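/- Let Γ be a commutative thick weakly distance-regular digraph, and let q, p be distinct elements of T = {s : (1,s-1) ∈ ∂̃(Γ)}. Then at least one of the following holds: (i) C(q) exists and p = q-1; (ii) C(p) exists and q = p-1; (iii) Γ_{1,q-1}^2 ∩ Γ_{1,p-1}Γ_{p-1,1} ≠ ∅; (iv) Γ_{1,p-1}^2 ∩ Γ_{1,q-1}Γ_{q-1,1} ≠ ∅. -/

import Mathlib

/-!
Common framework: commutative thick weakly distance-regular digraphs.
-/

variable {V : Type*}

/-- There is a directed walk of length `n` from `x` to `y`. -/
def HasWalk (adj : V → V → Prop) (x y : V) (n : ℕ) : Prop :=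
  ∃ f : ℕ → V, f 0 = x ∧ f n = y ∧ ∀ i < n, adj (f i) (f (i + 1))

/-- Directed distance `∂(x,y)`. -/
noncomputable def ddist (adj : V → V → Prop) (x y : V) : ℕ :=
  sInf {n | HasWalk adj x y n}

/-- Two-way distance `∂̃(x,y) = (∂(x,y), ∂(y,x))`. -/
noncomputable def tdist (adj : V → V → Prop) (x y : V) : ℕ × ℕ :=
  (ddist adj x y, ddist adj y x)

/-- The pair `i` is an attained two-way distance, i.e. `i ∈ ∂̃(Γ)`. -/
def Attained (adj : V → V → Prop) (i : ℕ × ℕ) : Prop :=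
  ∃ x y : V, tdist adj x y = i

/-- Intersection number `p^h_{i,j}`: for attained `h` it is the common cardinality of
`{z | ∂̃(x,z) = i, ∂̃(z,y) = j}` over pairs with `∂̃(x,y) = h` (and `0` otherwise). -/
noncomputable def pnum (adj : V → V → Prop) (h i j : ℕ × ℕ) : ℕ :=
  sSup {n | ∃ x y : V, tdist adj x y = h ∧
    n = Set.ncard {z : V | tdist adj x z = i ∧ tdist adj z y = j}}

/-- Valency `k_i = |Γ_i(x)|`. -/
noncomputable def kval (adj : V → V → Prop) (i : ℕ × ℕ) : ℕ :=
  pnum adj (0, 0) i i.swap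

/-- Adjacency of the subdigraph `Δ_J`: arcs of type `(1, t-1)` for `t ∈ J`. -/
def deltaAdj (adj : V → V → Prop) (J : Set ℕ) (u v : V) : Prop :=
  ∃ t ∈ J, tdist adj u v = (1, t - 1)

/-- A circuit of length `s`. -/
def IsCircuit (adj : V → V → Prop) (s : ℕ) (f : ℕ → V) : Prop :=
  0 < s ∧ f s = f 0 ∧ ∀ i < s, adj (f i) (f (i + 1))

/-- Strongly connected. -/
def IsStrong (adj : V → V → Prop) : Prop :=
  ∀ x y : V, ∃ n, HasWalk adj x y n

/-- Weakly distance-regular: the intersection numbers are well defined. -/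
def IsWDR (adj : V → V → Prop) : Prop :=
  ∀ (i j : ℕ × ℕ) (x y x' y' : V), tdist adj x y = tdist adj x' y' →
    Set.ncard {z : V | tdist adj x z = i ∧ tdist adj z y = j}
      = Set.ncard {z : V | tdist adj x' z = i ∧ tdist adj z y' = j}

/-- Thick: `p^h_{i,i}, p^h_{i,i*} ∈ {0, k_i}`. -/
def IsThick (adj : V → V → Prop) : Prop :=
  ∀ h i : ℕ × ℕ,
    (pnum adj h i i = 0 ∨ pnum adj h i i = kval adj i) ∧
    (pnum adj h i i.swap = 0 ∨ pnum adj h i i.swap = kval adj i)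

/-- A thick weakly distance-regular digraph (as a property of an adjacency relation). -/
def IsWDRThick (adj : V → V → Prop) : Prop :=
  IsStrong adj ∧ IsWDR adj ∧ IsThick adj

/-- A commutative thick weakly distance-regular digraph. -/
structure CTWDR (V : Type*) [Fintype V] where
  adj : V → V → Prop
  loopless : ∀ v, ¬ adj v v
  strong : IsStrong adj
  wdr : IsWDR adj
  comm : ∀ (i j : ℕ × ℕ) (x y : V),
    Set.ncard {z : V | tdist adj x z = i ∧ tdist adj z y = j}
      = Set.ncard {z : V | tdist adj x z = j ∧ tdist adj z y = i}
  thick : IsThick adj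

namespace CTWDR

variable {V : Type*} [Fintype V] (G : CTWDR V)

/-- Product `EF` of two sets of relations (relations identified with two-way distances). -/
def prodS (E F : Set (ℕ × ℕ)) : Set (ℕ × ℕ) :=
  {h | ∃ i ∈ E, ∃ j ∈ F, pnum G.adj h i j ≠ 0}

/-- Powers `Γ_i^l` (with `Γ_i^0 = {Γ_{(0,0)}}` and `Γ_i^1 = {Γ_i}`). -/
def pow (i : ℕ × ℕ) : ℕ → Set (ℕ × ℕ)
  | 0 => {(0, 0)}
  | 1 => {i}
  | n + 2 => G.prodS (pow i (n + 1)) {i}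

/-- The pair `(1, s-1)` is pure: every circuit of length `s` containing an arc of type
`(1, s-1)` consists of arcs of type `(1, s-1)`. -/
def Pure (s : ℕ) : Prop :=
  ∀ f : ℕ → V, IsCircuit G.adj s f →
    (∃ i < s, tdist G.adj (f i) (f (i + 1)) = (1, s - 1)) →
    ∀ i < s, tdist G.adj (f i) (f (i + 1)) = (1, s - 1)

/-- `(1, s-1)` is mixed. -/
def Mixed (s : ℕ) : Prop := ¬ G.Pure s

/-- Configuration `C(q)` exists. -/
def Cexists (q : ℕ) : Prop :=
  pnum G.adj (1, q - 2) (1, q - 1) (1, q - 1) ≠ 0 ∧ G.Pure (q - 1)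

/-- Configuration `D(q)` exists. -/
def Dexists (q : ℕ) : Prop :=
  pnum G.adj (1, q - 1) (1, q - 2) (q - 2, 1) ≠ 0 ∧ G.Pure (q - 1)

/-- A closed set of relations: `Γ_{i*}Γ_j ⊆ F` for all `i, j ∈ F`. -/
def Closed (F : Set (ℕ × ℕ)) : Prop :=
  ∀ i ∈ F, ∀ j ∈ F, G.prodS {i.swap} {j} ⊆ F

/-- The minimal closed set `⟨F⟩` containing `F`. -/
def genClosed (F : Set (ℕ × ℕ)) : Set (ℕ × ℕ) :=
  ⋂₀ {C | F ⊆ C ∧ G.Closed C}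

/-- The block `F_J(x)` of the closed set generated by `{Γ_{1,t-1}}_{t ∈ J}`. -/
def block (J : Set ℕ) (x : V) : Set V :=
  {y | tdist G.adj x y ∈ G.genClosed {i | ∃ t ∈ J, i = (1, t - 1)}}

end CTWDR

set_option linter.all false
set_option autoImplicit false

/-! ### Abstract calculus -/

section Calc
universe u
variable {R : Type u}

open Classical in
noncomputable def dl (x : R) : R → ℤ := Pi.single x 1

noncomputable def vec (m : Multiset R) : R → ℤ := (m.map dl).sum

def Ov (S : Set R) (v : R → ℤ) : Prop := ∀ x, x ∉ S → v x = 0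

@[simp] theorem vec_zero : vec (0 : Multiset R) = 0 := by simp [vec]
@[simp] theorem vec_cons (x : R) (m : Multiset R) : vec (x ::ₘ m) = dl x + vec m := by simp [vec]
@[simp] theorem vec_singleton (x : R) : vec ({x} : Multiset R) = dl x := by simp [vec]
@[simp] theorem vec_add (m n : Multiset R) : vec (m + n) = vec m + vec n := by simp [vec]
@[simp] theorem vec_rep (n : ℕ) (x : R) :
    vec (Multiset.replicate n x) = (n : ℤ) • dl x := by simp [vec]
open Classical in
theorem vec_apply (m : Multiset R) (x : R) : vec m x = m.count x := by
  induction m using Multiset.induction with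
  | empty => simp
  | cons a m ih =>
    simp only [vec_cons, Pi.add_apply, ih, dl, Multiset.count_cons, Pi.single_apply]
    split_ifs <;> push_cast <;> ring
theorem vec_inj {m n : Multiset R} (h : vec m = vec n) : m = n := by
  classical
  ext x
  have := congrFun h x
  rw [vec_apply, vec_apply] at this
  exact_mod_cast this

@[simp] theorem Ov_zero (S : Set R) : Ov S 0 := fun _ _ => rfl
@[simp] theorem Ov_add {S : Set R} {u v : R → ℤ} (h : Ov S u) (h' : Ov S v) : Ov S (u + v) := by
  intro x hx; simp [h x hx, h' x hx]
@[simp] theorem Ov_sub {S : Set R} {u v : R → ℤ} (h : Ov S u) (h' : Ov S v) : Ov S (u - v) := by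
  intro x hx; simp [h x hx, h' x hx]
@[simp] theorem Ov_neg {S : Set R} {v : R → ℤ} (h' : Ov S v) : Ov S (-v) := by
  intro x hx; simp [h' x hx]
@[simp] theorem Ov_smul {S : Set R} {v : R → ℤ} (n : ℤ) (h' : Ov S v) : Ov S (n • v) := by
  intro x hx; simp [h' x hx]
@[simp] theorem Ov_nsmul {S : Set R} {v : R → ℤ} (n : ℕ) (h' : Ov S v) : Ov S (n • v) := by
  intro x hx; simp [h' x hx]
@[simp] theorem Ov_dl {S : Set R} {x : R} (h : x ∈ S) : Ov S (dl x) := by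
  classical
  intro y hy
  have : y ≠ x := fun h' => hy (h' ▸ h)
  simp [dl, this]
@[simp] theorem Ov_vec {S : Set R} {m : Multiset R} (h : ∀ x ∈ m, x ∈ S) : Ov S (vec m) := by
  classical
  intro y hy
  rw [vec_apply]
  have : y ∉ m := fun h' => hy (h y h')
  simp [this]
theorem Ov.mono {S T : Set R} {v : R → ℤ} (h : Ov S v) (hs : S ⊆ T) : Ov T v :=
  fun x hx => h x (fun h' => hx (hs h'))

/-- the set of letters of a word -/
def lts (m : Multiset R) : Set R := {x | x ∈ m}
@[simp] theorem mem_lts {m : Multiset R} {x : R} : x ∈ lts m ↔ x ∈ m := Iff.rfl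

structure Sys (R : Type u) where
  l : R → ℕ
  r : R → ℕ
  Lam : Set R → (R → ℤ) → Prop
  inj : ∀ {x y : R}, l x = l y → r x = r y → x = y
  zero : ∀ S : Set R, Lam S 0
  add : ∀ {S : Set R} {u v : R → ℤ}, Lam S u → Lam S v → Lam S (u + v)
  neg : ∀ {S : Set R} {v : R → ℤ}, Lam S v → Lam S (-v)
  mono : ∀ {S T : Set R} {v : R → ℤ}, Lam S v → S ⊆ T → Lam T v
  ext : ∀ {S T : Set R} {u v : R → ℤ}, Ov S u → Ov T v → Lam (S ∪ T) (u + v) →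
    ∃ x, Lam (insert x S) (dl x - u) ∧ Lam (insert x T) (dl x + v)
  dom : ∀ {S T : Set R} {x : R} {u v : R → ℤ}, Lam (insert x S) (dl x - v) → Ov S v → S ⊆ T →
    Ov T u → Lam (insert x T) u → Lam T u
  sep : ∀ {x y : R}, Lam {x, y} (dl x - dl y) → x = y
  l_le : ∀ {x : R} {m : Multiset R}, (∀ y ∈ m, l y = 1) →
    Lam (insert x (lts m)) (dl x - vec m) → l x ≤ m.card
  r_le : ∀ {x : R} {m : Multiset R}, (∀ y ∈ m, l y = 1) →
    Lam (insert x (lts m)) (dl x + vec m) → r x ≤ m.card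
  l_ex : ∀ x : R, ∃ m : Multiset R, (∀ y ∈ m, l y = 1) ∧ m.card = l x ∧
    Lam (insert x (lts m)) (dl x - vec m)
  r_ex : ∀ x : R, ∃ m : Multiset R, (∀ y ∈ m, l y = 1) ∧ m.card = r x ∧
    Lam (insert x (lts m)) (dl x + vec m)

end Calc


section Inst
universe u
variable {V : Type u} [Fintype V] (G : CTWDR V)

theorem exWalk (x y : V) : HasWalk G.adj x y (ddist G.adj x y) :=
  Nat.sInf_mem (s := {n | HasWalk G.adj x y n}) (G.strong x y)

theorem ddist_le {x y : V} {n : ℕ} (h : HasWalk G.adj x y n) : ddist G.adj x y ≤ n :=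
  Nat.sInf_le h

theorem hw_zero {x y : V} : HasWalk G.adj x y 0 ↔ x = y := by
  constructor
  · rintro ⟨f, h0, h1, _⟩; rw [← h0, ← h1]
  · rintro rfl; exact ⟨fun _ => x, rfl, rfl, fun i hi => by omega⟩

theorem hw_succ {x y : V} {n : ℕ} :
    HasWalk G.adj x y (n + 1) ↔ ∃ z, G.adj x z ∧ HasWalk G.adj z y n := by
  constructor
  · rintro ⟨f, h0, h1, h2⟩
    refine ⟨f 1, ?_, fun i => f (i + 1), rfl, h1, fun i hi => h2 (i + 1) (by omega)⟩
    have := h2 0 (by omega)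
    rwa [h0] at this
  · rintro ⟨z, hz, f, h0, h1, h2⟩
    refine ⟨fun i => Nat.casesOn i x f, rfl, h1, ?_⟩
    intro i hi
    cases i with
    | zero => simpa [h0] using hz
    | succ k => exact h2 k (by omega)

theorem dd_zero {x y : V} : ddist G.adj x y = 0 ↔ x = y := by
  constructor
  · intro h; have := exWalk G x y; rw [h] at this; exact (hw_zero G).1 this
  · rintro rfl; exact Nat.le_zero.1 (ddist_le G ((hw_zero G).2 rfl))

theorem dd_one {x y : V} : ddist G.adj x y = 1 ↔ G.adj x y := by
  constructor
  · intro h; have := exWalk G x y; rw [h] at this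
    obtain ⟨z, hz, hz'⟩ := (hw_succ G).1 this
    rw [← (hw_zero G).1 hz']; exact hz
  · intro h
    have h1 : ddist G.adj x y ≤ 1 :=
      ddist_le G ((hw_succ G).2 ⟨y, h, (hw_zero G).2 rfl⟩)
    have h2 : ddist G.adj x y ≠ 0 := by
      intro h0; rw [(dd_zero G).1 h0] at h; exact G.loopless _ h
    omega

theorem td_swap (x y : V) : tdist G.adj y x = (tdist G.adj x y).swap := rfl

/-- coherent relations -/
def Coh : Type u := {A : V → V → Prop //
  ∀ x y x' y', tdist G.adj x y = tdist G.adj x' y' → A x y → A x' y'}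

variable {G}

theorem Coh.ext' {A B : Coh G} (h : ∀ x y, A.1 x y ↔ B.1 x y) : A = B := by
  apply Subtype.ext; funext x y; exact propext (h x y)

theorem wit {i j : ℕ × ℕ} {x y x' y' z : V} (h : tdist G.adj x y = tdist G.adj x' y')
    (h1 : tdist G.adj x z = i) (h2 : tdist G.adj z y = j) :
    ∃ z', tdist G.adj x' z' = i ∧ tdist G.adj z' y' = j := by
  have := G.wdr i j x y x' y' h
  have hp : 0 < Set.ncard {z : V | tdist G.adj x z = i ∧ tdist G.adj z y = j} :=
    (Set.ncard_pos (Set.toFinite _)).2 ⟨z, h1, h2⟩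
  rw [this] at hp
  exact (Set.ncard_pos (Set.toFinite _)).1 hp

theorem witc {i j : ℕ × ℕ} {x y z : V}
    (h1 : tdist G.adj x z = i) (h2 : tdist G.adj z y = j) :
    ∃ z', tdist G.adj x z' = j ∧ tdist G.adj z' y = i := by
  have := G.comm i j x y
  have hp : 0 < Set.ncard {z : V | tdist G.adj x z = i ∧ tdist G.adj z y = j} :=
    (Set.ncard_pos (Set.toFinite _)).2 ⟨z, h1, h2⟩
  rw [this] at hp
  exact (Set.ncard_pos (Set.toFinite _)).1 hp

def Coh.mul (A B : Coh G) : Coh G := ⟨fun x y => ∃ z, A.1 x z ∧ B.1 z y, by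
  rintro x y x' y' h ⟨z, h1, h2⟩
  obtain ⟨z', a, b⟩ := wit h (rfl : tdist G.adj x z = _) rfl
  exact ⟨z', A.2 _ _ _ _ a.symm h1, B.2 _ _ _ _ b.symm h2⟩⟩

def Coh.one : Coh G := ⟨fun x y => x = y, by
  rintro x y x' y' h rfl
  have h0 : tdist G.adj x x = (0,0) := by simp [tdist, (dd_zero G).2]
  rw [h0] at h
  exact (dd_zero G).1 (congrArg Prod.fst h).symm⟩

instance : CommMonoid (Coh G) where
  mul := Coh.mul
  one := Coh.one
  mul_assoc A B C := Coh.ext' fun x y => by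
    constructor
    · rintro ⟨z, ⟨w, h1, h2⟩, h3⟩; exact ⟨w, h1, z, h2, h3⟩
    · rintro ⟨w, h1, z, h2, h3⟩; exact ⟨z, ⟨w, h1, h2⟩, h3⟩
  one_mul A := Coh.ext' fun x y => by
    constructor
    · rintro ⟨z, rfl, h⟩; exact h
    · intro h; exact ⟨x, rfl, h⟩
  mul_one A := Coh.ext' fun x y => by
    constructor
    · rintro ⟨z, h, rfl⟩; exact h
    · intro h; exact ⟨y, h, rfl⟩
  mul_comm A B := Coh.ext' fun x y => by
    constructor
    · rintro ⟨z, h1, h2⟩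
      obtain ⟨z', a, b⟩ := witc (rfl : tdist G.adj x z = _) (rfl : tdist G.adj z y = _)
      exact ⟨z', B.2 _ _ _ _ a.symm h2, A.2 _ _ _ _ b.symm h1⟩
    · rintro ⟨z, h1, h2⟩
      obtain ⟨z', a, b⟩ := witc (rfl : tdist G.adj x z = _) (rfl : tdist G.adj z y = _)
      exact ⟨z', A.2 _ _ _ _ a.symm h2, B.2 _ _ _ _ b.symm h1⟩

theorem Coh.one_def (x y : V) : (1 : Coh G).1 x y ↔ x = y := Iff.rfl

def Coh.st (A : Coh G) : Coh G := ⟨fun x y => A.1 y x, by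
  intro x y x' y' h h1
  refine A.2 y x y' x' ?_ h1
  rw [td_swap, h, ← td_swap]⟩

theorem Coh.st_mul (A B : Coh G) : (A * B).st = A.st * B.st := by
  rw [mul_comm A.st]
  exact Coh.ext' fun x y => ⟨fun ⟨z, a, b⟩ => ⟨z, b, a⟩, fun ⟨z, a, b⟩ => ⟨z, b, a⟩⟩
theorem Coh.st_one : (1 : Coh G).st = 1 := Coh.ext' fun x y => ⟨Eq.symm, Eq.symm⟩
theorem Coh.st_st (A : Coh G) : A.st.st = A := rfl

def Coh.Z (A : Coh G) : Prop := ∃ x, A.1 x x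

theorem td_self (x : V) : tdist G.adj x x = (0,0) := by simp [tdist, (dd_zero G).2]

theorem Coh.Z.all {A : Coh G} (h : A.Z) (x : V) : A.1 x x := by
  obtain ⟨y, hy⟩ := h
  exact A.2 _ _ _ _ (by rw [td_self, td_self]) hy

theorem Coh.Z.mul {A B : Coh G} (h : A.Z) (h' : B.Z) : (A * B).Z := by
  obtain ⟨y, hy⟩ := h
  exact ⟨y, y, hy, h'.all y⟩
theorem Coh.Z.st {A : Coh G} (h : A.Z) : A.st.Z := h

variable (G) in
abbrev RelG : Type := {i : ℕ × ℕ // Attained G.adj i}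

def cls (i : RelG G) : Coh G := ⟨fun x y => tdist G.adj x y = i.1, by
  intro x y x' y' h h1; rw [← h, h1]⟩

theorem cls_def (i : RelG G) (x y : V) : (cls i).1 x y ↔ tdist G.adj x y = i.1 := Iff.rfl

theorem pnum_eq (i j : ℕ × ℕ) (x y : V) : pnum G.adj (tdist G.adj x y) i j =
    Set.ncard {z : V | tdist G.adj x z = i ∧ tdist G.adj z y = j} := by
  unfold pnum
  have : {n | ∃ x' y' : V, tdist G.adj x' y' = tdist G.adj x y ∧
    n = Set.ncard {z : V | tdist G.adj x' z = i ∧ tdist G.adj z y' = j}} =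
    {Set.ncard {z : V | tdist G.adj x z = i ∧ tdist G.adj z y = j}} := by
    ext n
    constructor
    · rintro ⟨x', y', h, rfl⟩; exact G.wdr _ _ _ _ _ _ h
    · rintro rfl; exact ⟨x, y, rfl, rfl⟩
  rw [this, csSup_singleton]

theorem kval_eq (i : ℕ × ℕ) (x : V) : kval G.adj i = Set.ncard {z : V | tdist G.adj x z = i} := by
  unfold kval
  rw [← td_self (G := G) x, pnum_eq]
  congr 1
  ext z
  simp only [Set.mem_setOf_eq, and_iff_left_iff_imp]
  rintro rfl; rfl

theorem cls_out (i : RelG G) (x : V) : ∃ y, tdist G.adj x y = i.1 := by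
  obtain ⟨a, b, h⟩ := i.2
  obtain ⟨z, h1, h2⟩ := wit (G := G) (x := a) (y := a) (x' := x) (y' := x) (z := b)
    (by rw [td_self, td_self]) h rfl
  exact ⟨z, h1⟩

theorem cls_nbr {i : RelG G} {x y z : V} (hx : tdist G.adj x z = i.1) (hy : tdist G.adj y z = i.1) :
    ∀ w, tdist G.adj y w = i.1 → tdist G.adj x w = i.1 := by
  have h := (G.thick (tdist G.adj x y) i.1).2
  have hn : 0 < pnum G.adj (tdist G.adj x y) i.1 i.1.swap := by
    rw [pnum_eq]
    refine (Set.ncard_pos (Set.toFinite _)).2 ⟨z, hx, ?_⟩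
    rw [td_swap, hy]
  have h2 : pnum G.adj (tdist G.adj x y) i.1 i.1.swap = kval G.adj i.1 := by
    rcases h with h | h
    · omega
    · exact h
  rw [pnum_eq, kval_eq i.1 y] at h2
  have hs : {z : V | tdist G.adj x z = i.1 ∧ tdist G.adj z y = i.1.swap} ⊆
      {z : V | tdist G.adj y z = i.1} := by
    rintro w ⟨_, h⟩
    simp only [Set.mem_setOf_eq]
    rw [td_swap, h]; rfl
  have := Set.eq_of_subset_of_ncard_le hs (by rw [h2]) (Set.toFinite _)
  intro w hw
  have hw' : w ∈ {z : V | tdist G.adj y z = i.1} := hw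
  rw [← this] at hw'
  exact hw'.1

theorem cls_reg (i : RelG G) : cls i * (cls i * (cls i).st) = cls i := by
  have e : cls i * (cls i * (cls i).st) = (cls i * (cls i).st) * cls i := mul_comm _ _
  rw [e]
  apply Coh.ext'
  intro x y
  constructor
  · rintro ⟨w, ⟨z, h1, h2⟩, h3⟩
    exact cls_nbr (i := i) h1 h2 y h3
  · intro h
    exact ⟨x, ⟨y, h, h⟩, h⟩

noncomputable def Wd (m : Multiset (RelG G)) : Coh G := (m.map cls).prod

@[simp] theorem Wd_zero : Wd (0 : Multiset (RelG G)) = 1 := by simp [Wd]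
@[simp] theorem Wd_cons (i : RelG G) (m : Multiset (RelG G)) : Wd (i ::ₘ m) = cls i * Wd m := by
  simp [Wd]
@[simp] theorem Wd_add (m n : Multiset (RelG G)) : Wd (m + n) = Wd m * Wd n := by simp [Wd]
@[simp] theorem Wd_single (i : RelG G) : Wd {i} = cls i := by simp [Wd]

theorem Wd_self (m : Multiset (RelG G)) [Nonempty V] : (Wd m * (Wd m).st).Z := by
  induction m using Multiset.induction with
  | empty => exact ⟨Classical.arbitrary V, _, rfl, rfl⟩
  | cons a m ih =>
    have e : Wd (a ::ₘ m) * (Wd (a ::ₘ m)).st = (cls a * (cls a).st) * (Wd m * (Wd m).st) := by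
      rw [Wd_cons, Coh.st_mul]; ac_rfl
    rw [e]
    refine Coh.Z.mul ?_ ih
    obtain ⟨y, hy⟩ := cls_out a (Classical.arbitrary V)
    exact ⟨_, y, hy, hy⟩

theorem Wd_abs {m n : Multiset (RelG G)} {x : RelG G} (h : x ∈ m ∨ x ∈ n) :
    (Wd m * (Wd n).st) * (cls x * (cls x).st) = Wd m * (Wd n).st := by
  rcases h with h | h
  · obtain ⟨m', rfl⟩ := Multiset.exists_cons_of_mem h
    have e : (Wd (x ::ₘ m') * (Wd n).st) * (cls x * (cls x).st) =
      (cls x * (cls x * (cls x).st)) * Wd m' * (Wd n).st := by rw [Wd_cons]; ac_rfl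
    rw [e, cls_reg, Wd_cons]
  · obtain ⟨m', rfl⟩ := Multiset.exists_cons_of_mem h
    have e : (Wd m * (Wd (x ::ₘ m')).st) * (cls x * (cls x).st) =
      (cls x * (cls x * (cls x).st)).st * Wd m * (Wd m').st := by
        rw [Wd_cons, Coh.st_mul, Coh.st_mul, Coh.st_mul, Coh.st_st]; ac_rfl
    rw [e, cls_reg, Wd_cons, Coh.st_mul]; ac_rfl

theorem Wd_abs' {m n k : Multiset (RelG G)} (h : ∀ x ∈ k, x ∈ m ∨ x ∈ n) :
    (Wd m * (Wd n).st) * (Wd k * (Wd k).st) = Wd m * (Wd n).st := by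
  induction k using Multiset.induction with
  | empty => simp [Coh.st_one]
  | cons a k ih =>
    have e : (Wd m * (Wd n).st) * (Wd (a ::ₘ k) * (Wd (a ::ₘ k)).st) =
      ((Wd m * (Wd n).st) * (Wd k * (Wd k).st)) * (cls a * (cls a).st) := by
      rw [Wd_cons, Coh.st_mul]; ac_rfl
    rw [e, ih (fun x hx => h x (Multiset.mem_cons_of_mem hx)), Wd_abs (h a (Multiset.mem_cons_self a k))]

def LamG (S : Set (RelG G)) (v : RelG G → ℤ) : Prop :=
  ∃ m n : Multiset (RelG G), (∀ x ∈ m, x ∈ S) ∧ (∀ x ∈ n, x ∈ S) ∧ v = vec m - vec n ∧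
    (Wd m * (Wd n).st).Z

theorem rigid {S : Set (RelG G)} {v : RelG G → ℤ} (h : LamG S v) {m n : Multiset (RelG G)}
    (hc : ∀ x ∈ S, x ∈ m ∨ x ∈ n) (hv : v = vec m - vec n) : (Wd m * (Wd n).st).Z := by
  obtain ⟨m0, n0, hm, hn, hv0, hz⟩ := h
  have : Nonempty V := by obtain ⟨x, _⟩ := hz; exact ⟨x⟩
  have e : m + n0 = n + m0 := by
    apply vec_inj
    rw [vec_add, vec_add]
    rw [hv] at hv0
    have := congrArg (· + vec n + vec n0) hv0
    calc vec m + vec n0 = vec m - vec n + vec n + vec n0 := by abel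
      _ = vec m0 - vec n0 + vec n + vec n0 := this
      _ = _ := by abel
  rw [← Wd_abs' (k := n0) (fun x hx => hc x (hn x hx))]
  have e2 : (Wd m * (Wd n).st) * (Wd n0 * (Wd n0).st) = (Wd n * (Wd n).st) * (Wd m0 * (Wd n0).st) := by
    calc _ = Wd (m + n0) * ((Wd n).st * (Wd n0).st) := by rw [Wd_add]; ac_rfl
      _ = _ := by rw [e, Wd_add]; ac_rfl
  rw [e2]
  exact Coh.Z.mul (Wd_self n) hz

open Classical in
theorem vec_sum {R : Type*} (s : Finset R) (f : R → ℕ) :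
    vec (∑ x ∈ s, Multiset.replicate (f x) x) = fun y => if y ∈ s then (f y : ℤ) else 0 := by
  funext y
  rw [vec_apply, Multiset.count_sum']
  simp only [Multiset.count_replicate]
  by_cases h : y ∈ s
  · simp [h, Finset.sum_ite_eq']
  · simp [h, Finset.sum_ite_eq']

instance : Finite (RelG G) := by
  have : Set.Finite {i | Attained G.adj i} := by
    have : {i | Attained G.adj i} = Set.range (fun p : V × V => tdist G.adj p.1 p.2) := by
      ext i; simp [Attained]
    rw [this]; exact Set.finite_range _
  exact this.to_subtype

theorem cover {R : Type*} [Finite R] {S : Set R} {v : R → ℤ} (h : Ov S v) :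
    ∃ m n : Multiset R, (∀ x, x ∈ m ↔ x ∈ S) ∧ (∀ x, x ∈ n ↔ x ∈ S) ∧ v = vec m - vec n := by
  classical
  have hS : S.Finite := Set.toFinite S
  refine ⟨∑ x ∈ hS.toFinset, Multiset.replicate ((v x).toNat + 1) x,
    ∑ x ∈ hS.toFinset, Multiset.replicate ((-v x).toNat + 1) x, ?_, ?_, ?_⟩
  · intro x; simp only [Multiset.mem_sum, Multiset.mem_replicate, Set.Finite.mem_toFinset]; constructor
    · rintro ⟨i, hi, _, rfl⟩; exact hi
    · intro h; exact ⟨x, h, by omega, rfl⟩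
  · intro x; simp only [Multiset.mem_sum, Multiset.mem_replicate, Set.Finite.mem_toFinset]; constructor
    · rintro ⟨i, hi, _, rfl⟩; exact hi
    · intro h; exact ⟨x, h, by omega, rfl⟩
  · rw [vec_sum, vec_sum]
    funext y
    by_cases hy : y ∈ S
    · simp [hy]
    · simp [hy, h y hy]

theorem Wd_walk {m : Multiset (RelG G)} (h : ∀ y ∈ m, y.1.1 = 1) :
    ∀ {x y : V}, (Wd m).1 x y → HasWalk G.adj x y m.card := by
  induction m using Multiset.induction with
  | empty => intro x y hx; simp only [Wd_zero, Coh.one_def] at hx; subst hx; exact (hw_zero G).2 rfl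
  | cons a m ih =>
    intro x y hx
    rw [Wd_cons] at hx
    obtain ⟨z, h1, h2⟩ := hx
    rw [Multiset.card_cons]
    refine (hw_succ G).2 ⟨z, ?_, ih (fun y hy => h y (Multiset.mem_cons_of_mem hy)) h2⟩
    have := h a (Multiset.mem_cons_self a m)
    rw [cls_def] at h1
    rw [← h1] at this
    exact (dd_one G).1 this

theorem walk_Wd {n : ℕ} : ∀ {x y : V}, HasWalk G.adj x y n →
    ∃ m : Multiset (RelG G), (∀ y ∈ m, y.1.1 = 1) ∧ m.card = n ∧ (Wd m).1 x y := by
  induction n with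
  | zero => intro x y h; exact ⟨0, by simp, rfl, by rw [Wd_zero]; exact (hw_zero G).1 h⟩
  | succ n ih =>
    intro x y h
    obtain ⟨z, h1, h2⟩ := (hw_succ G).1 h
    obtain ⟨m, a, b, c⟩ := ih h2
    refine ⟨(⟨tdist G.adj x z, x, z, rfl⟩ : RelG G) ::ₘ m, ?_, by simp [b], ?_⟩
    · intro w hw
      rcases Multiset.mem_cons.1 hw with rfl | hw
      · exact (dd_one G).2 h1
      · exact a w hw
    · rw [Wd_cons]; exact ⟨z, rfl, c⟩

theorem LamG_add {S : Set (RelG G)} {u v : RelG G → ℤ} (h : LamG S u) (h' : LamG S v) :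
    LamG S (u + v) := by
  obtain ⟨m, n, a, b, c, d⟩ := h
  obtain ⟨m', n', a', b', c', d'⟩ := h'
  refine ⟨m + m', n + n', ?_, ?_, ?_, ?_⟩
  · intro x hx; rcases Multiset.mem_add.1 hx with h | h; exacts [a x h, a' x h]
  · intro x hx; rcases Multiset.mem_add.1 hx with h | h; exacts [b x h, b' x h]
  · rw [c, c', vec_add, vec_add]; abel
  · have e : Wd (m + m') * (Wd (n + n')).st = (Wd m * (Wd n).st) * (Wd m' * (Wd n').st) := by
      rw [Wd_add, Wd_add, Coh.st_mul]; ac_rfl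
    rw [e]; exact d.mul d'

noncomputable def sysG (G : CTWDR V) [Nonempty V] : Sys (RelG G) where
  l x := x.1.1
  r x := x.1.2
  Lam := LamG
  inj h h' := Subtype.ext (Prod.ext h h')
  zero S := ⟨0, 0, by simp, by simp, by simp, ⟨Classical.arbitrary V, _, rfl, rfl⟩⟩
  add := LamG_add
  neg := by
    rintro S v ⟨m, n, a, b, rfl, d⟩
    refine ⟨n, m, b, a, by abel, ?_⟩
    have : Wd n * (Wd m).st = (Wd m * (Wd n).st).st := by
      rw [Coh.st_mul, Coh.st_st, mul_comm]
    rw [this]; exact d.st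
  mono := by
    rintro S T v ⟨m, n, a, b, c, d⟩ hs
    exact ⟨m, n, fun x hx => hs (a x hx), fun x hx => hs (b x hx), c, d⟩
  ext := by
    intro S T u v hu hv h
    obtain ⟨m, n, a, b, c⟩ := cover hu
    obtain ⟨m', n', a', b', c'⟩ := cover hv
    have hz : (Wd (m + m') * (Wd (n + n')).st).Z := by
      refine rigid h ?_ ?_
      · rintro x (hx | hx)
        · exact Or.inl (Multiset.mem_add.2 (Or.inl ((a x).2 hx)))
        · exact Or.inl (Multiset.mem_add.2 (Or.inr ((a' x).2 hx)))
      · rw [c, c', vec_add, vec_add]; abel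
    have e : Wd (m + m') * (Wd (n + n')).st = (Wd m * (Wd n).st) * (Wd m' * (Wd n').st) := by
      rw [Wd_add, Wd_add, Coh.st_mul]; ac_rfl
    rw [e] at hz
    obtain ⟨p, w, h1, h2⟩ := hz
    refine ⟨⟨tdist G.adj p w, p, w, rfl⟩, ?_, ?_⟩
    · refine ⟨⟨tdist G.adj p w, p, w, rfl⟩ ::ₘ n, m, ?_, ?_, ?_, ?_⟩
      · intro x hx
        rcases Multiset.mem_cons.1 hx with rfl | hx
        · exact Or.inl rfl
        · exact Or.inr ((b x).1 hx)
      · intro x hx; exact Or.inr ((a x).1 hx)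
      · rw [c, vec_cons]; abel
      · rw [Wd_cons, mul_assoc]
        refine ⟨p, w, rfl, ?_⟩
        have : Wd n * (Wd m).st = (Wd m * (Wd n).st).st := by
          rw [Coh.st_mul, Coh.st_st, mul_comm]
        rw [this]; exact h1
    · refine ⟨⟨tdist G.adj p w, p, w, rfl⟩ ::ₘ m', n', ?_, ?_, ?_, ?_⟩
      · intro x hx
        rcases Multiset.mem_cons.1 hx with rfl | hx
        · exact Or.inl rfl
        · exact Or.inr ((a' x).1 hx)
      · intro x hx; exact Or.inr ((b' x).1 hx)
      · rw [c', vec_cons]; abel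
      · rw [Wd_cons, mul_assoc]
        exact ⟨p, w, rfl, h2⟩
  dom := by
    intro S T x u v h hv hs hu h'
    obtain ⟨m, n, a, b, c⟩ := cover hv
    obtain ⟨p, k, a', b', c'⟩ := cover hu
    have z1 : (Wd ({x} + n) * (Wd m).st).Z := by
      refine rigid h ?_ ?_
      · rintro y (rfl | hy)
        · left; simp
        · right; exact (a y).2 hy
      · rw [c, vec_add, vec_singleton]; abel
    have z2 : (Wd ({x} + p) * (Wd ({x} + k)).st).Z := by
      refine rigid h' ?_ ?_
      · rintro y (rfl | hy)
        · left; simp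
        · left; simp [(a' y).2 hy]
      · rw [c', vec_add, vec_add]; abel
    have hsub : ∀ y z, (cls x).1 y z → (Wd m * (Wd n).st).1 y z := by
      obtain ⟨y, hy⟩ := z1
      rw [Wd_add, Wd_single, mul_assoc] at hy
      obtain ⟨z, h1, h2⟩ := hy
      have : (Wd n * (Wd m).st) = (Wd m * (Wd n).st).st := by
          rw [Coh.st_mul, Coh.st_st, mul_comm]
      rw [this] at h2
      intro y' z' h3
      refine (Wd m * (Wd n).st).2 _ _ _ _ ?_ h2
      rw [cls_def] at h1 h3; rw [h1, h3]
    refine ⟨m + n + p, m + n + k, ?_, ?_, ?_, ?_⟩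
    · intro y hy
      simp only [Multiset.mem_add] at hy
      rcases hy with (hy | hy) | hy
      exacts [hs ((a y).1 hy), hs ((b y).1 hy), (a' y).1 hy]
    · intro y hy
      simp only [Multiset.mem_add] at hy
      rcases hy with (hy | hy) | hy
      exacts [hs ((a y).1 hy), hs ((b y).1 hy), (b' y).1 hy]
    · rw [c', vec_add, vec_add (m+n)]; abel
    · have e : Wd (m + n + p) * (Wd (m + n + k)).st =
        (Wd m * (Wd n).st) * ((Wd m * (Wd n).st).st * (Wd p * (Wd k).st)) := by
        simp only [Wd_add, Coh.st_mul, Coh.st_st]; ac_rfl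
      have e' : Wd ({x} + p) * (Wd ({x} + k)).st =
        cls x * ((cls x).st * (Wd p * (Wd k).st)) := by
        simp only [Wd_add, Coh.st_mul, Wd_single]; ac_rfl
      rw [e]; rw [e'] at z2
      obtain ⟨y, z, h1, w, h2, h3⟩ := z2
      exact ⟨y, z, hsub _ _ h1, w, hsub _ _ h2, h3⟩
  sep := by
    intro x y h
    have := rigid h (m := {x}) (n := {y}) (by rintro z (rfl | rfl) <;> simp) (by simp)
    obtain ⟨p, w, h1, h2⟩ := this
    rw [Wd_single] at h1 h2
    exact Subtype.ext (h1.symm.trans h2)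
  l_le := by
    intro x m hm h
    have := rigid h (m := {x}) (n := m) (by rintro z (rfl | h) <;> [simp; exact Or.inr h]) (by simp)
    obtain ⟨p, w, h1, h2⟩ := this
    rw [Wd_single] at h1
    have := ddist_le G (Wd_walk hm h2)
    rw [cls_def] at h1
    rw [← h1]; exact this
  r_le := by
    intro x m hm h
    have := rigid h (m := {x} + m) (n := 0) (by
      rintro z (rfl | h) <;> [simp; exact Or.inl (by simp [mem_lts.1 h])]) (by simp)
    rw [Wd_zero, Coh.st_one, mul_one, Wd_add, Wd_single] at this
    obtain ⟨p, w, h1, h2⟩ := this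
    have := ddist_le G (Wd_walk hm h2)
    rw [cls_def] at h1
    rw [← h1]; exact this
  l_ex := by
    intro x
    obtain ⟨p, w, h⟩ := x.2
    obtain ⟨m, a, b, c⟩ := walk_Wd (exWalk G p w)
    refine ⟨m, a, ?_, {x}, m, by simp, fun y hy => Or.inr hy, by simp, p, w, ?_, c⟩
    · rw [b, ← h]; rfl
    · rw [Wd_single]; exact h
  r_ex := by
    intro x
    obtain ⟨p, w, h⟩ := x.2
    obtain ⟨m, a, b, c⟩ := walk_Wd (exWalk G w p)
    refine ⟨m, a, ?_, {x} + m, 0, ?_, by simp, by simp, ?_⟩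
    · rw [b, ← h]; rfl
    · intro y hy
      rcases Multiset.mem_add.1 hy with h | h
      · left; simpa using h
      · right; exact h
    · rw [Wd_zero, Coh.st_one, mul_one, Wd_add, Wd_single]
      exact ⟨p, w, h, c⟩

end Inst


section Cls
universe u
variable {R : Type u}
class MemC (x : R) (T : Set R) : Prop where
  out : x ∈ T
class SubC (S T : Set R) : Prop where
  out : S ⊆ T
class OvC (S : Set R) (v : R → ℤ) : Prop where
  out : Ov S v
instance mem_one (x : R) : MemC x {x} := ⟨rfl⟩
instance (priority := 900) mem_ins' (x y : R) (T : Set R) [h : MemC x T] : MemC x (insert y T) := ⟨Or.inr h.1⟩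
instance mem_ins (x : R) (T : Set R) : MemC x (insert x T) := ⟨Or.inl rfl⟩
instance mem_un1 (x : R) (S T : Set R) [h : MemC x S] : MemC x (S ∪ T) := ⟨Or.inl h.1⟩
instance mem_un2 (x : R) (S T : Set R) [h : MemC x T] : MemC x (S ∪ T) := ⟨Or.inr h.1⟩
instance (priority := 900) mem_lts1 (x y : R) (m : Multiset R) [h : MemC x (lts m)] : MemC x (lts (y ::ₘ m)) :=
  ⟨Multiset.mem_cons_of_mem h.1⟩
instance mem_lts2 (x : R) (m : Multiset R) : MemC x (lts (x ::ₘ m)) := ⟨Multiset.mem_cons_self x m⟩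
instance mem_lts3 (x : R) (m n : Multiset R) [h : MemC x (lts m)] : MemC x (lts (m + n)) :=
  ⟨Multiset.mem_add.2 (Or.inl h.1)⟩
instance mem_lts4 (x : R) (m n : Multiset R) [h : MemC x (lts n)] : MemC x (lts (m + n)) :=
  ⟨Multiset.mem_add.2 (Or.inr h.1)⟩
instance mem_lts5 (x : R) (n : ℕ) : MemC x (lts (Multiset.replicate (n + 1) x)) :=
  ⟨Multiset.mem_replicate.2 ⟨Nat.succ_ne_zero n, rfl⟩⟩
instance mem_lts6 (x : R) : MemC x (lts {x}) := ⟨Multiset.mem_singleton_self x⟩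

instance sub_e (T : Set R) : SubC ∅ T := ⟨Set.empty_subset T⟩
instance sub_one (x : R) (T : Set R) [h : MemC x T] : SubC {x} T := ⟨Set.singleton_subset_iff.2 h.1⟩
instance sub_ins (x : R) (S T : Set R) [h : MemC x T] [h' : SubC S T] : SubC (insert x S) T :=
  ⟨Set.insert_subset_iff.2 ⟨h.1, h'.1⟩⟩
instance sub_un (S S' T : Set R) [h : SubC S T] [h' : SubC S' T] : SubC (S ∪ S') T :=
  ⟨Set.union_subset h.1 h'.1⟩
instance (priority := 800) sub_l1 (m : Multiset R) (y : R) (T : Set R) [h : SubC (lts m) T] :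
    SubC (lts m) (insert y T) := ⟨h.1.trans (Set.subset_insert _ _)⟩
instance (priority := 800) sub_l2 (m : Multiset R) (S T : Set R) [h : SubC (lts m) S] :
    SubC (lts m) (S ∪ T) := ⟨h.1.trans Set.subset_union_left⟩
instance (priority := 800) sub_l3 (m : Multiset R) (S T : Set R) [h : SubC (lts m) T] :
    SubC (lts m) (S ∪ T) := ⟨h.1.trans Set.subset_union_right⟩
instance (priority := 800) sub_l4 (m : Multiset R) (y : R) (n : Multiset R) [h : SubC (lts m) (lts n)] :
    SubC (lts m) (lts (y ::ₘ n)) := ⟨h.1.trans fun _ h => Multiset.mem_cons_of_mem h⟩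
instance (priority := 800) sub_l5 (m n k : Multiset R) [h : SubC (lts m) (lts n)] :
    SubC (lts m) (lts (n + k)) := ⟨h.1.trans fun _ h => Multiset.mem_add.2 (Or.inl h)⟩
instance (priority := 800) sub_l6 (m n k : Multiset R) [h : SubC (lts m) (lts k)] :
    SubC (lts m) (lts (n + k)) := ⟨h.1.trans fun _ h => Multiset.mem_add.2 (Or.inr h)⟩
instance sub_z (T : Set R) : SubC (lts 0) T := ⟨fun _ h => absurd h (Multiset.notMem_zero _)⟩
instance sub_s (x : R) (T : Set R) [h : MemC x T] : SubC (lts {x}) T :=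
  ⟨fun y hy => by rw [Multiset.mem_singleton.1 hy]; exact h.1⟩
instance sub_c (x : R) (m : Multiset R) (T : Set R) [h : MemC x T] [h' : SubC (lts m) T] :
    SubC (lts (x ::ₘ m)) T := ⟨fun y hy => by
  rcases Multiset.mem_cons.1 hy with rfl | hy
  exacts [h.1, h'.1 hy]⟩
instance sub_a (m n : Multiset R) (T : Set R) [h : SubC (lts m) T] [h' : SubC (lts n) T] :
    SubC (lts (m + n)) T := ⟨fun y hy => by
  rcases Multiset.mem_add.1 hy with hy | hy
  exacts [h.1 hy, h'.1 hy]⟩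
instance sub_r (x : R) (n : ℕ) (T : Set R) [h : MemC x T] : SubC (lts (Multiset.replicate n x)) T :=
  ⟨fun y hy => by rw [Multiset.eq_of_mem_replicate hy]; exact h.1⟩
instance sub_r0 (x : R) (T : Set R) : SubC (lts (Multiset.replicate 0 x)) T :=
  ⟨fun y hy => absurd hy (Multiset.notMem_zero y)⟩
instance (priority := 1100) sub_refl (S : Set R) : SubC S S := ⟨subset_rfl⟩

instance ov_z (S : Set R) : OvC S 0 := ⟨Ov_zero S⟩
instance ov_a (S : Set R) (u v : R → ℤ) [h : OvC S u] [h' : OvC S v] : OvC S (u + v) := ⟨Ov_add h.1 h'.1⟩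
instance ov_s (S : Set R) (u v : R → ℤ) [h : OvC S u] [h' : OvC S v] : OvC S (u - v) := ⟨Ov_sub h.1 h'.1⟩
instance ov_n (S : Set R) (v : R → ℤ) [h' : OvC S v] : OvC S (-v) := ⟨Ov_neg h'.1⟩
instance ov_m (S : Set R) (v : R → ℤ) (n : ℤ) [h' : OvC S v] : OvC S (n • v) := ⟨Ov_smul n h'.1⟩
instance ov_m' (S : Set R) (v : R → ℤ) (n : ℕ) [h' : OvC S v] : OvC S (n • v) := ⟨Ov_nsmul n h'.1⟩
instance ov_d (S : Set R) (x : R) [h : MemC x S] : OvC S (dl x) := ⟨Ov_dl h.1⟩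
instance ov_v (S : Set R) (m : Multiset R) [h : SubC (lts m) S] : OvC S (vec m) := ⟨Ov_vec fun _ hx => h.1 hx⟩
end Cls

namespace Sys
universe u
variable {R : Type u} (A : Sys R)

abbrev rp (n : ℕ) (x : R) : Multiset R := Multiset.replicate n x

def Circ (m : Multiset R) : Prop := (∀ y ∈ m, A.l y = 1) ∧ A.Lam (lts m) (vec m)
def In (x : R) (m : Multiset R) : Prop := A.Lam (insert x (lts m)) (dl x - vec m)
def Dom (x : R) (S : Set R) : Prop :=
  ∀ (T : Set R) (u : R → ℤ), S ⊆ T → Ov T u → A.Lam (insert x T) u → A.Lam T u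

local infixr:67 ":>" => Multiset.cons
local notation "tz" => (2 : ℤ)
local notation "oo" => (by omega)
local notation "bs" => (by simp)
variable {A}
variable {a b c c' d d' e f g h k o s t x y z : R} {U W W' X m m' : Multiset R} {M i i' j j' n : ℕ} {S S' S'' S3 T : Set R} {u v v' v'' v3 v₁ v₂ w : R → ℤ}

theorem arcs_zero : ∀ y ∈ (0 : Multiset R), A.l y = 1 := fun y hy => absurd hy (Multiset.notMem_zero y)
theorem arcs_cons (h : A.l x = 1) (h' : ∀ y ∈ m, A.l y = 1) :
    ∀ y ∈ x :> m, A.l y = 1 := by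
  intro y hy
  rcases Multiset.mem_cons.1 hy with rfl | hy
  exacts [h, h' y hy]
theorem arcs_add {n : Multiset R} (h : ∀ y ∈ n, A.l y = 1) (h' : ∀ y ∈ m, A.l y = 1) :
    ∀ y ∈ n + m, A.l y = 1 := by
  intro y hy
  rcases Multiset.mem_add.1 hy with hy | hy
  exacts [h y hy, h' y hy]
theorem arcs_rep (h : A.l x = 1) : ∀ y ∈ Multiset.replicate n x, A.l y = 1 := by
  intro y hy; rw [Multiset.eq_of_mem_replicate hy]; exact h
theorem arcs_one (h : A.l x = 1) : ∀ y ∈ ({x} : Multiset R), A.l y = 1 := by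
  intro y hy; rw [Multiset.mem_singleton.1 hy]; exact h

theorem ij (A : Sys R) {x y : R} (h : A.l x = A.l y := by omega) (h' : A.r x = A.r y := by omega) : x = y :=
  A.inj h h'

theorem smul (h : A.Lam S v) (n : ℤ) : A.Lam S (n • v) := by
  induction n using Int.induction_on with
  | zero => rw [zero_smul]; exact A.zero S
  | succ i ih => rw [add_smul, one_smul]; exact A.add ih h
  | pred i ih => rw [sub_smul, one_smul, sub_eq_add_neg]; exact A.add ih (A.neg h)

theorem c1 (n : ℤ) (h : A.Lam S v)
    (e : u = n • v := by push_cast <;> module)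
    [s : SubC (S) (T)] : A.Lam T u := by
  rw [e]; exact A.mono (smul h n) s.1

theorem c2 (n : ℤ) (h : A.Lam S v) (n' : ℤ) (h' : A.Lam S' v')
    (e : u = n • v + n' • v' := by push_cast <;> module)
    [s : SubC (S) (T)]
    [s' : SubC (S') (T)] : A.Lam T u := by
  rw [e]; exact A.add (A.mono (smul h n) s.1) (A.mono (smul h' n') s'.1)

theorem c3 (n : ℤ) (h : A.Lam S v) (n' : ℤ)
    (h' : A.Lam S' v') (n'' : ℤ) (h'' : A.Lam S'' v'')
    (e : u = n • v + n' • v' + n'' • v'' := by push_cast <;> module)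
    [s : SubC (S) (T)]
    [s' : SubC (S') (T)]
    [s'' : SubC (S'') (T)] : A.Lam T u := by
  rw [e]
  exact A.add (A.add (A.mono (smul h n) s.1) (A.mono (smul h' n') s'.1)) (A.mono (smul h'' n'') s''.1)

theorem c4 (n : ℤ) (h : A.Lam S v) (n' : ℤ)
    (h' : A.Lam S' v') (n'' : ℤ) (h'' : A.Lam S'' v'') (n3 : ℤ) (h3 : A.Lam S3 v3)
    (e : u = n • v + n' • v' + n'' • v'' + n3 • v3 := by push_cast <;> module)
    [s : SubC (S) (T)]
    [s' : SubC (S') (T)]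
    [s'' : SubC (S'') (T)]
    [s3 : SubC (S3) (T)] : A.Lam T u := by
  rw [e]
  exact A.add (A.add (A.add (A.mono (smul h n) s.1) (A.mono (smul h' n') s'.1))
    (A.mono (smul h'' n'') s''.1)) (A.mono (smul h3 n3) s3.1)

theorem domk (v : R → ℤ) (h : A.Lam (insert x S) (dl x - v))
    [o : OvC S v] : A.Dom x S :=
  fun T u hs hu h' => A.dom h o.1 hs hu h'

theorem Dom.drop {U : Set R} (d : A.Dom x S) (h : A.Lam U u)
    [s : SubC (U) (insert x T)]
    [s' : SubC (S) (T)]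
    [o : OvC T u] : A.Lam T u :=
  d T u s'.1 o.1 (A.mono h s.1)

/-- existence of a middle relation -/
theorem split {U : Set R} (S T : Set R) (u v : R → ℤ) (h : A.Lam U w)
    (e : w = u + v := by push_cast <;> module)
    [s : SubC (U) (S ∪ T)]
    [o : OvC S u] [o' : OvC T v] :
    ∃ x, A.Lam (insert x S) (dl x - u) ∧ A.Lam (insert x T) (dl x + v) := by
  subst e; exact A.ext o.1 o'.1 (A.mono h s.1)

theorem pick (S : Set R) (v : R → ℤ) [o : OvC S v] :
    ∃ x, A.Lam (insert x S) (dl x - v) := by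
  obtain ⟨x, h, -⟩ := A.ext (S := S) (T := S) (u := v) (v := -v) o.1 (Ov_neg o.1)
    (by simpa using A.zero _)
  exact ⟨x, h⟩

theorem mkC {U : Set R} (m : Multiset R) (h : A.Lam U w)
    (e : w = vec m := by simp only [vec_cons, vec_add, vec_zero, vec_singleton, vec_rep] <;> push_cast <;> module)
    [s : SubC U (lts m)]
    (a : ∀ y ∈ m, A.l y = 1 := by
      repeat' (first
        | assumption | (with_reducible exact arcs_zero) | (with_reducible apply arcs_cons)
        | (with_reducible apply arcs_add) | (with_reducible apply arcs_rep)
        | (with_reducible apply arcs_one))) :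
    A.Circ m := ⟨a, by rw [← e]; exact A.mono h s.1⟩

/-- a relation with trivial label is the identity -/
theorem l_zero (h : A.l x = 0) : A.Lam {x} (dl x) ∧ A.r x = 0 := by
  obtain ⟨m, h1, h2, h3⟩ := A.l_ex x
  rw [h, Multiset.card_eq_zero] at h2
  subst h2
  have h4 : A.Lam {x} (dl x) := by
    refine A.mono (v := dl x) (S := insert x (lts 0)) (by simpa using h3) ?_
    intro y hy; simpa using hy
  refine ⟨h4, ?_⟩
  have := A.r_le (x := x) (m := 0) bs (by
    refine A.mono (v := _) (S := {x}) (by simpa using h4) ?_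
    intro y hy; left; simpa using hy)
  simpa using this

theorem r_zero (h : A.r x = 0) : A.Lam {x} (dl x) ∧ A.l x = 0 := by
  obtain ⟨m, h1, h2, h3⟩ := A.r_ex x
  rw [h, Multiset.card_eq_zero] at h2
  subst h2
  have h4 : A.Lam {x} (dl x) := by
    refine A.mono (v := dl x) (S := insert x (lts 0)) (by simpa using h3) ?_
    intro y hy; simpa using hy
  refine ⟨h4, ?_⟩
  have := A.l_le (x := x) (m := 0) bs (by
    refine A.mono (v := _) (S := {x}) (by simpa using h4) ?_
    intro y hy; left; simpa using hy)
  simpa using this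

theorem l_zero_of (h : A.Lam {x} (dl x)) : A.l x = 0 := by
  have := A.l_le (x := x) (m := 0) bs (by
    refine A.mono (v := _) (S := {x}) (by simpa using h) ?_
    intro y hy; left; simpa using hy)
  simpa using this

theorem r_pos (h : A.l a = 1) : 1 ≤ A.r a := by
  by_contra h'
  have := (r_zero (A := A) (x := a) oo).2
  omega

theorem not1 (h : A.l a = 1) : ¬ A.Lam {a} (dl a) := by
  intro h'
  have := l_zero_of h'
  omega

/-- every element in a word closes up to a circuit -/
theorem In.circ {w : Multiset R} (h : A.In x w) (hw : ∀ y ∈ w, A.l y = 1) :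
    ∃ m, m.card = A.r x ∧ A.Circ (w + m) ∧ A.Lam (insert x (lts m)) (dl x + vec m) := by
  obtain ⟨m, h1, h2, h3⟩ := A.r_ex x
  refine ⟨m, h2, ⟨?_, ?_⟩, h3⟩
  · intro y hy
    rcases Multiset.mem_add.1 hy with hy | hy
    exacts [hw y hy, h1 y hy]
  · have hd : A.Dom x (lts w) := domk (vec w) h
    refine hd.drop (U := insert x (lts w ∪ lts m)) (T := lts (w + m)) ?_
    exact c2 (-1) h 1 h3 (by rw [vec_add]; module)

/-- shortcut: replace the part of a word by a path of the middle relation -/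
theorem short {w : Multiset R} (h : A.Lam (insert x (lts w)) (dl x + vec w))
    (hw : ∀ y ∈ w, A.l y = 1) :
    ∃ m, m.card = A.l x ∧ A.Circ (w + m) ∧ A.In x m := by
  obtain ⟨m, h1, h2, h3⟩ := A.l_ex x
  refine ⟨m, h2, ⟨?_, ?_⟩, h3⟩
  · intro y hy
    rcases Multiset.mem_add.1 hy with hy | hy
    exacts [hw y hy, h1 y hy]
  · have hd : A.Dom x (lts w) := domk (-vec w) (by simpa using h)
    refine hd.drop (U := insert x (lts w ∪ lts m)) (T := lts (w + m)) ?_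
    exact c2 1 h (-1) h3 (by rw [vec_add]; module)

theorem Circ.le (h : A.Circ m) (a : R) [ha : MemC a (lts m)] :
    A.r a + 1 ≤ m.card := by
  have ha := ha.1
  obtain ⟨m', rfl⟩ := Multiset.exists_cons_of_mem ha
  have := A.r_le (x := a) (m := m') (fun y hy => h.1 y (Multiset.mem_cons_of_mem hy)) (by
    refine A.mono (v := _) (S := _) (by simpa using h.2) ?_
    intro y hy; simpa using hy)
  simpa using this

/-- upper bound for `r` -/
theorem rle {U : Set R} (m : Multiset R) (h : A.Lam U w)
    (e : w = dl x + vec m := by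
      simp only [vec_cons, vec_add, vec_zero, vec_singleton, vec_rep] <;> push_cast <;> module)
    [s : SubC U (insert x (lts m))]
    (a : ∀ y ∈ m, A.l y = 1 := by
      repeat' (first
        | assumption | (with_reducible exact arcs_zero) | (with_reducible apply arcs_cons)
        | (with_reducible apply arcs_add) | (with_reducible apply arcs_rep)
        | (with_reducible apply arcs_one))) : A.r x ≤ m.card := by
  subst e; exact A.r_le a (A.mono h s.1)

theorem lle {U : Set R} (m : Multiset R) (h : A.Lam U w)
    (e : w = dl x - vec m := by
      simp only [vec_cons, vec_add, vec_zero, vec_singleton, vec_rep] <;> push_cast <;> module)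
    [s : SubC U (insert x (lts m))]
    (a : ∀ y ∈ m, A.l y = 1 := by
      repeat' (first
        | assumption | (with_reducible exact arcs_zero) | (with_reducible apply arcs_cons)
        | (with_reducible apply arcs_add) | (with_reducible apply arcs_rep)
        | (with_reducible apply arcs_one))) : A.l x ≤ m.card := by
  subst e; exact A.l_le a (A.mono h s.1)

theorem mkIn {U : Set R} (m : Multiset R) (h : A.Lam U w)
    (e : w = dl x - vec m := by
      simp only [vec_cons, vec_add, vec_zero, vec_singleton, vec_rep] <;> push_cast <;> module)
    [s : SubC U (insert x (lts m))] :
    A.In x m := by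
  subst e; exact A.mono h s.1

/-- `x ∈ ab` -/
def In2 (A : Sys R) (x a b : R) : Prop := A.Lam {x, a, b} (dl x - dl a - dl b)

theorem In2.dom (h : A.In2 x a b) : A.Dom x {a, b} :=
  domk (dl a + dl b) (c1 1 h) 

theorem In2.symm (h : A.In2 x a b) : A.In2 x b a := c1 1 h

theorem In2.circ (h : A.In2 x a b) (ha : A.l a = 1) (hb : A.l b = 1) :
    ∃ m, m.card = A.r x ∧ A.Circ (a :> b :> m) := by
  have h' : A.In x (a :> b :> 0) := mkIn _ h
  obtain ⟨m, h1, h2, -⟩ := h'.circ (by simp [ha, hb])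
  exact ⟨m, h1, by simpa using h2⟩

theorem In2.bd (h : A.In2 x a b) (ha : A.l a = 1) (hb : A.l b = 1) :
    A.l x ≤ 2 ∧ A.r a ≤ A.r x + 1 ∧ A.r b ≤ A.r x + 1 ∧ (1 ≤ A.r x → 1 ≤ A.l x) := by
  obtain ⟨m, h1, h2⟩ := h.circ ha hb
  refine ⟨by simpa using lle (a :> b :> 0) h, ?_, ?_, ?_⟩
  · have := h2.le a; simp [h1] at this; omega
  · have := h2.le b; simp [h1] at this; omega
  · intro h3; by_contra h4
    have := (l_zero (A := A) (x := x) oo).2; omega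

theorem pick2 (a b : R) : ∃ x, A.In2 x a b := by
  obtain ⟨x, h⟩ := A.pick {a, b} (dl a + dl b)
  exact ⟨x, c1 1 h⟩

/-- circuit through an arc -/
theorem arc_circ (ha : A.l a = 1) :
    ∃ m, m.card = A.r a ∧ A.Circ (a :> m) := by
  have h' : A.In a (a :> 0) := mkIn (U := ∅) (w := 0) _ (A.zero _)
  obtain ⟨m, h1, h2, -⟩ := h'.circ (by simp [ha])
  exact ⟨m, h1, by simpa using h2⟩

def Neg (A : Sys R) (x : R) (m : Multiset R) : Prop := A.Lam (insert x (lts m)) (dl x + vec m)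

theorem Neg.lam (h : A.Neg x m)
    (e : u = dl x + vec m := by
      simp only [vec_cons, vec_add, vec_zero, vec_singleton, vec_rep] <;> push_cast <;> module)
    [s : SubC (insert x (lts m)) T] : A.Lam T u := by
  subst e; exact A.mono h s.1

theorem Circ.lam (h : A.Circ m)
    (e : u = vec m := by
      simp only [vec_cons, vec_add, vec_zero, vec_singleton, vec_rep] <;> push_cast <;> module)
    [s : SubC (lts m) T] : A.Lam T u := by
  subst e; exact A.mono h.2 s.1

theorem In.lam (h : A.In x m)
    (e : u = dl x - vec m := by
      simp only [vec_cons, vec_add, vec_zero, vec_singleton, vec_rep] <;> push_cast <;> module)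
    [s : SubC (insert x (lts m)) T] : A.Lam T u := by
  subst e; exact A.mono h s.1

theorem Circ.split {w : Multiset R} (h : A.Circ (w + m)) :
    ∃ x, A.In x w ∧ A.Neg x m ∧ A.l x ≤ w.card ∧ A.r x ≤ m.card := by
  obtain ⟨x, h1, h2⟩ := A.split (lts w) (lts m) (vec w) (vec m) h.2 bs
  exact ⟨x, h1, h2, A.l_le (fun y hy => h.1 y (by simp [hy])) h1,
    A.r_le (fun y hy => h.1 y (by simp [hy])) h2⟩

theorem Circ.split2 (h : A.Circ (a :> b :> m)) :
    ∃ x, A.In2 x a b ∧ A.Neg x m ∧ A.l x ≤ 2 ∧ A.r x ≤ m.card := by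
  obtain ⟨x, h1, h2, h3, h4⟩ := Circ.split (w := a :> b :> 0) (m := m) (by simpa using h)
  exact ⟨x, h1.lam, h2, h3, h4⟩

def PureL (A : Sys R) (a : R) : Prop :=
  ∀ m, A.Circ m → a ∈ m → m.card = A.r a + 1 → ∀ y ∈ m, y = a

theorem PureL.q (h : A.PureL a) (ha : A.l a = 1) :
    A.Lam {a} (((A.r a : ℤ) + 1) • dl a) := by
  obtain ⟨m, h1, h2⟩ := arc_circ (A := A) ha
  have h3 := h _ h2 bs (by simp [h1])
  have h4 : a :> m = rp (A.r a + 1) a := by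
    apply Multiset.eq_replicate.2; exact ⟨by simp [h1], h3⟩
  rw [h4] at h2
  have := h2.2
  rw [vec_rep] at this
  exact c1 1 this (by push_cast; module)

def Mix (A : Sys R) (d f : R) : Prop := A.l f = 1 ∧ A.r f + 1 = A.r d ∧ A.PureL f ∧
  (∀ m, A.Circ m → d ∈ m → m.card = A.r d + 1 → ∀ y ∈ m, y = d ∨ y = f) ∧
  (A.Lam {d, f} (tz • dl d - dl f) ∨ A.Lam {d, f} (dl d))

/-- words in two letters -/
theorem two_letters (h : ∀ y ∈ m, y = d ∨ y = f) :
    ∃ i j, i + j = m.card ∧ m = rp i d + rp j f := by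
  induction m using Multiset.induction with
  | empty => exact ⟨0, 0, rfl, rfl⟩
  | cons a m ih =>
    obtain ⟨i, j, h1, h2⟩ := ih (fun y hy => h y (Multiset.mem_cons_of_mem hy))
    rcases h a (Multiset.mem_cons_self a m) with rfl | rfl
    · refine ⟨i + 1, j, by simp; omega, ?_⟩
      rw [h2]; simp [rp, Multiset.replicate_succ]
    · refine ⟨i, j + 1, by simp; omega, ?_⟩
      rw [h2]; simp [rp, Multiset.replicate_succ]


theorem rep_le (ha : A.l a = 1) (h : A.Lam {a} ((n : ℤ) • dl a)) (hn : n ≠ 0) :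
    A.r a + 1 ≤ n := by
  obtain ⟨k, rfl⟩ := Nat.exists_eq_succ_of_ne_zero hn
  have C : A.Circ (rp (k + 1) a) := mkC _ h
  simpa using C.le a

theorem claimX (ha : A.l a = 1) (hc : A.l c = 1) (hd : A.l d = 1)
    (had : A.r d + 1 = A.r a) (h : A.In2 d a c) (M : A.Mix d f) : False := by
  obtain ⟨hf, hfd, pf, ml, cd⟩ := M
  have hq := pf.q hf
  have hf1 := r_pos hf
  obtain ⟨k, hk⟩ : ∃ k, A.r f = k + 1 := ⟨A.r f - 1, by omega⟩
  rw [hk] at hq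
  have hdf : d ≠ f := by rintro rfl; omega
  have haf : a ≠ f := by rintro rfl; omega
  rcases cd with h2 | h2
  · have W : A.Circ (a :> d :> c :> rp (k + 1) f) := mkC _ (c3 (-1) h 1 h2 1 hq : A.Lam {a, c, d, f}
      (dl a + dl c + dl d + ((k : ℤ) + 1) • dl f))
    have Df : A.Dom f {d} := domk (tz • dl d) (c1 (-1) h2)
    obtain ⟨x, x1, x2, x3, x4⟩ := W.split2
    have x5 := x1.bd ha hd
    simp at x4
    have W2 : A.Circ (a :> f :> c :> d :> rp k f) := mkC _ (W.lam : A.Lam {a, c, d, f}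
      (dl a + dl c + dl d + ((k : ℤ) + 1) • dl f))
    obtain ⟨y, y1, y2, y3, y4⟩ := W2.split2
    have y5 := y1.bd ha hf
    simp at y4
    have xl : A.l x = 1 ∨ A.l x = 2 := by omega
    have yl : A.l y = 1 ∨ A.l y = 2 := by omega
    rcases xl with xl | xl
    · obtain rfl : x = d := A.ij
      have a1 : A.Lam {a, x} (dl a) := c1 (-1) x1
      have Da : A.Dom a {x} := domk 0 (c1 1 a1)
      have : x = c := A.sep (Da.drop (c2 1 h 1 a1 : A.Lam {a, x, c} (dl x - dl c)))
      subst this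
      rcases yl with yl | yl
      · obtain rfl : y = x := A.ij
        exact hdf (A.sep (Da.drop (c2 1 y1 1 a1 : A.Lam {a, y, f} (dl y - dl f))))
      · have W3 : A.Circ ((a :> a :> f :> 0) + (x :> x :> rp k f)) := mkC _ (c2 1
          (W.lam : A.Lam {a, x, f} (dl a + tz • dl x + ((k : ℤ) + 1) • dl f)) 1 a1 :
          A.Lam {a, x, f} (tz • dl a + tz • dl x + ((k : ℤ) + 1) • dl f))
        obtain ⟨w, w1, w2, w3, w4⟩ := W3.split
        simp at w3 w4
        have w5 : A.Lam {w, a, f} (dl w - tz • dl a - dl f) := w1.lam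
        have w6 : A.Lam {w, x, f} (dl w - dl f) := Da.drop (c2 1 w5 2 a1 :
          A.Lam {a, w, x, f} (dl w - dl f))
        have w7 : A.l w ≤ 2 := lle (x :> x :> 0) (Df.drop (c2 1 w6 (-1) h2 :
          A.Lam {f, w, x} (dl w - tz • dl x)) : A.Lam {w, x} (dl w - tz • dl x))
        obtain ⟨m, m1, m2, m3⟩ := w1.circ (by simp [ha, hf])
        have m4 := m2.le a
        simp [m1] at m4
        have w0 : A.l w ≠ 0 := fun h0 => by have := (l_zero h0).2; omega
        have key : A.Lam {a, f} (tz • dl a) := by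
          rcases (show A.r w = k + 1 ∨ A.r w = k + 2 by omega) with hw | hw
          · have Dw : A.Dom w {f, x} := domk (dl f) (c1 1 w6)
            have e1 : A.Lam (insert f (insert x (lts m))) (tz • dl x + vec m) :=
              Dw.drop (c3 1 h2 (-1) w6 1 m3 :
                A.Lam (insert w (insert f (insert x (lts m)))) _)
            have e2 : A.Lam (insert x (lts m)) (tz • dl x + vec m) :=
              Df.drop e1
            have e3 : A.Circ (x :> x :> m) := mkC _ e2 (a := by
              intro y hy; simp at hy; rcases hy with rfl | hy; exact hd; exact m2.1 y (by simp [hy]))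
            have e4 := ml _ e3 bs (by simp; omega)
            obtain ⟨i, j, ij, rfl⟩ := two_letters (d := x) (f := f) (m := m) (fun y hy => e4 y (by simp [hy]))
            have e5 : A.Lam {x, f} ((2 + i : ℤ) • dl x + (j : ℤ) • dl f) := e3.lam
            have hj : j + i = k + 1 := by omega
            have hj' : (j : ℤ) = k + 1 - i := by omega
            have e6 : A.Lam {x} ((i : ℤ) • dl x) := Df.drop (c3 (-1) e5 1 hq (i + 1 : ℤ) h2 (by rw [hj']; module) :
              A.Lam {x, f} ((i : ℤ) • dl x))
            have i0 : i = 0 := by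
              by_contra hi
              have := rep_le hd e6 hi
              omega
            subst i0
            have m4 : A.Lam {w, f} (dl w + (j : ℤ) • dl f) := (show A.Neg w _ from m3).lam bs
            obtain rfl : w = f := A.sep (c2 1 m4 (-1) hq (by rw [hj']; push_cast; module))
            exact c1 (-1) w5
          · rcases (show A.l w = 1 ∨ A.l w = 2 by omega) with wl | wl
            · obtain rfl : w = x := A.ij
              exact absurd (A.sep (c1 1 w6)) hdf
            · obtain rfl : w = y := A.ij
              have e1 : A.Lam {a, f} (dl a) := y1.dom.drop (c2 1 y1 (-1) w5 : A.Lam {w, a, f} (dl a))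
              have Da2 : A.Dom a {f} := domk 0 (c1 1 e1)
              have : w = f := A.sep (Da2.drop (c2 1 y1 1 e1 : A.Lam {w, a, f} (dl w - dl f)))
              subst this; omega
        obtain ⟨z, z1, z2⟩ := split {a} {f} (tz • dl a) 0 key
        have z3 : A.In2 z a a := c1 1 z1
        have z4 := z3.bd ha ha
        have z5 : A.r z ≤ k + 2 := by
          simpa using (rle (rp (k + 2) f) (c2 1 z2 1 hq : A.Lam {z, f} (dl z + (k + 2 : ℤ) • dl f)))
        rcases (show A.l z = 1 ∨ A.l z = 2 by omega) with zl | zl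
        · obtain rfl : z = x := A.ij
          exact not1 hd (Df.drop (c1 1 z2 : A.Lam {z, f} (dl z)))
        · obtain rfl : z = y := A.ij
          exact haf (A.sep (y1.dom.drop (c2 1 y1 (-1) z3 : A.Lam {z, a, f} (dl a - dl f))))
    · rcases yl with yl | yl
      · obtain rfl : y = d := A.ij
        have e1 : A.Lam {a, y} (dl a + dl y) := Df.drop (c2 1 h2 (-1) y1 : A.Lam {f, a, y} (dl a + dl y))
        have := (mkC (a :> y :> 0) e1).le a
        simp at this; omega
      · obtain rfl : y = x := A.ij
        have e0 : A.Lam {y, a, d, f} (dl d) := c3 1 h2 (-1) y1 1 x1 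
        have e1 : A.Lam {a, d} (dl d) :=
          Df.drop (x1.dom.drop (T := {f, a, d}) e0 : A.Lam {f, a, d} (dl d))
        have Dd : A.Dom d {a} := domk 0 (c1 1 e1)
        have : y = a := A.sep (Dd.drop (c2 1 x1 1 e1 : A.Lam {d, y, a} (dl y - dl a)))
        subst this; omega
  · have Dd : A.Dom d {f} := domk 0 (c1 1 h2)
    have W : A.Circ (a :> f :> c :> rp (k + 1) f) := mkC _ (Dd.drop (c3 (-1) h 1 h2 1 hq :
      A.Lam {d, a, c, f} (dl a + dl c + (k + 2 : ℤ) • dl f)) :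
      A.Lam {a, c, f} (dl a + dl c + (k + 2 : ℤ) • dl f))
    have naf : ¬ A.Lam {a, f} (dl a + dl f) := fun h' => by
      have := (mkC (a :> f :> 0) h').le a
      simp at this; omega
    obtain ⟨x, x1, x2, x3, x4⟩ := W.split2
    have x5 := x1.bd ha hf
    simp at x4
    have xl : A.l x ≠ 1 := fun xl => by
      obtain rfl : x = d := A.ij
      exact naf (Dd.drop (c2 (-1) x1 1 h2 : A.Lam {x, a, f} (dl a + dl f)))
    obtain ⟨z, z1⟩ := pick2 (A := A) d d
    have z2 := z1.bd hd hd
    have z3 : A.Lam {z, f} (dl z) := Dd.drop (c2 1 z1 2 h2 : A.Lam {d, z, f} (dl z))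
    have z5 : A.r z ≤ k + 2 := by
      simpa using (rle (rp (k + 2) f) (c2 1 z3 1 hq : A.Lam {z, f} (dl z + (k + 2 : ℤ) • dl f)))
    rcases (show A.l z = 1 ∨ A.l z = 2 by omega) with zl | zl
    · rcases (show A.r z = k + 1 ∨ A.r z = k + 2 by omega) with zr | zr
      · obtain rfl : z = f := A.ij
        exact not1 hf (c1 1 z3)
      · obtain rfl : z = d := A.ij
        exact not1 hd (c1 (-1) z1)
    rcases (show A.r z = k + 2 ∨ A.r z = k + 1 by omega) with zr | zr
    · obtain rfl : z = x := A.ij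
      exact naf (x1.dom.drop (c2 (-1) x1 1 z3 : A.Lam {z, a, f} (dl a + dl f)))
    obtain ⟨m, m1, m2⟩ := z1.circ hd hd
    obtain ⟨i, j, ij, rfl⟩ := two_letters (d := d) (f := f) (m := m)
      (fun y hy => ml _ m2 bs (by simp; omega) y (by simp [hy]))
    have e5 : A.Lam {d, f} ((2 + i : ℤ) • dl d + (j : ℤ) • dl f) := m2.lam
    have e6 : A.Lam {f} ((j : ℤ) • dl f) := Dd.drop (c2 1 e5 (-2 - i : ℤ) h2 :
      A.Lam {d, f} ((j : ℤ) • dl f))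
    have j0 : j = 0 := by
      by_contra hi
      have := rep_le hf e6 hi
      omega
    subst j0
    have ii : i = k + 1 := by omega
    subst ii
    have hdq : A.Lam {d} ((k + 3 : ℤ) • dl d) := m2.lam
    have W2 : A.Circ (a :> d :> c :> rp (k + 1) d) := mkC _ (c2 (-1) h 1 hdq :
      A.Lam {a, c, d} (dl a + dl c + (k + 2 : ℤ) • dl d))
    obtain ⟨y, y1, y2, y3, y4⟩ := W2.split2
    have y5 := y1.bd ha hd
    simp at y4
    rcases (show A.l y = 1 ∨ A.l y = 2 by omega) with yl | yl
    · obtain rfl : y = d := A.ij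
      have e1 : A.Lam {a, f} (dl a) := Dd.drop (c1 (-1) y1 : A.Lam {y, a, f} (dl a))
      have Da : A.Dom a {f} := domk 0 (c1 1 e1)
      have : x = f := A.sep (Da.drop (c2 1 x1 1 e1 : A.Lam {a, x, f} (dl x - dl f)))
      subst this; omega
    · obtain rfl : y = x := A.ij
      have e1 : A.Lam {a, f} (dl f) := x1.dom.drop (Dd.drop (c3 (-1) x1 1 y1 1 h2 :
        A.Lam {d, y, a, f} (dl f)) : A.Lam {y, a, f} (dl f))
      have Df : A.Dom f {a} := domk 0 (c1 1 e1)
      have : y = a := A.sep (Df.drop (c2 1 x1 1 e1 : A.Lam {f, y, a} (dl y - dl a)))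
      subst this; omega

theorem In2.lor (h : A.In2 x a b) (ha : A.l a = 1) (hb : A.l b = 1) (hr : A.r x ≠ 0) :
    A.l x = 1 ∨ A.l x = 2 := by
  have h1 := (h.bd ha hb).1
  have h2 : A.l x ≠ 0 := fun h0 => hr (l_zero h0).2
  omega

/-- replace letters by congruent vectors -/
theorem absorb (o₁ : Ov S v₁) (o₂ : Ov S v₂) (m : Multiset R) :
    ∀ u : R → ℤ, Ov S u →
    (∀ y ∈ m, A.Lam (insert y S) (dl y - v₁) ∨ A.Lam (insert y S) (dl y - v₂)) →
    A.Lam (S ∪ lts m) (u + vec m) →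
    ∃ i j : ℕ, i + j = m.card ∧ A.Lam S (u + (i : ℤ) • v₁ + (j : ℤ) • v₂) := by
  induction m using Multiset.induction with
  | empty =>
    intro u ou h h'
    refine ⟨0, 0, rfl, ?_⟩
    exact A.mono (S := S ∪ lts 0) (by simpa using h') (by intro x hx; simpa using hx)
  | cons y m ih =>
    intro u ou h h'
    have step : ∀ v : R → ℤ, Ov S v → A.Lam (insert y S) (dl y - v) →
        A.Lam (S ∪ lts m) ((u + v) + vec m) := by
      intro v ov hv
      have D : A.Dom y S := domk v hv (o := ⟨ov⟩)
      have s1 : S ∪ lts (y :> m) ⊆ insert y (S ∪ lts m) := by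
        intro z hz; simp at hz ⊢; tauto
      have s2 : insert y S ⊆ insert y (S ∪ lts m) := by
        intro z hz; simp at hz ⊢; tauto
      refine D _ _ Set.subset_union_left ?_ (c2 1 h' (-1) hv (by rw [vec_cons]; module) (s := ⟨s1⟩) (s' := ⟨s2⟩))
      exact Ov_add ((Ov_add ou ov).mono Set.subset_union_left)
        ((Ov_vec fun x hx => hx : Ov (lts m) (vec m)).mono Set.subset_union_right)
    have h2 : ∀ z ∈ m, A.Lam (insert z S) (dl z - v₁) ∨ A.Lam (insert z S) (dl z - v₂) :=
      fun z hz => h z (Multiset.mem_cons_of_mem hz)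
    rcases h y (Multiset.mem_cons_self y m) with hy | hy
    · obtain ⟨i, j, h3, h4⟩ := ih _ (Ov_add ou o₁) h2 (step v₁ o₁ hy)
      exact ⟨i + 1, j, by simp; omega, c1 1 h4⟩
    · obtain ⟨i, j, h3, h4⟩ := ih _ (Ov_add ou o₂) h2 (step v₂ o₂ hy)
      exact ⟨i, j + 1, by simp; omega, c1 1 h4⟩

theorem absorb1 (o₁ : Ov S v) (m : Multiset R)
    (u : R → ℤ) (ou : Ov S u)
    (h : ∀ y ∈ m, A.Lam (insert y S) (dl y - v))
    (h' : A.Lam (S ∪ lts m) (u + vec m)) :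
    A.Lam S (u + (m.card : ℤ) • v) := by
  obtain ⟨i, j, h1, h2⟩ := absorb o₁ o₁ m u ou (fun y hy => Or.inl (h y hy)) h'
  rw [← h1]
  exact c1 1 h2

theorem claimY (ha : A.l a = 1) (hc : A.l c = 1) (hd : A.l d = 1)
    (had : A.r d + 1 = A.r a) (h : A.In2 d a c) (pd : A.PureL d) (hac : c ≠ a) : c = d := by
  have hq := pd.q hd
  have hd1 := r_pos hd
  obtain ⟨n, hn⟩ : ∃ n, A.r d = n + 1 := ⟨A.r d - 1, by omega⟩
  rw [hn] at hq
  have V : A.Lam {a, c, d} (dl a + dl c + (n + 1 : ℤ) • dl d) := c2 (-1) h 1 hq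
  have W : A.Circ (a :> d :> c :> rp n d) := mkC _ V
  obtain ⟨x, x1, x2, x3, x4⟩ := W.split2
  have x5 := (x1.bd ha hd).2.1
  simp at x4
  rcases x1.lor ha hd oo with xl | xl
  · obtain rfl : x = d := A.ij
    have a1 : A.Lam {a, x} (dl a) := c1 (-1) x1
    have Da : A.Dom a {x} := domk 0 (c1 1 a1)
    exact (A.sep (Da.drop (c2 1 h 1 a1 : A.Lam {a, x, c} (dl x - dl c)))).symm
  have W2 : A.Circ (c :> d :> a :> rp n d) := mkC _ V
  obtain ⟨y, y1, y2, y3, y4⟩ := W2.split2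
  have y5 := (y1.bd hc hd).2.2.1
  simp at y4
  rcases (show A.r y = n ∨ A.r y = n + 1 by omega) with yr | yr
  · obtain ⟨m, m1, m2⟩ := y1.circ hc hd
    exact pd _ m2 bs (by simp; omega) c bs
  rcases y1.lor hc hd oo with yl | yl
  · obtain rfl : y = d := A.ij
    have a1 : A.Lam {c, y} (dl c) := c1 (-1) y1
    have Dc : A.Dom c {y} := domk 0 (c1 1 a1)
    have : y = a := (A.sep (Dc.drop (c2 1 h 1 a1 : A.Lam {c, y, a} (dl y - dl a))))
    subst this; omega
  · obtain rfl : y = x := A.ij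
    have Dd : A.Dom d {a, c} := h.dom
    exact absurd (A.sep (Dd.drop (y1.dom.drop (T := {d, c, a}) (c2 1 x1 (-1) y1 :
      A.Lam {y, d, c, a} (dl c - dl a)) : A.Lam {d, c, a} (dl c - dl a)))) hac

def MMs (A : Sys R) (a : R) : Prop := A.PureL a ∨ ∃ d, A.Mix a d

theorem mmF (ha : A.l a = 1) (hc : A.l c = 1) (hac : c ≠ a) (hn : A.r a = n + 2)
    (h : A.Lam {a, c} (dl a + (n + 2 : ℤ) • dl c)) (IH : A.r c < A.r a → A.MMs c) :
    A.r c = n + 1 ∧ A.PureL c ∧ A.Lam {a, c} (dl a) := by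
  have W : A.Circ (a :> rp (n + 2) c) := mkC _ h
  have hcn := W.le c
  simp at hcn
  have hcn2 : A.r c ≠ n + 2 := fun h' => hac (A.ij)
  rcases IH oo with pc | ⟨g, hg, hgc, pg, ml, cd⟩
  · have hq := pc.q hc
    have key : ∀ t : ℕ, A.Lam {a, c} (dl a + (t : ℤ) • dl c) → t ≠ 0 → n + 2 ≤ t := by
      intro t ht t0
      obtain ⟨k, rfl⟩ := Nat.exists_eq_succ_of_ne_zero t0
      have := (mkC (a :> rp (k + 1) c) ht).le a
      simp at this; omega
    have e1 : A.Lam {a, c} (dl a) := by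
      have := key ((n + 2) % (A.r c + 1)) (c2 1 h (-((n + 2) / (A.r c + 1) : ℕ) : ℤ) hq (by
        have := Nat.mod_add_div (n + 2) (A.r c + 1)
        have h2 : ((n : ℤ) + 2) = ((n + 2) % (A.r c + 1) : ℕ) + (A.r c + 1) * ((n + 2) / (A.r c + 1) : ℕ) := by
          exact_mod_cast this.symm
        rw [h2]; module))
      by_cases h0 : (n + 2) % (A.r c + 1) = 0
      · have := Nat.mod_add_div (n + 2) (A.r c + 1)
        have h2 : ((n : ℤ) + 2) = (A.r c + 1) * ((n + 2) / (A.r c + 1) : ℕ) := by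
          rw [h0] at this; exact_mod_cast oo
        exact c2 1 h (-((n + 2) / (A.r c + 1) : ℕ) : ℤ) hq (by rw [h2]; module)
      · have h1 := this h0
        have h2 := Nat.mod_lt (n + 2) (show 0 < A.r c + 1 by omega)
        omega
    have := key (A.r c + 1) (c2 1 e1 1 hq) oo
    exact ⟨by omega, pc, e1⟩
  · exfalso
    have := r_pos hg
    rcases cd with h2 | h2
    · obtain ⟨k, rfl⟩ : ∃ k, n = k + 1 := ⟨n - 1, by omega⟩
      have := (mkC (a :> g :> rp (k + 1) c) (c2 1 h (-1) h2 :
        A.Lam {a, c, g} (dl a + dl g + (k + 1 : ℤ) • dl c))).le a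
      simp at this; omega
    · have Dc : A.Dom c {g} := domk 0 (c1 1 h2)
      have e1 : A.Lam {a, g} (dl a) := Dc.drop (c2 1 h (-n-2 : ℤ) h2 : A.Lam {c, a, g} (dl a))
      have := (mkC (a :> rp (A.r g + 1) g) (c2 1 e1 1 (pg.q hg) : A.Lam {a, g} (dl a + (A.r g + 1 : ℤ) • dl g))).le a
      simp at this; omega


theorem two_of_mem (h1 : a ∈ m) (h2 : c ∈ m) (h : c ≠ a) :
    ∃ m', m = a :> c :> m' := by
  obtain ⟨t, rfl⟩ := Multiset.exists_cons_of_mem h1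
  rcases Multiset.mem_cons.1 h2 with h3 | h3
  · exact absurd h3 h
  · obtain ⟨s, rfl⟩ := Multiset.exists_cons_of_mem h3
    exact ⟨s, rfl⟩

theorem mmstep (ha : A.l a = 1) (hn : A.r a = n + 2)
    (IH : ∀ b, A.l b = 1 → A.r b < A.r a → A.MMs b)
    (W : A.Circ (a :> c :> m)) (hm : m.card = n + 1) (hac : c ≠ a) :
    A.r c = n + 1 ∧ A.PureL c ∧ (A.Lam {a, c} (tz • dl a - dl c) ∨ A.Lam {a, c} (dl a)) := by
  have hc : A.l c = 1 := W.1 c bs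
  have E0 : ∀ (b : R) (t : Multiset R), A.Circ (a :> b :> t) → t.card = n + 1 →
      ∃ x, A.In2 x a b ∧ A.r x = n + 1 ∧ (A.l x = 1 ∨ A.l x = 2) := by
    intro b t C ht
    obtain ⟨x, x1, x2, x3, x4⟩ := C.split2
    have hb := C.1 b bs
    have x5 := (x1.bd ha hb).2.1
    have xr : A.r x = n + 1 := by omega
    exact ⟨x, x1, xr, x1.lor ha hb oo⟩
  have X : ∀ d b, A.l d = 1 → A.r d = n + 1 → A.l b = 1 → A.In2 d a b → A.PureL d := by
    intro d b hd hr hb h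
    rcases IH d hd oo with h1 | ⟨f, h1⟩
    · exact h1
    · exact (claimX ha hb hd oo h h1).elim
  obtain ⟨x, x1, xr, xl⟩ := E0 c m W hm
  have fin : A.l x = 2 → a ∉ m → (∀ b ∈ m, b ≠ a → ∀ d, A.l d = 1 → A.r d = n + 1 → ¬ A.In2 d a b) →
      A.r c = n + 1 ∧ A.PureL c ∧ (A.Lam {a, c} (tz • dl a - dl c) ∨ A.Lam {a, c} (dl a)) := by
    intro xl am hh
    have e1 : A.Lam {a, c} ((dl a + dl c) + (m.card : ℤ) • dl c) := by
      refine absorb1 (Ov_dl bs) m _ (Ov_add (Ov_dl bs) (Ov_dl bs)) ?_ ?_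
      · intro y hy
        have hya : y ≠ a := fun h => am (h ▸ hy)
        obtain ⟨s, rfl⟩ := Multiset.exists_cons_of_mem hy
        obtain ⟨z, z1, zr, zl⟩ := E0 y (c :> s) (by
          rw [Multiset.cons_swap y c]; exact W) (by simpa using hm)
        rcases zl with zl | zl
        · exact absurd z1 (hh y hy hya z zl zr)
        · obtain rfl : z = x := A.ij
          exact x1.dom.drop (T := {y, a, c}) (c2 1 x1 (-1) z1 : A.Lam {z, y, a, c} (dl y - dl c))
      · exact W.lam
    have := mmF ha hc hac hn (c1 1 e1 (by rw [hm]; push_cast; module)) (IH c hc)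
    exact ⟨this.1, this.2.1, Or.inr this.2.2⟩
  by_cases hD : ∃ d, A.l d = 1 ∧ A.r d = n + 1 ∧ A.Lam {a, d} (dl a)
  · obtain ⟨d, hd, hdr, h2⟩ := hD
    have pd : A.PureL d := X d d hd hdr hd (c1 (-1) h2)
    have Da : A.Dom a {d} := domk 0 (c1 1 h2)
    have K : ∀ b, A.In2 d a b → b = d := fun b hb =>
      (A.sep (Da.drop (c2 1 hb 1 h2 : A.Lam {a, d, b} (dl d - dl b)))).symm
    suffices hcd : c = d by
      subst hcd; exact ⟨hdr, pd, Or.inr h2⟩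
    rcases xl with xl | xl
    · obtain rfl : x = d := A.ij
      exact K c x1
    by_cases am : a ∈ m
    · exfalso
      obtain ⟨s, rfl⟩ := Multiset.exists_cons_of_mem am
      obtain ⟨z, z1, zr, zl⟩ := E0 a (c :> s) (by rw [Multiset.cons_swap a c]; exact W) (by simpa using hm)
      rcases zl with zl | zl
      · obtain rfl : z = d := A.ij
        exact not1 hd (Da.drop (c2 1 z1 2 h2 : A.Lam {a, z} (dl z)))
      · obtain rfl : z = x := A.ij
        exact hac (A.sep (x1.dom.drop (c2 (-1) x1 1 z1 : A.Lam {z, c, a} (dl c - dl a))))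
    by_cases dm : d ∈ m
    · obtain ⟨s, rfl⟩ := Multiset.exists_cons_of_mem dm
      have e1 : A.Circ (c :> d :> s) := mkC _ (Da.drop (T := lts (c :> d :> s)) (c2 1 W.2 (-1) h2
        (by simp only [vec_cons]; module) :
        A.Lam (insert a (lts (c :> d :> s))) (vec (c :> d :> s)))) rfl
        (a := fun y hy => W.1 y (by rw [Multiset.mem_cons]; exact Or.inr hy))
      exact pd _ e1 bs (by simp at hm; simp; omega) c bs
    by_contra hcd
    refine hcd (A.inj (hc.trans hd.symm) ?_)
    rw [hdr]
    refine (fin xl am ?_).1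
    intro b hb hba d' hd' hdr' h'
    obtain rfl : d' = d := A.ij
    have := K b h'
    exact dm (this ▸ hb)
  · have nd : ∀ b, A.l b = 1 → b ≠ a → ∀ d, A.l d = 1 → A.r d = n + 1 → ¬ A.In2 d a b := by
      intro b hb hba d hd hdr h
      have := claimY ha hb hd oo h (X d b hd hdr hb h) hba
      subst this
      exact hD ⟨b, hd, hdr, c1 (-1) h⟩
    have xl : A.l x = 2 := xl.resolve_left (fun h => nd c hc hac x h xr x1)
    by_cases am : a ∈ m
    · obtain ⟨s, rfl⟩ := Multiset.exists_cons_of_mem am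
      obtain ⟨d, z1, hdr, zl⟩ := E0 a (c :> s) (by rw [Multiset.cons_swap a c]; exact W) (by simpa using hm)
      rcases zl with hd | zl
      · have pd := X d a hd hdr ha z1
        have hq := pd.q hd
        rw [hdr] at hq
        have W2 : A.Circ (a :> d :> a :> rp n d) := mkC _ (c2 (-1) z1 1 hq :
          A.Lam {a, d} (tz • dl a + (n + 1 : ℤ) • dl d))
        obtain ⟨y, y1, yr, yl⟩ := E0 d (a :> rp n d) W2 bs
        rcases yl with yl | yl
        · obtain rfl : y = d := A.ij
          exact absurd ⟨y, hd, hdr, c1 (-1) y1⟩ hD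
        obtain rfl : y = x := A.ij
        have Dd : A.Dom d {a} := domk (tz • dl a) (c1 1 z1)
        have e1 : A.In2 c a a := Dd.drop (x1.dom.drop (T := {d, a, c}) (c3 (-1) x1 1 y1 1 z1 :
          A.Lam {y, d, a, c} (dl c - dl a - dl a)) : A.Lam {d, a, c} (dl c - dl a - dl a))
        have e2 := (e1.bd ha ha).2.1
        have e3 := W.le c
        simp at e3 hm
        have e4 : A.r c ≠ n + 2 := fun h' => hac (A.ij)
        obtain rfl : c = d := A.ij
        exact ⟨hdr, pd, Or.inl (c1 (-1) e1)⟩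
      · obtain rfl : d = x := A.ij
        exact absurd (A.sep (x1.dom.drop (c2 (-1) x1 1 z1 : A.Lam {d, c, a} (dl c - dl a)))) hac
    · exact fin xl am (fun b hb hba => nd b (W.1 b (by simp [hb])) hba)

theorem mm_two (ha : A.l a = 1) (h1 : A.r a = 1) : A.PureL a := by
  intro m hm am mc y hy
  by_contra hya
  obtain ⟨s, rfl⟩ := two_of_mem am hy hya
  have := hm.le y
  rw [mc] at this
  have hy1 : A.l y = 1 := hm.1 y hy
  have := r_pos hy1
  exact hya (A.ij)

theorem MM : ∀ (a : R), A.l a = 1 → A.MMs a := by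
  have : ∀ n (a : R), A.r a = n → A.l a = 1 → A.MMs a := by
    intro n
    induction n using Nat.strong_induction_on with
    | _ n ih =>
    intro a hn ha
    have IH : ∀ b, A.l b = 1 → A.r b < A.r a → A.MMs b := fun b hb h => ih _ (hn ▸ h) b rfl hb
    have := r_pos ha
    rcases (show A.r a = 1 ∨ ∃ k, A.r a = k + 2 from by
      rcases Nat.lt_or_ge (A.r a) 2 with h | h
      · left; omega
      · right; exact ⟨A.r a - 2, by omega⟩) with h1 | ⟨k, hk⟩
    · exact Or.inl (mm_two ha h1)
    by_cases pa : A.PureL a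
    · exact Or.inl pa
    right
    unfold PureL at pa
    push Not at pa
    obtain ⟨m, m1, m2, m3, d, m4, m5⟩ := pa
    have key : ∀ m, A.Circ m → a ∈ m → m.card = A.r a + 1 → ∀ y ∈ m, y ≠ a → A.l y = 1 ∧ A.r y = k + 1 ∧
        A.PureL y ∧ (A.Lam {a, y} (tz • dl a - dl y) ∨ A.Lam {a, y} (dl a)) := by
      intro m m1 m2 m3 y m4 m5
      obtain ⟨s, rfl⟩ := two_of_mem m2 m4 m5
      exact ⟨m1.1 y m4, mmstep ha hk IH m1 (by simp at m3; omega) m5⟩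
    obtain ⟨d1, d2, d3, d4⟩ := key m m1 m2 m3 d m4 m5
    refine ⟨d, d1, by omega, d3, ?_, d4⟩
    intro t t1 t2 t3 y hy
    by_cases hya : y = a
    · exact Or.inl hya
    · right
      obtain ⟨e1, e2, -⟩ := key t t1 t2 t3 y hy hya
      exact A.ij
  exact fun a => this _ a rfl


def QP (A : Sys R) (a : R) : Prop := A.Lam {a} (((A.r a : ℤ) + 1) • dl a)
def Mx (A : Sys R) (d f : R) : Prop := A.l f = 1 ∧ A.r f + 1 = A.r d ∧ A.PureL f ∧
  (∀ m, A.Circ m → d ∈ m → m.card = A.r d + 1 → ∀ y ∈ m, y = d ∨ y = f)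
def CC (A : Sys R) (d f : R) : Prop := A.Mx d f ∧ A.Lam {d, f} (tz • dl d - dl f)
def DD (A : Sys R) (d f : R) : Prop := A.Mx d f ∧ A.Lam {d, f} (dl d)

theorem MM3 (ha : A.l a = 1) : A.PureL a ∨ (∃ d, A.CC a d) ∨ ∃ d, A.DD a d := by
  rcases MM a ha with h | ⟨d, h1, h2, h3, h4, h5 | h5⟩
  · exact Or.inl h
  · exact Or.inr (Or.inl ⟨d, ⟨h1, h2, h3, h4⟩, h5⟩)
  · exact Or.inr (Or.inr ⟨d, ⟨h1, h2, h3, h4⟩, h5⟩)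

/-- the `H`-criterion for dominance -/
theorem domH (h : ∀ y, A.Lam {y, x} (dl y) → A.Lam (insert y S) (dl y)) :
    A.Dom x S := by
  intro T u hs hu hl
  obtain ⟨y, y1, y2⟩ := A.ext (S := T) (T := {x}) (u := u) (v := 0) hu (Ov_zero _)
    (A.mono (by simpa using hl) (by intro z hz; simp at hz ⊢; tauto))
  have y3 := h y (c1 1 y2)
  have D : A.Dom y T := domk 0 (A.mono (by simpa using y3) (Set.insert_subset_insert hs))
  exact D T u subset_rfl hu (c2 1 y3 (-1) y1 (by module)
    (s := ⟨Set.insert_subset_insert hs⟩))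

theorem single (hs : A.In2 s c c) (h : ∀ x, A.In2 x c c → x = s) : A.Dom c {s} := by
  apply domH
  intro y hy
  obtain ⟨z, z1⟩ := pick2 (A := A) y s
  have Dy : A.Dom y {c} := domk 0 (c1 1 hy)
  have Ds : A.Dom s {c} := domk (tz • dl c) (c1 1 hs)
  have e : A.In2 z c c := Ds.drop (Dy.drop (T := {s, z, c}) (c3 1 z1 1 hs 1 hy :
    A.Lam {y, s, z, c} (dl z - dl c - dl c)) : A.Lam {s, z, c} (dl z - dl c - dl c))
  have := h z e
  subst this
  exact c1 (-1) z1

theorem cc_dd (hd : A.l d = 1) (h : A.Lam {a, d} (tz • dl a - dl d))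
    (h' : A.Lam {a, d} (dl a)) : False := by
  have Da : A.Dom a {d} := domk 0 (c1 1 h')
  exact not1 hd (Da.drop (c2 (-1) h 2 h' : A.Lam {a, d} (dl d)))

theorem CC.dom (h : A.CC a d) : A.Dom d {a} := domk (tz • dl a) (c1 (-1) h.2)
theorem DD.dom (h : A.DD a d) : A.Dom a {d} := domk 0 (c1 1 h.2)
theorem Mx.q (h : A.Mx a d) : A.Lam {d} (((A.r a : ℤ)) • dl d) := by
  have := h.2.2.1.q h.1
  rw [← h.2.1]; push_cast; exact this

theorem Mx.form (h : A.Mx a d) {m : Multiset R} (hm : A.Circ m) (am : a ∈ m)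
    (hc : m.card = A.r a + 1) : ∃ i j, i + 1 + j = A.r a + 1 ∧ m = rp (i + 1) a + rp j d ∧
      A.Lam {a, d} ((i + 1 : ℤ) • dl a + (j : ℤ) • dl d) := by
  obtain ⟨i, j, h1, rfl⟩ := two_letters (h.2.2.2 m hm am hc)
  have i0 : i ≠ 0 := by
    rintro rfl
    simp [Multiset.mem_replicate] at am
    have := h.2.1
    rw [← am.2] at this; omega
  obtain ⟨i, rfl⟩ := Nat.exists_eq_succ_of_ne_zero i0
  exact ⟨i, j, by omega, rfl, hm.lam⟩

theorem CC.circ (h : A.CC a d) (ha : A.l a = 1) {m : Multiset R} (hm : A.Circ m) (am : a ∈ m)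
    (hc : m.card = A.r a + 1) : m = rp 2 a + rp (A.r d) d := by
  obtain ⟨i, j, h1, rfl, h2⟩ := h.1.form hm am hc
  obtain ⟨hd, hda, pd, ml⟩ := h.1
  have hd0 := r_pos hd
  have hq := pd.q hd
  rcases Nat.even_or_odd' i with ⟨t, rfl | rfl⟩
  · have e1 : A.Lam {a, d} (dl a + (t + j : ℤ) • dl d) := c2 1 h2 (-t : ℤ) h.2
    exfalso
    obtain ⟨k, hk⟩ : ∃ k, t + j = k + 1 := ⟨t + j - 1, by omega⟩
    have hk' : (t + j : ℤ) = k + 1 := by exact_mod_cast hk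
    have := (mkC (a :> rp (k + 1) d) (show A.Lam {a, d} (dl a + (k + 1 : ℤ) • dl d) by rw [← hk']; exact e1)).le a
    simp at this
    have t0 : t = 0 := by omega
    subst t0
    have hj : (j : ℤ) = A.r d + 1 := by omega
    exact cc_dd hd h.2 (c2 1 h2 (-1) hq (by rw [hj]; module))
  · have hj0 : t = 0 := by
      by_cases hk : t + j = 0
      · omega
      obtain ⟨k, hk⟩ := Nat.exists_eq_succ_of_ne_zero hk
      have hk' : (t + j : ℤ) = k + 1 := by exact_mod_cast hk
      have := (mkC (a :> a :> rp (k + 1) d) (c2 1 h2 (-t : ℤ) h.2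
        (by rw [← hk']; push_cast; module) : A.Lam {a, d} (tz • dl a + (k + 1 : ℤ) • dl d))).le a
      simp at this
      omega
    subst hj0
    have : j = A.r d := by omega
    rw [this]

theorem CC.nqp (h : A.CC a d) (ha : A.l a = 1) (hq : A.QP a) : False := by
  obtain ⟨hd, hda, pd, ml⟩ := h.1
  have C : A.Circ (rp (A.r a + 1) a) := mkC _ hq
  have h1 := h.circ ha C bs bs
  have h0 := r_pos hd
  have h2 : d ∈ rp (A.r a + 1) a := by rw [h1]; simp [Multiset.mem_replicate]; omega
  have h3 := Multiset.eq_of_mem_replicate h2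
  subst h3; omega

theorem DD.circ (h : A.DD a d) (ha : A.l a = 1) {m : Multiset R} (hm : A.Circ m) (am : a ∈ m)
    (hc : m.card = A.r a + 1) : m = a :> rp (A.r a) d ∨ A.QP a := by
  obtain ⟨i, j, h1, rfl, h2⟩ := h.1.form hm am hc
  obtain ⟨hd, hda, pd, ml⟩ := h.1
  have e1 : A.Lam {d} ((j : ℤ) • dl d) := h.dom.drop (c2 1 h2 (-(i + 1) : ℤ) h.2 : A.Lam {a, d} ((j : ℤ) • dl d))
  by_cases j0 : j = 0
  · subst j0
    right
    obtain rfl : i = A.r a := by omega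
    exact hm.lam
  · left
    have := rep_le hd e1 j0
    obtain rfl : i = 0 := by omega
    obtain rfl : j = A.r a := by omega
    rfl

/-- an arc in a square -/
theorem sq_arc (ha : A.l a = 1) (hc : A.l c = 1) (h : A.In2 c a a) (hr : A.r c + 1 = A.r a) :
    A.CC a c := by
  have pc : A.PureL c := by
    rcases MM c hc with h1 | ⟨f, h1⟩
    · exact h1
    · exact (claimX ha ha hc hr h h1).elim
  have hq := pc.q hc
  have h0 := r_pos hc
  obtain ⟨n, hn⟩ : ∃ n, A.r c = n + 1 := ⟨A.r c - 1, by omega⟩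
  rw [hn] at hq
  have C : A.Circ (a :> a :> rp (n + 1) c) := mkC _ (c2 (-1) h 1 hq :
    A.Lam {a, c} (tz • dl a + (n + 1 : ℤ) • dl c))
  have hac : a ≠ c := by rintro rfl; omega
  have ml : ∀ d, A.Mx a d → d = c := fun d hd => A.inj (by rw [hd.1, hc]) (by have := hd.2.1; omega)
  rcases MM3 ha with h1 | ⟨d, h1⟩ | ⟨d, h1⟩
  · exact absurd (h1 _ C bs (by simp; omega) c bs).symm hac
  · obtain rfl := ml d h1.1
    exact h1
  · obtain rfl := ml d h1.1
    exact ⟨h1.1, c1 (-1) h⟩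

theorem T3 (ha : A.l a = 1) (h2 : 2 ≤ A.r a) :
    (A.QP a ∧ ∃ s, A.l s = 2 ∧ A.r s + 1 = A.r a ∧ A.In2 s a a ∧ ∀ x, A.In2 x a a → x = s) ∨
    (¬ A.QP a ∧ ∃ d s, A.DD a d ∧ A.l s = 2 ∧ A.r s = A.r a ∧ A.In2 s a a ∧ ∀ x, A.In2 x a a → x = s) ∨
    (∃ d, A.CC a d ∧ ∀ x, A.In2 x a a → x = d ∨ (A.l x = 2 ∧ A.r x = A.r a)) := by
  obtain ⟨n, hn⟩ : ∃ n, A.r a = n + 2 := ⟨A.r a - 2, by omega⟩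
  by_cases hq : A.QP a
  · left
    have key : ∀ x, A.In2 x a a → A.l x = 2 ∧ A.r x + 1 = A.r a := by
      intro x hx
      have x5 := (hx.bd ha ha).2.1
      have hq' := hq
      unfold QP at hq'
      rw [hn] at hq'
      have x6 := rle (x := x) (rp (n + 1) a) (c2 1 hx 1 hq' : A.Lam {x, a} (dl x + (n + 1 : ℤ) • dl a))
      simp at x6
      rcases hx.lor ha ha oo with xl | xl
      · exact ((sq_arc ha xl hx oo).nqp ha hq).elim
      · exact ⟨xl, by omega⟩
    obtain ⟨s, hs⟩ := pick2 (A := A) a a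
    obtain ⟨s1, s2⟩ := key s hs
    refine ⟨hq, s, s1, s2, hs, fun x hx => ?_⟩
    obtain ⟨x1, x2⟩ := key x hx
    exact A.ij
  right
  rcases MM3 ha with h1 | ⟨d, h1⟩ | ⟨d, h1⟩
  · exact absurd (h1.q ha) hq
  · right
    refine ⟨d, h1, fun x hx => ?_⟩
    obtain ⟨hd, hda, pd, ml⟩ := h1.1
    have hqd := pd.q hd
    have hd' : A.r d = n + 1 := by omega
    rw [hd'] at hqd
    have x5 := (hx.bd ha ha).2.1
    have e1 : A.Lam {d, x, a} (dl x + tz • dl a + (n : ℤ) • dl d) := c3 1 hx 2 h1.2 1 hqd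
    have x6 : A.r x ≤ n + 2 := by
      rcases n with _ | k
      · simpa using rle (x := x) (a :> a :> 0) (h1.dom.drop (by simpa using e1) :
          A.Lam {x, a} (dl x + tz • dl a))
      · have := rle (x := x) (a :> a :> rp (k + 1) d) e1
        simp at this; omega
    rcases (show A.r x = n + 1 ∨ A.r x = n + 2 by omega) with xr | xr
    · left
      obtain ⟨m, m1, m2, m3⟩ := (mkIn (a :> a :> 0) hx : A.In x _).circ (by simp [ha])
      have h3 := h1.circ ha m2 bs (by simp; omega)
      have h4 : m = rp (A.r d) d := by
        have e : rp 2 a = a :> a :> 0 := rfl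
        rw [e] at h3
        exact add_left_cancel h3
      subst h4
      rw [hd'] at m3
      exact A.sep (c2 1 (Neg.lam m3 : A.Lam {x, d} (dl x + (n + 1 : ℤ) • dl d)) (-1) hqd : A.Lam {x, d} (dl x - dl d))
    · right
      rcases hx.lor ha ha oo with xl | xl
      · obtain rfl : x = a := A.ij
        exact (not1 ha (c1 (-1) hx)).elim
      · exact ⟨xl, by omega⟩
  · left
    have hd := h1.1.1
    have hda := h1.1.2.1
    have hqd := h1.1.q
    rw [hn] at hqd
    have key : ∀ x, A.In2 x a a → A.l x = 2 ∧ A.r x = A.r a := by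
      intro x hx
      have x5 := (hx.bd ha ha).2.1
      have e1 : A.Lam {x, d} (dl x) := h1.dom.drop (c2 1 hx 2 h1.2 : A.Lam {a, x, d} (dl x))
      have x6 := rle (x := x) (rp (n + 2) d) (c2 1 e1 1 hqd : A.Lam {x, d} (dl x + (n + 2 : ℤ) • dl d))
      simp at x6
      have x7 : A.r x ≠ n + 1 := by
        intro x7
        obtain ⟨m, m1, m2⟩ := hx.circ ha ha
        rcases h1.circ ha m2 bs (by simp; omega) with h3 | h3
        · have h4 : a ∈ rp (A.r a) d := by
            rw [← (Multiset.cons_inj_right a).1 h3]; simp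
          have := Multiset.eq_of_mem_replicate h4
          subst this; omega
        · exact hq h3
      rcases hx.lor ha ha oo with xl | xl
      · obtain rfl : x = a := A.ij
        exact (not1 ha (c1 (-1) hx)).elim
      · exact ⟨xl, by omega⟩
    obtain ⟨s, hs⟩ := pick2 (A := A) a a
    obtain ⟨s1, s2⟩ := key s hs
    refine ⟨hq, d, s, h1, s1, s2, hs, fun x hx => ?_⟩
    obtain ⟨x1, x2⟩ := key x hx
    exact A.ij

theorem CC.HC (h : A.CC a d) (ha : A.l a = 1) {S : Set R} {v : R → ℤ} (o : Ov S v)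
    (hv : A.Lam (insert a S) v) : A.Lam (insert d S) v ∨
      ∃ t, A.l t = 2 ∧ A.r t = A.r a ∧ A.In2 t a a ∧ A.Lam (insert d (insert t S)) (v + dl d - dl t) := by
  obtain ⟨y, y1, y2⟩ := A.ext (S := S) (T := {a}) (u := v) (v := 0) o (Ov_zero _)
    (A.mono (by simpa using hv) (by intro z hz; simp at hz ⊢; tauto))
  have y3 : A.Lam {y, a} (dl y) := c1 1 y2
  have Dy : A.Dom y {a} := domk 0 (c1 1 y3)
  have DyS : A.Dom y S := domk v y1 (o := ⟨o⟩)
  obtain ⟨z, z1⟩ := pick2 (A := A) y d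
  have e : A.In2 z a a := h.dom.drop (Dy.drop (T := {d, z, a}) (c3 1 z1 (-1) h.2 1 y3 :
    A.Lam {y, d, z, a} (dl z - dl a - dl a)) : A.Lam {d, z, a} (dl z - dl a - dl a))
  have h0 := r_pos h.1.1
  have h00 := h.1.2.1
  have key : z = d ∨ (A.l z = 2 ∧ A.r z = A.r a) := by
    rcases T3 ha oo with ⟨h1, -⟩ | ⟨h1, d', s, h2, -⟩ | ⟨d', h1, h2⟩
    · exact (h.nqp ha h1).elim
    · obtain rfl : d' = d := A.inj (by rw [h2.1.1, h.1.1]) (by have := h2.1.2.1; omega)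
      exact (cc_dd h.1.1 h.2 h2.2).elim
    · obtain rfl : d' = d := A.inj (by rw [h1.1.1, h.1.1]) (by have := h1.1.2.1; omega)
      exact h2 z e
  rcases key with rfl | ⟨zl, zr⟩
  · left
    have e1 : A.Lam (insert y (insert z S)) v := c2 (-1) z1 (-1) y1 (by module)
      (s' := ⟨Set.insert_subset_insert (Set.subset_insert _ _)⟩)
    exact DyS _ _ (Set.subset_insert _ _) (o.mono (Set.subset_insert _ _)) e1
  · right
    refine ⟨z, zl, zr, e, ?_⟩
    have e1 : A.Lam (insert y (insert d (insert z S))) (v + dl d - dl z) := c2 (-1) z1 (-1) y1 (by module)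
      (s' := ⟨Set.insert_subset_insert ((Set.subset_insert _ _).trans (Set.subset_insert _ _))⟩)
    refine DyS _ _ ((Set.subset_insert _ _).trans (Set.subset_insert _ _)) ?_ e1
    exact Ov_sub (Ov_add (o.mono ((Set.subset_insert _ _).trans (Set.subset_insert _ _)))
      (Ov_dl bs)) (Ov_dl bs)

theorem CC.tau (h : A.CC a d) (ha : A.l a = 1) (t1 : A.In2 t a a) (tl : A.l t = 2)
    (tr : A.r t = A.r a) : A.Dom t {d} ∧ A.Lam {t, d} (tz • dl t + (A.r a - 2 : ℤ) • dl d) := by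
  have Dt : A.Dom t {a} := domk (tz • dl a) (c1 1 t1)
  have hq := h.1.q
  have ntd : t ≠ d := by rintro rfl; have := h.1.1; omega
  have uniq : ∀ t', A.l t' = 2 → A.r t' = A.r a → t' = t := fun t' h1 h2 => A.ij
  constructor
  · apply domH
    intro y hy
    have Dy : A.Dom y {t} := domk 0 (c1 1 hy)
    rcases h.HC ha (S := {y}) (v := dl y) (Ov_dl bs) (Dt.drop (T := {a, y}) (c1 1 hy : A.Lam {t, a, y} (dl y))) with h1 | ⟨t', a1, a2, -, h1⟩
    · exact c1 1 h1
    · obtain rfl := uniq t' a1 a2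
      exact absurd (A.sep (Dy.drop (T := {t', d}) (c2 (-1) h1 1 hy : A.Lam {y, t', d} (dl t' - dl d)))) ntd
  · have e : A.Lam {a, t, d} (tz • dl t + (A.r a - 2 : ℤ) • dl d) := c3 2 t1 2 h.2 1 hq
    rcases h.HC ha (S := {t, d}) (Ov_add (Ov_smul _ (Ov_dl bs)) (Ov_smul _ (Ov_dl bs))) e with h1 | ⟨t', a1, a2, -, h1⟩
    · exact c1 1 h1
    · obtain rfl := uniq t' a1 a2
      exact absurd (A.sep (c2 1 h1 (-1) hq : A.Lam {t', d} (dl t' - dl d))) ntd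


def II (A : Sys R) (a b : R) : Prop := A.Lam {a, b} (tz • dl a)
def SS (A : Sys R) (a b : R) : Prop := A.Lam {a, b} (tz • dl a - dl b)
structure Viol (A : Sys R) (a b : R) : Prop where
  la : A.l a = 1
  lb : A.l b = 1
  ne : a ≠ b
  i1 : ¬ A.II a b
  i2 : ¬ A.II b a
  s1 : ¬ A.SS a b
  s2 : ¬ A.SS b a

theorem Viol.symm (h : A.Viol a b) : A.Viol b a :=
  ⟨h.lb, h.la, h.ne.symm, h.i2, h.i1, h.s2, h.s1⟩

theorem Viol.na (h : A.Viol a b) : ¬ A.Lam {a, b} (dl a) := fun h' => h.i1 (c1 2 h')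
theorem Viol.nb (h : A.Viol a b) : ¬ A.Lam {a, b} (dl b) := fun h' => h.i2 (c1 2 h')

theorem two_q (ha : A.l a = 1) (h : A.r a = 1) : A.Lam {a} (tz • dl a) := by
  have := (mm_two ha h).q ha
  rw [h] at this
  exact c1 1 this

theorem Viol.r2 (h : A.Viol a b) : 2 ≤ A.r a := by
  have h0 := r_pos h.la
  by_contra h1
  exact h.i1 (c1 1 (two_q h.la oo))

def Mn (A : Sys R) (a b : R) (M : ℕ) : Prop :=
  (∃ m, A.Circ (a :> b :> m) ∧ m.card = M) ∧ ∀ m, A.Circ (a :> b :> m) → M ≤ m.card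

theorem Mn.symm (h : A.Mn a b M) : A.Mn b a M := by
  obtain ⟨⟨m, h1, h2⟩, h3⟩ := h
  exact ⟨⟨m, by rw [Multiset.cons_swap]; exact h1, h2⟩, fun m hm => h3 m (by
    rw [Multiset.cons_swap]; exact hm)⟩

theorem mn_ex (ha : A.l a = 1) (hb : A.l b = 1) : ∃ M, A.Mn a b M := by
  classical
  obtain ⟨x, hx⟩ := pick2 (A := A) a b
  obtain ⟨m, h1, h2⟩ := hx.circ ha hb
  have ex : ∃ M, ∃ m, A.Circ (a :> b :> m) ∧ m.card = M := ⟨_, m, h2, rfl⟩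
  exact ⟨Nat.find ex, Nat.find_spec ex, fun m hm => Nat.find_min' ex ⟨m, hm, rfl⟩⟩

theorem Mn.in2 (h : A.Mn a b M) (ha : A.l a = 1) (hb : A.l b = 1)
    (hx : A.In2 x a b) : M ≤ A.r x := by
  obtain ⟨m, h1, h2⟩ := hx.circ ha hb
  rw [← h1]; exact h.2 m h2

/-- `N` exceeds the types -/
theorem Viol.T5 (h : A.Viol a b) {m : Multiset R} (hm : A.Circ (a :> b :> m)) :
    A.r a ≤ m.card := by
  have h1 := hm.le a
  simp at h1
  by_contra h2
  have h3 : (a :> b :> m).card = A.r a + 1 := by simp; omega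
  rcases MM3 h.la with p | ⟨d, p, p2⟩ | ⟨d, p, p2⟩
  · exact h.ne (p _ hm bs h3 b bs).symm
  · rcases p.2.2.2 _ hm bs h3 b bs with rfl | rfl
    · exact h.ne rfl
    · exact h.s1 p2
  · rcases p.2.2.2 _ hm bs h3 b bs with rfl | rfl
    · exact h.ne rfl
    · exact h.na p2

theorem Viol.T5' (h : A.Viol a b) (hM : A.Mn a b M) : A.r a ≤ M ∧ A.r b ≤ M := by
  obtain ⟨⟨m, h1, h2⟩, h3⟩ := hM
  exact ⟨h2 ▸ h.T5 h1, h2 ▸ h.symm.T5 (m := m) (by rw [Multiset.cons_swap]; exact h1)⟩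

theorem Lk (ha : A.l a = 1) (hd : A.l d = 1) (hM : A.r d = M) (hM2 : 2 ≤ M)
    (h : A.In2 d a b) (nb : ¬ A.Lam {a, b} (dl a)) (U : ∃ x, A.In2 x a d ∧ A.r x ≤ M)
    (V : ∀ m, A.Circ (a :> d :> m) → m.card + 1 ≠ M) : ∃ x, A.In2 x a d ∧ A.l x = 2 ∧ A.r x = M := by
  obtain ⟨x, x1, x2⟩ := U
  have x3 := (x1.bd ha hd).2.2.1
  have x4 : A.r x = M := by
    by_contra h'
    obtain ⟨m, m1, m2⟩ := x1.circ ha hd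
    exact V m m2 oo
  refine ⟨x, x1, ?_, x4⟩
  refine (x1.lor ha hd oo).resolve_left fun xl => ?_
  obtain rfl : x = d := A.ij
  have a1 : A.Lam {a, x} (dl a) := c1 (-1) x1
  have Da : A.Dom a {x} := domk 0 (c1 1 a1)
  obtain rfl : x = b := A.sep (Da.drop (c2 1 h 1 a1 : A.Lam {a, x, b} (dl x - dl b)))
  exact nb a1

theorem Lsame (h : A.In2 d a b) (h1 : A.In2 x a d) (h2 : A.In2 x b d) : a = b :=
  A.sep (h.dom.drop (h1.dom.drop (T := {d, a, b}) (c2 (-1) h1 1 h2 : A.Lam {x, d, a, b} (dl a - dl b)) :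
    A.Lam {d, a, b} (dl a - dl b)))

/-- parity reduction -/
theorem parity (h2 : A.II a f)
    (h : A.Lam {a, f} ((j + 1 : ℤ) • dl a + (i + 1 : ℤ) • dl f)) :
    (j % 2 = 1 ∧ A.Lam {a, f} ((i + 1 : ℤ) • dl f)) ∨ (j % 2 = 0 ∧ A.Lam {a, f} (dl a + (i + 1 : ℤ) • dl f)) := by
  rcases Nat.even_or_odd' j with ⟨t, rfl | rfl⟩
  · exact Or.inr ⟨by omega, c2 1 h (-t : ℤ) h2⟩
  · exact Or.inl ⟨by omega, c2 1 h (-t - 1 : ℤ) h2⟩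

theorem Circ.arcs (h : A.Circ m) [s : SubC (lts m') (lts m)] : ∀ y ∈ m', A.l y = 1 :=
  fun y hy => h.1 y (s.1 hy)

theorem Circ.re (h : A.Circ m) (m' : Multiset R) (e : vec m = vec m' := by
      simp only [vec_cons, vec_add, vec_zero, vec_singleton, vec_rep] <;> push_cast <;> module) : A.Circ m' := by
  rw [← vec_inj e]; exact h

theorem XA (ha : A.l a = 1) (hf : A.l f = 1) (pf : A.PureL f) (naf : a ≠ f)
    (xa : A.In2 x a f) (xl : A.l x = 2) (e : A.r x = A.r f) :
    ∃ i j : ℕ, i + j = A.r f ∧ A.Lam {a, f} ((i + 1 : ℤ) • dl a + (j + 1 : ℤ) • dl f) := by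
  obtain ⟨m, m1, m2⟩ := xa.circ ha hf
  have hrf := r_pos hf
  have G : ∀ g ∈ m, A.Lam (insert g {a, f}) (dl g - dl a) ∨ A.Lam (insert g {a, f}) (dl g - dl f) := by
    intro g hg
    obtain ⟨m', rfl⟩ := Multiset.exists_cons_of_mem hg
    have hgl : A.l g = 1 := m2.1 g bs
    have m3 := m2.re (f :> g :> a :> m')
    obtain ⟨w, w1, w2, w3, w4⟩ := m3.split2
    simp at w4 m1
    have w5 := (w1.bd hf hgl).2.1
    by_cases w6 : A.r w + 1 = A.r f
    · obtain ⟨k, k1, k2⟩ := w1.circ hf hgl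
      have := pf _ k2 bs (by simp; omega) g bs
      subst this
      exact Or.inr (c1 0 (A.zero ∅))
    · rcases w1.lor hf hgl oo with wl | wl
      · obtain rfl : w = f := A.ij
        have g1 : A.Lam {g, w} (dl g) := c1 (-1) w1
        have Dg : A.Dom g {w} := domk 0 (c1 1 g1)
        have := pf _ (mkC (a :> w :> m') (Dg.drop (T := lts (a :> w :> m'))
          (c2 1 m2.2 (-1) g1 (by simp only [vec_cons]; module) :
          A.Lam (insert g (lts (a :> w :> m'))) (dl a + dl w + vec m')))
          (by simp only [vec_cons]; module) m2.arcs)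
          bs (by simp; omega) a bs
        exact absurd this naf
      · obtain rfl : w = x := A.ij
        exact Or.inl (xa.dom.drop (c2 1 xa (-1) w1 : A.Lam {w, g, a, f} (dl g - dl a)))
  obtain ⟨i, j, ij, e3⟩ := absorb (A := A) (S := {a, f}) (Ov_dl bs) (Ov_dl bs) m (dl a + dl f)
    (Ov_add (Ov_dl bs) (Ov_dl bs)) G (c1 1 m2.2 (by simp only [vec_cons]; module))
  exact ⟨i, j, by omega, c1 1 e3⟩

theorem XB (ha : A.l a = 1) (hf : A.l f = 1) (pf : A.PureL f) (naf : a ≠ f)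
    (xa : A.In2 x a f) (xl : A.l x = 2) (e : A.r x = A.r f) (ii : A.II a f)
    (naH : ¬ A.Lam {a, f} (dl a)) : A.Lam {a, f} (dl f) := by
  obtain ⟨i, j, ij, e3⟩ := XA ha hf pf naf xa xl e
  have hq := pf.q hf
  rcases parity (i := j) (j := i) ii e3 with ⟨h1, h2⟩ | ⟨h1, h2⟩
  · have := (mkC (a :> a :> rp (j + 1) f) (c2 1 h2 1 ii : A.Lam {a, f} (tz • dl a + (j + 1 : ℤ) • dl f))).le f
    simp at this
    have e4 : A.r f = j + 1 := by omega
    rw [e4] at hq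
    exact c2 1 hq (-1) h2
  · exfalso
    by_cases hi : i = 0
    · rw [show A.r f = j by omega] at hq
      exact naH (c2 1 h2 (-1) hq)
    · have := (mkC (a :> rp (j + 1) f) h2).le f
      simp at this; omega

set_option maxHeartbeats 400000 in
theorem Viol.L (V : A.Viol a b) (hM : A.Mn a b M) (h : A.In2 d a b) (hd : A.l d = 1)
    (hr : A.r d = M) : False := by
  have ha := V.la
  have hb := V.lb
  obtain ⟨raM, rbM⟩ := V.T5' hM
  have ra := V.r2
  have rb := V.symm.r2
  have nad : a ≠ d := by rintro rfl; exact V.nb (c1 (-1) h)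
  have nbd : b ≠ d := by rintro rfl; exact V.na (c1 (-1) h)
  have fin : (∃ x, A.In2 x a d ∧ A.r x ≤ M) → (∃ x, A.In2 x b d ∧ A.r x ≤ M) →
      (∀ m, A.Circ (a :> d :> m) → m.card + 1 ≠ M) → (∀ m, A.Circ (b :> d :> m) → m.card + 1 ≠ M) →
      False := by
    intro U1 U2 V1 V2
    obtain ⟨x, x1, x2, x3⟩ := Lk ha hd hr oo h V.na U1 V1
    obtain ⟨y, y1, y2, y3⟩ := Lk hb hd hr oo h.symm V.symm.na U2 V2
    obtain rfl : x = y := A.ij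
    exact V.ne (Lsame h x1 y1)
  obtain ⟨n, rfl⟩ : ∃ n, M = n + 2 := ⟨M - 2, by omega⟩
  have nab : ¬ A.Lam {a, b} (dl a + dl b) := fun h' => by
    have := (mkC (a :> b :> 0) h').le a
    simp at this; omega
  rcases MM3 hd with p | ⟨f, p⟩ | ⟨f, p⟩
  · have hq := p.q hd
    rw [hr] at hq
    have e : A.Lam {a, b, d} (dl a + dl b + (n + 2 : ℤ) • dl d) := c2 (-1) h 1 hq
    have pp : ∀ c, c ≠ d → ∀ m, A.Circ (c :> d :> m) → m.card + 1 ≠ n + 2 := fun c hc m hm hh =>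
      hc (p _ hm bs (by simp; omega) c bs)
    refine fin ?_ ?_ (pp a nad) (pp b nbd)
    · obtain ⟨x, x1, x2, x3, x4⟩ := (mkC (a :> d :> b :> rp (n + 1) d) e).split2
      exact ⟨x, x1, by simpa using x4⟩
    · obtain ⟨x, x1, x2, x3, x4⟩ := (mkC (b :> d :> a :> rp (n + 1) d) e).split2
      exact ⟨x, x1, by simpa using x4⟩
  · have hf := p.1.1
    have hq := p.1.q
    have hff := p.1.2.1
    rw [hr] at hq
    have Df : A.Dom f {d} := domk (tz • dl d) (c1 (-1) p.2)
    have e : A.Lam {a, b, d, f} (dl a + dl b + dl d + (n + 1 : ℤ) • dl f) := c3 (-1) h 1 p.2 1 hq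
    have pp : ∀ c b, A.In2 d c b → A.l b = 1 → c ≠ d → ∀ m, A.Circ (c :> d :> m) → m.card + 1 ≠ n + 2 := by
      intro c b h hb hc m hm hh
      rcases p.1.2.2.2 _ hm bs (by simp; omega) c bs with h1 | rfl
      · exact hc h1
      · have := (mkC (b :> d :> 0) (Df.drop (c2 (-1) h 1 p.2 : A.Lam {c, b, d} (dl b + dl d)) :
          A.Lam {b, d} (dl b + dl d))).le d
        simp at this; omega
    refine fin ?_ ?_ (pp a b h hb nad) (pp b a h.symm ha nbd)
    · obtain ⟨x, x1, x2, x3, x4⟩ := (mkC (a :> d :> b :> rp (n + 1) f) e).split2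
      exact ⟨x, x1, by simpa using x4⟩
    · obtain ⟨x, x1, x2, x3, x4⟩ := (mkC (b :> d :> a :> rp (n + 1) f) e).split2
      exact ⟨x, x1, by simpa using x4⟩
  · have hf := p.1.1
    have hq := p.1.q
    have hff := p.1.2.1
    have Dd := p.dom
    have ml := p.1.2.2.2
    have pf := p.1.2.2.1
    have hdf := p.2
    rw [hr] at hq
    have ab : A.Lam {a, b, f} (dl a + dl b) := Dd.drop (T := {a, b, f}) (c2 (-1) h 1 p.2 :
      A.Lam {d, a, b, f} (dl a + dl b))
    have Da : A.Dom a {b, f} := domk (-dl b) (c1 1 ab)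
    have Db : A.Dom b {a, f} := domk (-dl a) (c1 1 ab)
    have naf : a ≠ f := by
      rintro rfl
      exact nab (c1 1 ab)
    have nbf : b ≠ f := by
      rintro rfl
      exact nab (c1 1 ab)
    have pp : ∀ c, c ≠ d → c ≠ f → ∀ m, A.Circ (c :> d :> m) → m.card + 1 ≠ n + 2 := by
      intro c hc hc' m hm hh
      rcases ml _ hm bs (by simp; omega) c bs with h1 | h1
      exacts [hc h1, hc' h1]
    have sub1 : A.Lam {a, f} (dl a) → A.Lam {b, f} (dl b) → False := by
      intro a1 b1
      have pu : ∀ c, A.Lam {c, f} (dl c) → ∃ x, A.In2 x c d ∧ A.r x ≤ n + 2 := by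
        intro c hc
        obtain ⟨x, x1⟩ := pick2 (A := A) c d
        have Dc : A.Dom c {f} := domk 0 (c1 1 hc)
        have e : A.Lam {x, f} (dl x) := Dd.drop (Dc.drop (T := {d, x, f}) (c3 1 x1 1 hc 1 p.2 : A.Lam {c, d, x, f} (dl x)) :
          A.Lam {d, x, f} (dl x))
        refine ⟨x, x1, ?_⟩
        simpa using rle (x := x) (rp (n + 2) f) (c2 1 e 1 hq : A.Lam {x, f} (dl x + (n + 2 : ℤ) • dl f))
      exact fin (pu a a1) (pu b b1) (pp a nad naf) (pp b nbd nbf)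
    have naH : ¬ A.Lam {a, f} (dl a) := fun a1 => sub1 a1 (by
      have Da' : A.Dom a {f} := domk 0 (c1 1 a1)
      exact Da'.drop (c2 1 ab (-1) a1 : A.Lam {a, b, f} (dl b)))
    have nbH : ¬ A.Lam {b, f} (dl b) := fun b1 => sub1 (by
      have Db' : A.Dom b {f} := domk 0 (c1 1 b1)
      exact Db'.drop (c2 1 ab (-1) b1 : A.Lam {b, a, f} (dl a))) b1
    have ef : A.r f = n + 1 := by omega
    have K : ∀ c c', A.l c = 1 → A.l c' = 1 → A.Lam {c, c', f} (dl c + dl c') → c ≠ f →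
        ¬ A.Lam {c, f} (dl c) → 2 ≤ A.r c → ∀ x, A.In2 x c f → A.l x = 2 ∧ (A.r x = n + 1 ∨ A.r x = n + 2) ∧
          ¬ A.Lam {x, f} (dl x) := by
      intro c c' hc hc' cc' cf cH c2' x hx
      have two : ¬ A.Lam {c, f} (dl c + dl f) := fun h' => by
        have := (mkC (c :> f :> 0) h').le c
        simp at this; omega
      have Dc : A.Dom c {c', f} := domk (-dl c') (c1 1 cc')
      have e1 : A.Lam {x, c', f} (dl x + dl c' - dl f) :=
        Dc.drop (c2 1 hx 1 cc' : A.Lam {c, x, c', f} (dl x + dl c' - dl f))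
      have u1 : A.r x ≤ n + 2 := by
        simpa using rle (x := x) (c' :> rp (n + 1) f) (c2 1 e1 1 hq :
          A.Lam {x, c', f} (dl x + dl c' + (n + 1 : ℤ) • dl f))
      have u2 := (hx.bd hc hf).2.2.1
      have u3 : A.r x ≠ n := fun h' => by
        obtain ⟨m, m1, m2⟩ := hx.circ hc hf
        exact cf (pf _ m2 bs (by simp; omega) c bs)
      refine ⟨(hx.lor hc hf oo).resolve_left fun xl => ?_, by omega, fun h' => ?_⟩
      · rcases (by omega : A.r x = n + 1 ∨ A.r x = n + 2) with e | e
        · obtain rfl : x = f := A.ij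
          exact cH (c1 (-1) hx)
        · obtain rfl : x = d := A.ij
          exact two (Dd.drop (c2 (-1) hx 1 hdf : A.Lam {x, c, f} (dl c + dl f)))
      · have Dx : A.Dom x {f} := domk 0 (c1 1 h')
        exact two (Dx.drop (c2 (-1) hx 1 h' : A.Lam {x, c, f} (dl c + dl f)))
    obtain ⟨x, xa⟩ := pick2 (A := A) a f
    obtain ⟨x', xb⟩ := pick2 (A := A) b f
    obtain ⟨z, zd⟩ := pick2 (A := A) d d
    obtain ⟨xl, xr, xz⟩ := K a b ha hb ab naf naH ra x xa
    obtain ⟨xl', xr', xz'⟩ := K b a hb ha (c1 1 ab) nbf nbH rb x' xb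
    have zf : A.Lam {z, f} (dl z) := Dd.drop (c2 1 zd 2 hdf : A.Lam {d, z, f} (dl z))
    have Dz : A.Dom z {f} := domk 0 (c1 1 zf)
    have zr : A.r z ≤ n + 2 := by
      simpa using rle (x := z) (rp (n + 2) f) (c2 1 zf 1 hq : A.Lam {z, f} (dl z + (n + 2 : ℤ) • dl f))
    have zr' := (zd.bd hd hd).2.1
    have zl : A.l z = 2 := (zd.lor hd hd oo).resolve_left fun zl => by
      rcases (by omega : A.r z = n + 1 ∨ A.r z = n + 2) with e | e
      · obtain rfl : z = f := A.ij
        exact not1 hf (c1 1 zf)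
      · obtain rfl : z = d := A.ij
        exact not1 hd (c1 (-1) zd)
    have nxz : A.r x ≠ A.r z := fun e => by
      obtain rfl : x = z := A.ij
      exact xz zf
    have nxz' : A.r x' ≠ A.r z := fun e => by
      obtain rfl : x' = z := A.ij
      exact xz' zf
    obtain rfl : x = x' := A.ij
    have e1 : A.Lam {a, b, f} (dl a - dl b) := xa.dom.drop (c2 (-1) xa 1 xb : A.Lam {x, a, b, f} (dl a - dl b))
    have ii : A.II a f := Db.drop (c2 1 e1 1 ab : A.Lam {b, a, f} (tz • dl a))
    have Y : ∀ y, A.In2 y a d → n + 3 ≤ A.r y := by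
      intro y hy
      have y1 := (hy.bd ha hd).2.2.1
      have y2 : A.r y ≠ n + 1 := fun e => by
        obtain ⟨m, m1, m2⟩ := hy.circ ha hd
        exact pp a nad naf m m2 oo
      by_contra y3
      have y4 : A.r y = n + 2 := by omega
      rcases hy.lor ha hd oo with yl | yl
      · obtain rfl : y = d := A.ij
        exact naH (Dd.drop (c1 (-1) hy : A.Lam {y, a, f} (dl a)))
      · rcases (by omega : A.r y = A.r x ∨ A.r y = A.r z) with e | e
        · obtain rfl : y = x := A.inj oo e
          have e2 : A.Lam {a, f} (dl f) := Dd.drop (xa.dom.drop (T := {d, a, f})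
            (c3 (-1) xa 1 hy 1 hdf : A.Lam {y, d, a, f} (dl f)) : A.Lam {d, a, f} (dl f))
          have Df : A.Dom f {a} := domk 0 (c1 1 e2)
          exact nab (Df.drop (c1 1 ab : A.Lam {a, b, f} (dl a + dl b)))
        · obtain rfl : y = z := A.inj oo e
          exact naH (Dd.drop (Dz.drop (T := {d, a, f})
            (c3 1 zf (-1) hy (-1) hdf : A.Lam {y, d, a, f} (dl a)) : A.Lam {d, a, f} (dl a)))
    rcases (by omega : A.r z = n + 1 ∨ A.r x = n + 1) with e | e
    · obtain ⟨m, m1, m2⟩ := zd.circ hd hd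
      rcases p.circ hd m2 bs (by simp; omega) with h1 | h1
      · have h2 : d :> m = rp (A.r d) f := by simpa using h1
        have h3 : d ∈ rp (A.r d) f := h2 ▸ Multiset.mem_cons_self d m
        have h4 := Multiset.eq_of_mem_replicate h3
        rw [← h4] at ef; omega
      · unfold QP at h1
        rw [hr] at h1
        obtain ⟨y, y1, y2, y3, y4⟩ := (mkC (a :> d :> b :> rp (n + 1) d) (c2 (-1) h 1 h1 :
          A.Lam {a, b, d} (dl a + dl b + (n + 2 : ℤ) • dl d))).split2
        have := Y y y1
        simp at y4; omega
    · have e2 := XB ha hf pf naf xa xl oo ii naH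
      have Df : A.Dom f {a} := domk 0 (c1 1 e2)
      exact nab (Df.drop (c1 1 ab : A.Lam {a, b, f} (dl a + dl b)))


theorem inv (y : R) : ∃ x, A.Lam {x, y} (dl x + dl y) ∧ A.l x = A.r y ∧ A.r x = A.l y := by
  obtain ⟨x, h⟩ := A.pick {y} (-dl y)
  have h1 : A.Lam {x, y} (dl x + dl y) := c1 1 h
  have K : ∀ x y : R, A.Lam {x, y} (dl x + dl y) → A.l x ≤ A.r y ∧ A.r x ≤ A.l y := by
    intro x y h
    have D : A.Dom y {x} := domk (-dl x) (c1 1 h)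
    obtain ⟨m, m1, m2, m3⟩ := A.r_ex y
    obtain ⟨n, n1, n2, n3⟩ := A.l_ex y
    constructor
    · rw [← m2]
      exact A.l_le m1 (D.drop (c2 1 h (-1) m3 : A.Lam (insert y (insert x (lts m))) (dl x - vec m)))
    · rw [← n2]
      exact A.r_le n1 (D.drop (c2 1 h (-1) n3 : A.Lam (insert y (insert x (lts n))) (dl x + vec n)))
  have h2 := K x y h1
  have h3 := K y x (c1 1 h1)
  exact ⟨x, h1, by omega, by omega⟩

theorem T3C (ha : A.l a = 1) (h2 : 2 ≤ A.r a) (h : A.CC a d) (hx : A.In2 x a a) :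
    x = d ∨ (A.l x = 2 ∧ A.r x = A.r a) := by
  have hd := h.1.1
  have hr := h.1.2.1
  rcases T3 ha h2 with ⟨h, -⟩ | ⟨-, d', s, h', -⟩ | ⟨d', h', h''⟩
  · exact (CC.nqp ‹_› ha h).elim
  · obtain rfl : d' = d := A.inj (by rw [hd, h'.1.1]) (by have := h'.1.2.1; omega)
    exact (cc_dd hd h.2 h'.2).elim
  · obtain rfl : d' = d := A.inj (by rw [hd, h'.1.1]) (by have := h'.1.2.1; omega)
    exact h'' x hx

theorem Viol.z2 (V : A.Viol a b) (hM : A.Mn a b M) (h : A.In2 z a b) (hr : A.r z ≤ M) :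
    A.l z = 2 ∧ A.r z = M := by
  have h1 := hM.in2 V.la V.lb h
  have h2 := (V.T5' hM).1
  have h3 := V.r2
  refine ⟨(h.lor V.la V.lb oo).resolve_left fun h4 => V.L hM h h4 oo, by omega⟩

theorem Viol.zz (V : A.Viol a b) (hM : A.Mn a b M) :
    ∃ z, A.In2 z a b ∧ A.l z = 2 ∧ A.r z = M := by
  obtain ⟨m, h1, h2⟩ := hM.1
  obtain ⟨z, z1, z2, z3, z4⟩ := h1.split2
  exact ⟨z, z1, V.z2 hM z1 oo⟩

theorem In2.canc (h : A.In2 z a b) (h' : A.In2 z b c) : A.Lam {a, b, c} (dl a - dl c) :=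
  h.dom.drop (c2 (-1) h 1 h' : A.Lam {z, a, b, c} (dl a - dl c))

theorem two2 (ha : A.l a = 1) (hb : A.l b = 1) (h2 : 2 ≤ A.r a) : ¬ A.Lam {a, b} (dl a + dl b) := fun h' => by
  have := (mkC (a :> b :> 0) h').le a
  simp at this; omega

theorem PD (V : A.Viol a b) (hM : A.Mn a b M) (d : A.DD b h)
    (sl : A.l s = 2) (sr : A.r s = A.r b) (sb : A.In2 s b b) (ii : A.II a h) : False := by
  have ha := V.la
  have hb := V.lb
  obtain ⟨raM, rbM⟩ := V.T5' hM
  have ra := V.r2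
  have hh := d.1.1
  have hr := d.1.2.1
  have pf := d.1.2.2.1
  have hq := d.1.q
  have hbh := d.2
  have Db := d.dom
  have nah : a ≠ h := by rintro rfl; exact V.nb (c1 1 d.2)
  obtain ⟨n, hn⟩ : ∃ n, A.r b = n + 1 := ⟨A.r h, hr.symm⟩
  rw [hn] at hq
  have nab : A.r a ≠ A.r b := fun e => V.ne (A.inj oo e)
  have r1 : A.r a ≤ n := by
    have C := mkC (a :> a :> rp (n + 1) h) (c2 1 ii 1 hq : A.Lam {a, h} (tz • dl a + (n + 1 : ℤ) • dl h))
    have h1 := C.le a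
    simp at h1
    by_contra h2
    have h3 : (a :> a :> rp (n + 1) h).card = A.r a + 1 := by simp; omega
    have : h = a ∨ A.r h + 1 = A.r a := by
      rcases MM3 ha with p | ⟨d, p, -⟩ | ⟨d, p, -⟩
      · exact Or.inl (p _ C bs h3 h bs)
      · rcases p.2.2.2 _ C bs h3 h bs with rfl | rfl
        exacts [Or.inl rfl, Or.inr p.2.1]
      · rcases p.2.2.2 _ C bs h3 h bs with rfl | rfl
        exacts [Or.inl rfl, Or.inr p.2.1]
    rcases this with e | e
    · exact nah e.symm
    · omega
  obtain ⟨z, z1, zl, zr⟩ := V.zz hM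
  have zs : z ≠ s := by
    rintro rfl
    exact V.ne (A.sep (c1 1 (z1.canc sb)))
  have zs' : M ≠ n + 1 := fun e => zs (A.ij)
  have z3 : A.Lam {z, a, h} (dl z - dl a) := Db.drop (c2 1 z1 1 hbh : A.Lam {b, z, a, h} (dl z - dl a))
  have naH : ¬ A.Lam {a, h} (dl a) := fun aH => by
    have Da : A.Dom a {h} := domk 0 (c1 1 aH)
    have z4 : A.Lam {z, h} (dl z) := Da.drop (c2 1 z3 1 aH : A.Lam {a, z, h} (dl z))
    have := rle (x := z) (rp (n + 1) h) (c2 1 z4 1 hq : A.Lam {z, h} (dl z + (n + 1 : ℤ) • dl h))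
    simp at this; omega
  obtain ⟨y, hy⟩ := pick2 (A := A) a h
  have y1 : A.r y ≤ n + 1 := by
    simpa using rle (x := y) (a :> rp n h) (c3 1 hy 1 ii 1 hq : A.Lam {y, a, h} (dl y + dl a + (n : ℤ) • dl h))
      (s := ⟨by
        rcases n with _ | n
        · omega
        · exact SubC.out⟩)
  have y2 := (hy.bd ha hh).2.2.1
  have y3 : A.r y + 1 ≠ n := fun e => by
    obtain ⟨m, m1, m2⟩ := hy.circ ha hh
    exact nah (pf _ m2 bs (by simp; omega) a bs)
  have y4 : A.r y ≠ n + 1 := fun e => by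
    have : A.Lam {y, h} (dl y) := by
      rcases hy.lor ha hh oo with yl | yl
      · obtain rfl : y = b := A.ij
        exact hbh
      · obtain rfl : y = s := A.ij
        exact Db.drop (c2 1 sb 2 hbh : A.Lam {b, y, h} (dl y))
    have Dy : A.Dom y {h} := domk 0 (c1 1 this)
    exact two2 ha hh ra (Dy.drop (c2 (-1) hy 1 this : A.Lam {y, a, h} (dl a + dl h)))
  have yl : A.l y = 2 := (hy.lor ha hh oo).resolve_left fun yl => by
    obtain rfl : y = h := A.ij
    exact naH (c1 (-1) hy)
  have := XB ha hh pf nah hy yl oo ii naH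
  have Dh : A.Dom h {a} := domk 0 (c1 1 this)
  exact V.nb (Dh.drop (c1 1 hbh : A.Lam {h, a, b} (dl b)))

theorem Viol.P (V : A.Viol a b) (hM : A.Mn a b M) (l : ℤ) :
    ¬ A.Lam {a, b} (tz • dl a + l • dl b) := by
  intro H
  have ha := V.la
  have hb := V.lb
  obtain ⟨raM, rbM⟩ := V.T5' hM
  have ra := V.r2
  have rb := V.symm.r2
  have nab : A.r a ≠ A.r b := fun e => V.ne (A.inj oo e)
  rcases T3 hb rb with ⟨q, -⟩ | ⟨-, h, s, d, sl, sr, sb, -⟩ | ⟨h, c, -⟩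
  · have e1 : (l % (A.r b + 1)) = l - (A.r b + 1) * (l / (A.r b + 1)) := by rw [Int.emod_def]
    obtain ⟨k, hk⟩ := Int.eq_ofNat_of_zero_le (Int.emod_nonneg l (by omega : (A.r b + 1 : ℤ) ≠ 0))
    have hk' := Int.emod_lt_of_pos l (by omega : (0 : ℤ) < A.r b + 1)
    have e2 : A.Lam {a, b} (tz • dl a + (k : ℤ) • dl b) := c2 1 H (-(l / (A.r b + 1))) q (by
      rw [← hk, e1]; module)
    rw [hk] at hk'
    rcases k with _ | k
    · exact V.i1 (c1 1 e2)
    · have := hM.2 _ (mkC (a :> b :> a :> rp k b) e2)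
      simp at this
      unfold QP at q
      rw [show A.r b = k + 1 by omega] at q
      exact V.s1 (c2 1 e2 (-1) q)
  · exact PD V hM d sl sr sb (d.dom.drop (c2 1 H (-l) d.2 : A.Lam {b, a, h} (tz • dl a)))
  · have hq := c.1.q
    have hbh := c.2
    have hh := c.1.1
    have hr := c.1.2.1
    have Dh := c.dom
    obtain ⟨ρ, hρ⟩ : ∃ ρ, A.r b = ρ + 1 := ⟨A.r h, hr.symm⟩
    rw [hρ] at hq
    have q : A.Lam {b} ((2 * (ρ + 1) : ℤ) • dl b) := Dh.drop (c2 1 hq (ρ + 1) hbh : A.Lam {h, b} ((2 * (ρ + 1) : ℤ) • dl b))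
    have e1 : (l % (2 * (ρ + 1))) = l - (2 * (ρ + 1)) * (l / (2 * (ρ + 1))) := by rw [Int.emod_def]
    obtain ⟨k, hk⟩ := Int.eq_ofNat_of_zero_le (Int.emod_nonneg l (by omega : (2 * (ρ + 1) : ℤ) ≠ 0))
    have hk' := Int.emod_lt_of_pos l (by omega : (0 : ℤ) < 2 * (ρ + 1))
    have e2 : A.Lam {a, b} (tz • dl a + (k : ℤ) • dl b) := c2 1 H (-(l / (2 * (ρ + 1)))) q (by
      rw [← hk, e1]; module)
    rw [hk] at hk'
    rcases Nat.even_or_odd' k with ⟨m, rfl | rfl⟩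
    · rcases m with _ | m
      · exact V.i1 (c1 1 e2)
      · have C : A.Circ (a :> b :> a :> b :> rp m h) := by
          rcases m with _ | m
          · exact mkC _ e2
          · exact mkC _ (c2 1 e2 (-m - 1) hbh :
              A.Lam {a, b, h} (tz • dl a + tz • dl b + (m + 1 : ℤ) • dl h))
        have := hM.2 _ C
        simp at this
        obtain rfl : ρ = m + 1 := by omega
        obtain ⟨x, x1, x2⟩ := A.split {a} {b} (tz • dl a) ((-2 : ℤ) • dl b) (c2 1 e2 (-1) q :
          A.Lam {a, b} (tz • dl a - tz • dl b))
        have x1 : A.In2 x a a := c1 1 x1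
        have x3 := T3C hb rb c (c1 1 x2 : A.In2 x b b)
        have x4 : (A.l x = 2 ∧ A.r x ≤ A.r a) ∨ (A.l x = 1 ∧ A.r x + 1 = A.r a) := by
          rcases T3 ha ra with ⟨-, s, s1, s2, -, s3⟩ | ⟨-, d, s, -, s1, s2, -, s3⟩ | ⟨d, d1, s3⟩
          · rw [s3 x x1]; left; omega
          · rw [s3 x x1]; left; omega
          · rcases s3 x x1 with rfl | h
            · exact Or.inr ⟨d1.1.1, d1.1.2.1⟩
            · left; omega
        rcases x3 with rfl | x3 <;> omega
    · have C : A.Circ (a :> b :> a :> rp m h) := by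
        rcases m with _ | m
        · exact mkC _ e2
        · exact mkC _ (c2 1 e2 (-m - 1) hbh :
              A.Lam {a, b, h} (tz • dl a + dl b + (m + 1 : ℤ) • dl h))
      have := hM.2 _ C
      simp at this
      obtain rfl : ρ = m := by omega
      exact V.s1 (c2 1 e2 (-1) q)


structure Ctx (A : Sys R) (a b : R) (M : ℕ) : Prop where
  V : A.Viol a b
  hM : A.Mn a b M
  mn : ∀ c d M', A.Viol c d → A.Mn c d M' → M ≤ M'

theorem Ctx.symm (h : A.Ctx a b M) : A.Ctx b a M :=
  ⟨h.V.symm, h.hM.symm, h.mn⟩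

theorem Ctx.lose (h : A.Ctx a b M) {m : Multiset R} (hm : A.Circ m) (ha : a ∈ m)
    (hb : b ∈ m) : M + 2 ≤ m.card := by
  obtain ⟨m', rfl⟩ := two_of_mem ha hb h.V.ne.symm
  have := h.hM.2 m' hm
  simp; omega

open Classical in
def Cls (A : Sys R) (a b : R) (M i j : ℕ) (m : Multiset R) : Prop :=
  A.Circ m ∧ m.card = M + 2 ∧ i ≤ m.count a ∧ j ≤ m.count b

structure Good (A : Sys R) (a b : R) (M : ℕ) (W : Multiset R) : Prop where
  C : A.Circ W
  card : W.card = M + 2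
  am : a ∈ W
  bm : b ∈ W
  f1 : ∀ c ∈ W, c ≠ a → c ≠ b → ¬ A.Lam {c, a, b} (dl c - dl a)
  f1' : ∀ c ∈ W, c ≠ a → c ≠ b → ¬ A.Lam {c, a, b} (dl c - dl b)
  f3 : ∀ c ∈ W, ∀ c' ∈ W, c ≠ a → c ≠ b → c' ≠ a → c' ≠ b → c ≠ c' → ¬ A.Lam {c, c', a, b} (dl c - dl c')
  kk : ∀ o k U, W = o :> o :> U → A.r o = 1 → A.l k = 1 → A.r k = 2 → ¬ A.Circ (k :> k :> U)

theorem Good.symm (h : A.Good a b M W) : A.Good b a M W :=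
  ⟨h.C, h.card, h.bm, h.am, fun c hc h1 h2 h3 => h.f1' c hc h2 h1 (c1 1 h3),
    fun c hc h1 h2 h3 => h.f1 c hc h2 h1 (c1 1 h3),
    fun c hc c' hc' h1 h2 h3 h4 h5 h6 => h.f3 c hc c' hc' h2 h1 h4 h3 h5 (c1 1 h6), h.kk⟩

theorem repl (h : A.Circ (x :> U)) (hy : A.l y = 1) {S : Set R}
    (e : A.Lam (insert x S) (dl x - dl y)) (s : S ⊆ lts (y :> U)) (yS : y ∈ S) : A.Circ (y :> U) := by
  refine ⟨arcs_cons hy h.arcs, ?_⟩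
  exact A.dom e (Ov_dl yS) s (Ov_vec fun _ h => h) (c2 1 h.2 (-1) e (by simp only [vec_cons]; module)
    (s' := ⟨Set.insert_subset_insert s⟩))

theorem repl_all (h : A.Circ (rp n x + U)) {S : Set R}
    (e : A.Lam (insert x S) (dl x - dl y)) (s : S ⊆ lts U) (yU : y ∈ U) : A.Circ (rp n y + U) := by
  have hy : A.l y = 1 := h.1 y (by simp [yU])
  have := absorb1 (A := A) (S := lts U) (v := dl y) (Ov_dl yU) (rp n x) (vec U) (Ov_vec fun _ h => h)
    (fun z hz => by
      rw [Multiset.eq_of_mem_replicate hz]; exact A.mono e (Set.insert_subset_insert s))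
    (c1 1 h.2 (by rw [vec_add]; module))
  refine ⟨arcs_add (arcs_rep hy) h.arcs, c1 1 this (by simp [vec_add]; module)⟩

open Classical in
theorem good_ex (h : A.Ctx a b M) (hi : 1 ≤ i) (hj : 1 ≤ j)
    (ex : ∃ m, A.Cls a b M i j m) : ∃ W, A.Cls a b M i j W ∧ A.Good a b M W := by
  have ra := h.V.r2
  have rb := h.V.symm.r2
  let nf : Multiset R → ℕ := fun m => m.countP (fun x => x ≠ a ∧ x ≠ b)
  let no : Multiset R → ℕ := fun m => m.countP (fun x => A.r x = 1)
  let nd : Multiset R → ℕ := fun m => m.toFinset.card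
  let μ : Multiset R → ℕ × ℕ × ℕ := fun m => (nf m, no m, nd m)
  have wf : WellFounded (Prod.Lex (· < ·) (Prod.Lex (· < ·) (· < ·)) : ℕ × ℕ × ℕ → ℕ × ℕ × ℕ → Prop) :=
    WellFounded.prod_lex wellFounded_lt (WellFounded.prod_lex wellFounded_lt wellFounded_lt)
  obtain ⟨W, hW, hmin⟩ := (InvImage.wf μ wf).has_min {m | A.Cls a b M i j m} ex
  have l1 : ∀ m, A.Cls a b M i j m → ¬ nf m < nf W := fun m hm h => hmin m hm (Prod.Lex.left _ _ h)
  have l2 : ∀ m, A.Cls a b M i j m → nf m ≤ nf W → ¬ no m < no W := fun m hm h h' => by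
    rcases h.lt_or_eq with h | h
    · exact l1 m hm h
    · refine hmin m hm ?_
      show Prod.Lex _ _ (nf m, _) (nf W, _)
      rw [h]; exact Prod.Lex.right _ (Prod.Lex.left _ _ h')
  have l3 : ∀ m, A.Cls a b M i j m → nf m ≤ nf W → no m ≤ no W → ¬ nd m < nd W := fun m hm h h2 h' => by
    rcases h.lt_or_eq with h | h
    · exact l1 m hm h
    rcases h2.lt_or_eq with h2 | h2
    · exact l2 m hm h.le h2
    · refine hmin m hm ?_
      show Prod.Lex _ _ (nf m, no m, _) (nf W, no W, _)
      rw [h, h2]; exact Prod.Lex.right _ (Prod.Lex.right _ h')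
  obtain ⟨C, card, ci, cj⟩ := hW
  have am : a ∈ W := Multiset.count_pos.1 oo
  have bm : b ∈ W := Multiset.count_pos.1 oo
  have F1 : ∀ e, (e = a ∨ e = b) → ∀ c ∈ W, c ≠ a → c ≠ b → ¬ A.Lam {c, a, b} (dl c - dl e) := by
    intro e he c hc h1 h2 h3
    obtain ⟨U, rfl⟩ := Multiset.exists_cons_of_mem hc
    have aU : a ∈ U := (Multiset.mem_cons.1 am).resolve_left h1.symm
    have bU : b ∈ U := (Multiset.mem_cons.1 bm).resolve_left h2.symm
    have el : A.l e = 1 := by rcases he with rfl | rfl; exacts [h.V.la, h.V.lb]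
    have := repl C el h3 (by rintro x (rfl | rfl) <;> simp [aU, bU]) (by rcases he with rfl | rfl <;> simp)
    refine l1 _ ⟨this, by simpa using card, ?_, ?_⟩ ?_
    · rw [Multiset.count_cons_of_ne h1.symm] at ci
      exact ci.trans (Multiset.count_le_count_cons _ _ _)
    · rw [Multiset.count_cons_of_ne h2.symm] at cj
      exact cj.trans (Multiset.count_le_count_cons _ _ _)
    · simp only [nf]
      rw [Multiset.countP_cons_of_neg _ (by rcases he with rfl | rfl <;> simp),
        Multiset.countP_cons_of_pos _ ⟨h1, h2⟩]
      omega
  have F3 : ∀ c ∈ W, ∀ c' ∈ W, c ≠ a → c ≠ b → c' ≠ a → c' ≠ b → c ≠ c' → A.r c' ≠ 1 →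
      ¬ A.Lam {c, c', a, b} (dl c - dl c') := by
    intro c hc c' hc' h1 h2 h1' h2' h3 h5 h4
    set U := W.filter (fun x => x ≠ c) with hU
    have eW : W = rp (W.count c) c + U := by
      rw [hU, rp, ← Multiset.filter_eq', Multiset.filter_add_not]
    have m1 : ∀ x ∈ W, x ≠ c → x ∈ U := fun x hx hxc => Multiset.mem_filter.2 ⟨hx, hxc⟩
    have cU : c ∉ U := fun h => (Multiset.mem_filter.1 h).2 rfl
    have C' := repl_all (x := c) (y := c') (n := W.count c) (U := U) (eW ▸ C) h4 (by
      rintro x (rfl | rfl | rfl)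
      exacts [m1 _ hc' h3.symm, m1 _ am h1.symm, m1 _ bm h2.symm]) (m1 _ hc' h3.symm)
    have h6 : W.card = W.count c + U.card := by
      conv_lhs => rw [eW]
      simp
    have hn : 0 < W.count c := Multiset.count_pos.2 hc
    have k1 : W.count a = U.count a := by
      conv_lhs => rw [eW]
      simp [Multiset.count_replicate, h1]
    have k2 : W.count b = U.count b := by
      conv_lhs => rw [eW]
      simp [Multiset.count_replicate, h2]
    refine l3 (rp (W.count c) c' + U) ⟨C', by simp; omega, by simp; omega, by simp; omega⟩ ?_ ?_ ?_
    · simp only [nf]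
      conv_rhs => rw [eW]
      rw [Multiset.countP_add, Multiset.countP_add]
      refine Nat.add_le_add_right ?_ _
      refine (Multiset.countP_le_card _ _).trans (le_of_eq ?_)
      rw [(Multiset.countP_eq_card (s := rp (W.count c) c)).2 (fun x hx => by
        rw [Multiset.eq_of_mem_replicate hx]; exact ⟨h1, h2⟩)]
      simp
    · simp only [no]
      conv_rhs => rw [eW]
      rw [Multiset.countP_add, Multiset.countP_add,
        Multiset.countP_eq_zero.2 (fun x hx => by rw [Multiset.eq_of_mem_replicate hx]; exact h5)]
      omega
    · simp only [nd]
      refine Finset.card_lt_card ⟨fun x hx => ?_, fun hh => ?_⟩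
      · simp only [Multiset.mem_toFinset, Multiset.mem_add] at hx ⊢
        rcases hx with hx | hx
        · rw [Multiset.eq_of_mem_replicate hx]; exact hc'
        · exact (Multiset.mem_filter.1 hx).1
      · have := hh (Multiset.mem_toFinset.2 hc)
        simp only [Multiset.mem_toFinset, Multiset.mem_add] at this
        rcases this with hx | hx
        · exact h3 (Multiset.eq_of_mem_replicate hx)
        · exact cU hx
  refine ⟨W, ⟨C, card, ci, cj⟩, C, card, am, bm, F1 a (Or.inl rfl), F1 b (Or.inr rfl), ?_, ?_⟩
  · intro c hc c' hc' h1 h2 h1' h2' h3 h4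
    by_cases h5 : A.r c' = 1
    · refine F3 c' hc' c hc h1' h2' h1 h2 h3.symm (fun h6 => h3 (A.inj ?_ oo)) (c1 (-1) h4)
      rw [C.1 c hc, C.1 c' hc']
    · exact F3 c hc c' hc' h1 h2 h1' h2' h3 h5 h4
  · rintro o k U rfl ho hk hk2 hC
    have oa : a ≠ o := by rintro rfl; omega
    have ob : b ≠ o := by rintro rfl; omega
    simp only [Multiset.count_cons_of_ne oa, Multiset.count_cons_of_ne ob] at ci cj
    have k1 := Multiset.count_le_count_cons a k (k :> U)
    have k2 := Multiset.count_le_count_cons a k U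
    have k3 := Multiset.count_le_count_cons b k (k :> U)
    have k4 := Multiset.count_le_count_cons b k U
    refine l2 (k :> k :> U) ⟨hC, by simpa using card, by omega, by omega⟩ ?_ ?_
    · simp only [nf, Multiset.countP_cons]
      rw [if_pos (show o ≠ a ∧ o ≠ b from ⟨oa.symm, ob.symm⟩)]
      split_ifs <;> omega
    · simp only [no, Multiset.countP_cons]
      simp [ho, hk2]


theorem SS.cc (h : A.SS a d) (ha : A.l a = 1) (hd : A.l d = 1) (h2 : 2 ≤ A.r a) : A.CC a d := by
  have hi : A.In2 d a a := c1 (-1) h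
  rcases T3 ha h2 with ⟨_, s, sl, -, -, hs⟩ | ⟨_, _, s, -, sl, -, -, hs⟩ | ⟨e, he, hs⟩
  · have := hs d hi; subst this; omega
  · have := hs d hi; subst this; omega
  · rcases hs d hi with rfl | ⟨h, -⟩
    · exact he
    · omega

theorem CC.cir (h : A.CC a d) (ha : A.l a = 1) : A.Circ (a :> a :> rp (A.r d) d) := by
  have h1 : (A.r a : ℤ) = A.r d + 1 := by exact_mod_cast h.1.2.1.symm
  have h2 := h.1.q
  have h3 := h.1.1
  have h4 := r_pos h3
  obtain ⟨n, hn⟩ := Nat.exists_eq_succ_of_ne_zero (by omega : A.r d ≠ 0)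
  rw [hn] at h1 ⊢
  exact mkC _ (c2 (T := {a, d}) (u := tz • dl a + ((n : ℤ) + 1) • dl d) 1 h2 1 h.2 (by
    rw [h1]; push_cast; module))

theorem CC.npure (h : A.CC a d) (ha : A.l a = 1) : ¬ A.PureL a := fun p => by
  have h2 := h.1.2.1
  have := p _ (h.cir ha) bs (by simp; omega) d (by
    have := r_pos h.1.1
    exact Multiset.mem_cons_of_mem (Multiset.mem_cons_of_mem (Multiset.mem_replicate.2 ⟨by omega, rfl⟩)))
  subst this; omega

theorem CC.uniq (h : A.CC a d) (h' : A.CC a d') : d = d' :=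
  A.inj (by rw [h.1.1, h'.1.1]) (by have := h.1.2.1; have := h'.1.2.1; omega)

theorem Ctx.K3 (h : A.Ctx a b M) (lc : A.l c = 1) (ca : c ≠ a) (cb : c ≠ b)
    (f1 : ¬ A.Lam {c, a, b} (dl c - dl a)) (f1' : ¬ A.Lam {c, a, b} (dl c - dl b))
    (ii : A.II a c) (cc : A.CC c b) : False := by
  have la := h.V.la
  have lb := h.V.lb
  have ra := h.V.r2
  have rb := h.V.symm.r2
  have e1 : A.r b + 1 = A.r c := cc.1.2.1
  have e2 := cc.2
  by_cases aH : A.Lam {a, c} (dl a)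
  · have dA : A.Dom a {c} := domk 0 (c1 1 aH)
    have key : ∀ x n, A.Lam {x, a, b} (dl x - (n : ℤ) • dl a - dl b) → x = b ∨ A.l x = 2 ∧ A.r x = A.r c := by
      intro x n hx
      have h1 : A.Lam {a, b, x, c} (dl x - dl c - dl c) := c3 1 hx n aH (-1) e2
      have h2 : A.Lam {b, x, c} (dl x - dl c - dl c) := dA.drop h1
      exact T3C lc oo cc (cc.dom.drop h2)
    obtain ⟨x, hx⟩ := pick2 (A := A) a b
    obtain ⟨y, hy⟩ := pick (A := A) {a, b} (tz • dl a + dl b)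
    rcases key x 1 (c1 1 hx) with rfl | ⟨x1, x2⟩
    · exact h.V.na (c1 (-1) hx)
    rcases key y 2 (c1 1 hy) with rfl | ⟨y1, y2⟩
    · exact h.V.i1 (c1 (-1) hy)
    have := A.inj (x1.trans y1.symm) (x2.trans y2.symm)
    subst this
    exact h.V.na (hx.dom.drop (T := {a, b}) (u := dl a) (c2 (T := {x, a, b}) 1 hx (-1) hy))
  obtain ⟨y, y1, y2⟩ := split {a} {c} (tz • dl a) 0 ii
  obtain ⟨t, ht⟩ := pick2 (A := A) y b
  have dy : A.Dom y {a} := domk (tz • dl a) y1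
  have dy2 : A.Dom y {c} := domk 0 (c1 1 y2)
  have ht2 : A.In2 t c c := by
    have h1 : A.Lam {y, b, t, c} (dl t - dl c - dl c) := c3 1 ht 1 y2 (-1) e2
    have h2 : A.Lam {b, t, c} (dl t - dl c - dl c) := dy2.drop h1
    exact cc.dom.drop h2
  have hab : A.Lam {t, a, b} (dl t - tz • dl a - dl b) := by
    have h1 : A.Lam {y, t, a, b} (dl t - tz • dl a - dl b) := c2 1 ht 1 y1
    exact dy.drop h1
  have tt : A.l t = 2 ∧ A.r t = A.r c := by
    rcases T3C lc oo cc ht2 with rfl | h'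
    · exact absurd (c1 (-1) hab) h.V.i1
    · exact h'
  have C := cc.cir lc
  obtain ⟨n, hn⟩ := Nat.exists_eq_succ_of_ne_zero (by omega : A.r b ≠ 0)
  rw [hn] at C
  obtain ⟨z, z1, zl, zr⟩ := h.V.zz h.hM
  have Mle : M ≤ A.r c + 1 := by
    have := h.lose (mkC (a :> a :> c :> c :> rp (n + 1) b) (c2 (T := lts (a :> a :> c :> c :> rp (n + 1) b))
      (u := tz • dl a + vec (c :> c :> rp (n + 1) b)) 1 ii 1 C.2)) bs bs
    simp at this; omega
  have Mge := (h.V.T5' h.hM).2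
  have hac : ∀ x, A.In2 x a c → A.l x = 2 ∧ A.r x = A.r c + 1 := by
    intro x hx
    obtain ⟨b1, b2, b3, b4⟩ := hx.bd la lc
    have up : A.r x ≤ A.r c + 1 := by
      have := rle (x := x) (a :> c :> rp (n + 1) b) (c3 (T := insert x (lts (a :> c :> rp (n + 1) b)))
        (u := dl x + vec (a :> c :> rp (n + 1) b)) 1 hx 1 ii 1 C.2 (by
          simp only [vec_cons, vec_rep]; module))
      simp at this; omega
    have lo : A.r x ≠ A.r b := fun e => by
      obtain ⟨m, m1, m2⟩ := hx.circ la lc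
      rcases cc.1.2.2.2 _ m2 bs (by simp; omega) a bs with h' | h'
      · exact ca h'.symm
      · exact h.V.ne h'
    have l12 := hx.lor la lc oo
    rcases l12 with l1 | l2
    · rcases (by omega : A.r x = A.r c ∨ A.r x = A.r c + 1) with e | e
      · have := A.inj (l1.trans lc.symm) e
        subst this
        exact absurd (c1 (-1) hx) aH
      · exfalso
        have Z : A.Circ (x :> a :> c :> rp (n + 1) b) :=
          mkC _ (c3 (T := (lts (x :> a :> c :> rp (n + 1) b)))
            (u := dl x + vec (a :> c :> rp (n + 1) b)) 1 hx 1 ii 1 C.2 (by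
            simp only [vec_cons, vec_rep]; module))
        have : ∃ d, ∀ y ∈ x :> a :> c :> rp (n + 1) b, y = x ∨ y = d := by
          rcases MM3 l1 with h' | ⟨d, h'⟩ | ⟨d, h'⟩
          · exact ⟨x, fun y hy => Or.inl (h' _ Z bs (by simp; omega) y hy)⟩
          · exact ⟨d, fun y hy => (h'.1.2.2.2 _ Z bs (by simp; omega) y hy)⟩
          · exact ⟨d, fun y hy => (h'.1.2.2.2 _ Z bs (by simp; omega) y hy)⟩
        obtain ⟨d, hd⟩ := this
        have q1 : c = d := (hd c bs).resolve_left (by rintro rfl; omega)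
        have q2 : b = d := (hd b bs).resolve_left (by rintro rfl; omega)
        exact cb (q1.trans q2.symm)
    · refine ⟨l2, ?_⟩
      rcases (by omega : A.r x = A.r c ∨ A.r x = A.r c + 1) with e | e
      · exfalso
        have := A.inj (l2.trans tt.1.symm) (e.trans tt.2.symm)
        subst this
        exact ca (A.sep (c1 (-1) (In2.canc hx ht2)))
      · exact e
  rcases (by omega : M = A.r b ∨ M = A.r c ∨ M = A.r c + 1) with e | e | e
  · obtain ⟨y, hy, hyn, yl, yr⟩ := (C.re (c :> b :> c :> rp n b)).split2
    have yl' : A.l y = 2 := by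
      have := hy.bd lc lb
      rcases hy.lor lc lb oo with h' | h'
      · exfalso
        have : y = b := A.inj oo (by simp at yr; omega)
        subst this
        exact cc_dd lb e2 (c1 (-1) hy)
      · exact h'
    have : z = y := A.inj oo (by have := hy.bd lc lb; simp at yr; omega)
    subst this
    exact f1 (c1 1 (In2.canc hy z1.symm))
  · have := A.inj (zl.trans tt.1.symm) oo
    subst this
    exact h.V.na (z1.dom.drop (T := {a, b}) (u := dl a) (c2 (T := {z, a, b}) 1 z1 (-1) hab))
  · obtain ⟨x, hx⟩ := pick2 (A := A) a c
    obtain ⟨x1, x2⟩ := hac x hx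
    have := A.inj (zl.trans x1.symm) oo
    subst this
    exact f1' (c1 1 (In2.canc hx.symm z1))

theorem Good.f2 (h : A.Ctx a b M) (g : A.Good a b M W) (hc : c ∈ W)
    (ca : c ≠ a) (cb : c ≠ b) : ¬ A.Lam {c, a, b} (dl c) := fun h1 => by
  obtain ⟨U, rfl⟩ := Multiset.exists_cons_of_mem hc
  have aU : a ∈ U := (Multiset.mem_cons.1 g.am).resolve_left ca.symm
  have bU : b ∈ U := (Multiset.mem_cons.1 g.bm).resolve_left cb.symm
  have : A.Circ U := ⟨g.C.arcs, A.dom (v := 0) (S := {a, b}) (c1 1 h1) (Ov_zero _)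
    (by rintro x (rfl | rfl) <;> assumption) (Ov_vec fun _ h => h)
    (c2 1 g.C.2 (-1) h1 (by simp only [vec_cons]; module) (s := ⟨fun x hx => by simpa using hx⟩)
      (s' := ⟨by rintro x (rfl | rfl | rfl); exacts [Or.inl rfl, Or.inr aU, Or.inr bU]⟩))⟩
  have := h.lose this aU bU
  have := g.card
  simp at this; omega

theorem Good.nV (h : A.Ctx a b M) (g : A.Good a b M W) (hc : c ∈ W)
    (ca : c ≠ a) (cb : c ≠ b) : ¬ A.Viol a c := fun V => by
  obtain ⟨M', hM'⟩ := mn_ex (A := A) V.la V.lb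
  have h1 := h.mn _ _ _ V hM'
  obtain ⟨U, rfl⟩ := two_of_mem g.am hc ca
  have h2 := hM'.2 U g.C
  have h3 := g.card
  simp at h3
  obtain ⟨z, z1, zl, zr⟩ := h.V.zz h.hM
  obtain ⟨y, y1, yl, yr⟩ := V.zz hM'
  have := A.inj (zl.trans yl.symm) oo
  subst this
  exact g.f1' c hc ca cb (c1 (-1) (In2.canc z1.symm y1))

theorem Good.K (h : A.Ctx a b M) (g : A.Good a b M W) (hc : c ∈ W)
    (ca : c ≠ a) (cb : c ≠ b) : A.II c a ∨ A.II c b ∨ (A.II a c ∧ A.II b c) := by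
  have la := h.V.la
  have lb := h.V.lb
  have ra := h.V.r2
  have rb := h.V.symm.r2
  have lc := g.C.1 c hc
  by_contra! hn
  obtain ⟨n1, n2, n3⟩ := hn
  have rc : 2 ≤ A.r c := by
    by_contra h'
    have := r_pos lc
    exact n1 (c1 1 (two_q lc oo))
  have A1 : A.II a c ∨ A.CC a c ∨ A.CC c a := by
    by_contra! h'
    exact g.nV h hc ca cb ⟨la, lc, ca.symm, h'.1, n1, fun s => h'.2.1 (s.cc la lc ra),
      fun s => h'.2.2 (s.cc lc la rc)⟩
  have A2 : A.II b c ∨ A.CC b c ∨ A.CC c b := by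
    by_contra! h'
    exact g.symm.nV h.symm hc cb ca ⟨lb, lc, cb.symm, h'.1, n2, fun s => h'.2.1 (s.cc lb lc rb),
      fun s => h'.2.2 (s.cc lc lb rc)⟩
  have f1 := g.f1 c hc ca cb
  have f1' := g.f1' c hc ca cb
  rcases A1 with i | s | s <;> rcases A2 with i' | s' | s'
  · exact n3 i i'
  · exact h.V.i1 (s'.dom.drop (T := {a, b}) i)
  · exact h.K3 lc ca cb f1 f1' i s'
  · exact h.V.i2 (s.dom.drop (T := {b, a}) i')
  · exact h.V.P h.hM (-2) (s.dom.drop (T := {a, b}) (c2 (T := {c, a, b}) 1 s.2 (-1) s'.2))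
  · exact s'.npure lc s.1.2.2.1
  · exact h.symm.K3 lc cb ca (fun h => f1' (c1 1 h)) (fun h => f1 (c1 1 h)) i' s
  · exact s.npure lc s'.1.2.2.1
  · exact h.V.ne (s.uniq s')


theorem mmlet (lg : A.l g = 1) {m : Multiset R} (Z : A.Circ m) (gm : g ∈ m)
    (hc : m.card = A.r g + 1) (xm : x ∈ m) : x = g ∨ A.r x + 1 = A.r g := by
  rcases MM3 lg with h | ⟨d, h⟩ | ⟨d, h⟩
  · exact Or.inl (h m Z gm hc x xm)
  · rcases h.1.2.2.2 m Z gm hc x xm with h' | rfl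
    exacts [Or.inl h', Or.inr h.1.2.1]
  · rcases h.1.2.2.2 m Z gm hc x xm with h' | rfl
    exacts [Or.inl h', Or.inr h.1.2.1]

theorem inv2 (h : A.l y = 2) (h' : A.r y = 2) : A.Lam {y} (tz • dl y) := by
  obtain ⟨x, h1, h2, h3⟩ := inv (A := A) y
  have : x = y := A.ij
  subst this
  exact c1 1 h1

structure KK (A : Sys R) (k o : R) : Prop where
  lk : A.l k = 1
  rk : A.r k = 2
  lo : A.l o = 1
  ro : A.r o = 1
  ko : A.Lam {k, o} (dl k)
  nq : ¬ A.QP k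
  k4 : A.Lam {k} ((4 : ℤ) • dl k)
  d0 : A.Dom k ∅

theorem kk_of (lk : A.l k = 1) (rk : A.r k = 2) (lo : A.l o = 1) (ro : A.r o = 1)
    (ko : A.Lam {k, o} (dl k)) (nq : ¬ A.QP k) : A.KK k o := by
  have dk : A.Dom k {o} := domk 0 (c1 1 ko)
  have o2 := two_q lo ro
  rcases T3 lk oo with ⟨h, -⟩ | ⟨_, d, s, hd, sl, sr, s1, hs⟩ | ⟨d, hd, -⟩
  · exact absurd h nq
  · have ds : A.Dom s {k, k} := s1.dom
    have s2 := inv2 sl oo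
    refine ⟨lk, rk, lo, ro, ko, nq, ?_, domH fun y hy => ?_⟩
    · exact ds.drop (T := {k}) (c2 (T := {s, k}) 1 s2 (-2) s1)
    · have yo : A.Lam {y, o} (dl y) := dk.drop (A.mono hy (show _ ⊆ ({k, y, o} : Set R) by
        rintro x (rfl | rfl) <;> simp))
      have r2 : A.r y ≤ 2 := rle (x := y) (o :> o :> 0) (c2 (T := {y, o})
        (u := dl y + tz • dl o) 1 yo 1 o2)
      have l2 : A.l y ≤ 2 := lle (x := y) (o :> o :> 0) (c2 (T := {y, o})
        (u := dl y - tz • dl o) 1 yo (-1) o2)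
      by_cases r0 : A.r y = 0
      · exact A.mono (r_zero r0).1 bs
      by_cases l0 : A.l y = 0
      · exact A.mono (l_zero l0).1 bs
      exfalso
      have dy : A.Dom y {k} := domk 0 (c1 1 hy)
      rcases (by omega : A.l y = 1 ∨ A.l y = 2) with l | l <;> rcases (by omega : A.r y = 1 ∨ A.r y = 2) with r | r
      · have : y = o := A.ij
        subst this
        have C : A.Circ (k :> k :> y :> 0) := mkC _ (c2 (T := {k, y}) (u := dl y + tz • dl k)
          (2) ko 1 hy)
        obtain ⟨x, x1, x2, x3, x4⟩ := C.split2
        have h1 := hs x x1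
        subst h1
        simp at x4; omega
      · have : y = k := A.ij
        subst this
        exact not1 lk (c1 1 hy)
      · obtain ⟨w, w1, w2, w3⟩ := inv (A := A) k
        have : w = y := A.ij
        subst this
        exact not1 lk (dy.drop (T := {k}) (c2 (T := {w, k}) 1 w1 (-1) hy))
      · have : y = s := A.ij
        subst this
        have := rep_le (n := 2) lk (dy.drop (T := {k}) (c2 (T := {y, k}) (-1) s1 (1) hy)) oo
        omega
  · exfalso
    have : d = o := A.inj (by rw [hd.1.1, lo]) (by have := hd.1.2.1; omega)
    subst this
    exact cc_dd lo hd.2 ko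

theorem kfinal (h : A.Ctx a k M) (K : A.KK k o) {P : Multiset R} (hP : A.Circ P)
    (aP : a ∈ P) (cP : P.card + 1 = M) : False := by
  have la := h.V.la
  have lk := K.lk
  have rk := K.rk
  have lo := K.lo
  have ro := K.ro
  have ko := K.ko
  have d0 := K.d0
  have o2 := two_q lo ro
  have k4 := K.k4
  have ra : 3 ≤ A.r a := by
    have := h.V.r2
    by_contra h'
    exact h.V.ne (A.ij)
  obtain ⟨u, u1, u2⟩ := arc_circ (A := A) la
  have lu : ∀ y ∈ u, A.l y = 1 := u2.arcs
  have MQ : M = A.r a + 2 := by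
    have h1 := h.lose (mkC (k :> o :> o :> a :> u) (c3 (T := lts (k :> o :> o :> a :> u))
      (u := dl k + tz • dl o + vec (a :> u)) 1 ko 1 o2 1 u2.2)) bs bs
    obtain ⟨P', rfl⟩ := Multiset.exists_cons_of_mem aP
    have h2 := hP.le a
    simp at h1 h2 cP
    omega
  have lose : ∀ m, A.Circ m → a ∈ m → k ∈ m → A.r a + 4 ≤ m.card := fun m h1 h2 h3 => by
    have := h.lose h1 h2 h3; omega
  have oa : ¬ A.Lam {a, o} (dl o) := fun h1 =>
    h.V.nb ((domk 0 (c1 1 h1) : A.Dom o {a}).drop (T := {a, k}) ko)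
  have mm : ∀ g m, A.l g = 1 → A.r g = A.r a + 1 → A.Circ (g :> m) → m.card = A.r a + 1 →
      ∀ y ∈ m, A.r y ≤ 2 → False := fun g m h1 h2 h3 h4 y h5 h6 => by
    rcases mmlet h1 h3 bs (by simp; omega) (Multiset.mem_cons_of_mem h5) with rfl | h' <;> omega
  obtain ⟨x, hx⟩ := pick2 (A := A) a o
  have xx : A.l x = 2 ∧ A.r x = A.r a + 1 := by
    obtain ⟨m, m1, m2⟩ := hx.circ la lo
    have lm : ∀ y ∈ m, A.l y = 1 := m2.arcs
    have e1 := lose _ (mkC (k :> a :> o :> m) (c2 (T := lts (k :> a :> o :> m))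
      (u := dl k + vec (a :> o :> m)) 1 ko 1 m2.2)) bs bs
    have Z : A.Lam (insert x (lts (o :> a :> u))) (dl x + vec (o :> u)) := c3 1 hx 1 u2.2 1 o2 (by
      simp only [vec_cons]; module)
    have hle : ∀ y ∈ lts (o :> u), True := fun _ _ => trivial
    have Z' : A.Neg x (o :> u) := by
      have da : A.Dom a (lts u) := domk (-vec u) (c1 1 u2.2 (by simp only [vec_cons]; module))
      exact da.drop (A.mono Z (show _ ⊆ insert a (insert x (lts (o :> u))) from by
        intro y hy
        simp only [Set.mem_insert_iff, mem_lts, Multiset.mem_cons] at hy ⊢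
        rcases hy with h | h | h | h <;> simp [h])) 
    have e2 : A.r x ≤ A.r a + 1 := by
      have := A.r_le (arcs_cons lo lu) Z'
      simp at this; omega
    simp at e1
    refine ⟨?_, by omega⟩
    rcases hx.lor la lo oo with e | e
    · exact (mm x (o :> u) e oo ⟨arcs_cons e (arcs_cons lo lu), Z'.lam⟩ (by simp; omega) o bs
        oo).elim
    · exact e
  have hx1 : A.Lam {x, a, o} (dl x - dl a - dl o) := hx
  have xeq : ∀ y (i j : ℤ), A.l y = 2 → A.r y = A.r a + 1 → A.Lam {y, a, k} (dl y - i • dl a - j • dl k) →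
      A.Lam {a, o} ((i - 1) • dl a - dl o) := by
    intro y i j h1 h2 h3
    have := A.inj (h1.trans xx.1.symm) oo
    subst this
    have h4 : A.Lam {y, a, o, k} ((i - 1) • dl a - dl o) := c3 1 hx1 (-1) h3 (-j) ko
    have h5 : A.Lam {k, a, o} ((i - 1) • dl a - dl o) := hx.dom.drop h4
    exact d0.drop h5
  have nSS : ∀ d, A.l d = 1 → 2 ≤ A.r d → ¬ A.CC k d := fun d h1 h2 h3 => by
    have := h3.1.2.1; omega
  obtain ⟨v, v1, vl, vr⟩ : ∃ v, A.Lam {v, a, k} (dl v - tz • dl a - dl k) ∧ A.l v = 3 ∧ A.r v = A.r a + 1 := by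
    have key : ∀ f n, A.l f = 1 → n + 1 = A.r a → A.Lam {a, f} (tz • dl a + (n : ℤ) • dl f) →
        ∃ v, A.Lam {v, a, k} (dl v - tz • dl a - dl k) ∧ A.l v = 3 ∧ A.r v = A.r a + 1 := by
      intro f n lf hn hf
      rcases n with _ | n
      · omega
      have C : A.Circ ((a :> a :> k :> 0) + (o :> o :> rp (n + 1) f)) := mkC _
        (c3 (T := {a, f, k, o}) (u := tz • dl a + ((n : ℤ) + 1) • dl f + dl k + tz • dl o) 1 ko 1 hf 1 o2)
      obtain ⟨v, vI, Z1, lv, -⟩ := C.split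
      simp at lv
      obtain ⟨m, m1, m2, -⟩ := vI.circ (by simp [la, lk])
      have rv := lose _ m2 bs bs
      simp at rv
      have v1 : A.Lam {v, a, k} (dl v - tz • dl a - dl k) := vI.lam
      have : A.r v ≤ A.r a + 1 := by
        have := A.r_le (arcs_cons lo (arcs_cons lo (arcs_rep lf))) Z1
        simp at this; omega
      refine ⟨v, v1, ?_, by omega⟩
      have l0 : A.l v ≠ 0 := fun h0 => by have := (l_zero h0).2; omega
      rcases (by omega : A.l v = 1 ∨ A.l v = 2 ∨ A.l v = 3) with e | e | e
      · exact (mm v (o :> o :> rp (n + 1) f) e oo ⟨arcs_cons e (arcs_cons lo (arcs_cons lo (arcs_rep lf))), Z1.lam⟩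
          (by simp; omega) o bs oo).elim
      · have e1 := A.sep (c1 (T := {a, o}) (u := dl a - dl o) 1 (xeq v 2 1 e oo (c1 1 v1)))
        subst e1; omega
      · exact e
    rcases T3 la h.V.r2 with ⟨q, -⟩ | ⟨_, d, s, hd, -⟩ | ⟨d, hd, -⟩
    · have e : (A.r a : ℤ) = ((A.r a - 1 : ℕ) : ℤ) + 1 := by push_cast [show 1 ≤ A.r a by omega]; ring
      refine key a (A.r a - 1) la oo (c1 1 q (by rw [e]; module))
    · exfalso
      have e1 := hd.1.2.1
      have ld := hd.1.1
      have pd := hd.1.2.2.1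
      have dk : ¬ A.PureL k := fun p => K.nq (p.q lk)
      have nv : ¬ A.Viol d k := fun V => by
        obtain ⟨M', hM'⟩ := mn_ex (A := A) ld lk
        have e2 := h.mn _ _ _ V hM'
        have e3 := hM'.2 (o :> o :> rp (A.r d) d) (mkC _ (c3 (T := {d, k, o})
          (u := dl k + tz • dl o + ((A.r d : ℤ) + 1) • dl d) 1 ko 1 o2 1 (pd.q ld)))
        simp at e3; omega
      have i2 : A.II k d := by
        by_contra i2
        refine nv ⟨ld, lk, fun e => dk (e ▸ pd), fun i1 => ?_, i2, fun s => dk (s.cc ld lk oo).1.2.2.1,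
          fun s => nSS d ld oo (s.cc lk ld oo)⟩
        have := rep_le (n := 2) ld (d0.drop (T := {d}) i1) oo
        omega
      obtain ⟨w, hw⟩ := pick (A := A) {a, k} (dl a + tz • dl k)
      have wI : A.In w (a :> k :> k :> 0) := mkIn _ hw
      obtain ⟨m, m1, m2, -⟩ := wI.circ (by simp [la, lk])
      have rw' := lose _ m2 bs bs
      simp at rw'
      have h1 : A.Lam {a, k, w, d} (dl w) := c3 1 hw 1 hd.2 1 i2
      have h2 : A.Lam {k, w, d} (dl w) := hd.dom.drop h1
      have h3 : A.Lam {w, d} (dl w) := d0.drop h2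
      have := rle (x := w) (rp (A.r d + 1) d) (c2 (T := {w, d}) (u := dl w + ((A.r d : ℤ) + 1) • dl d)
        1 h3 1 (pd.q ld))
      simp at this; omega
    · have e1 := hd.1.2.1
      exact key d (A.r d) hd.1.1 e1 ((hd.cir la).lam)
  have fin : ∀ y (j : ℤ), j = -1 ∨ j = 2 → A.Lam {y, a, k} (dl y - dl a - j • dl k) →
      A.r y = A.r a + 1 → A.l y ≠ 1 → False := by
    intro y j hj y1 y2 y3
    have l3 : A.l y ≤ 3 := by
      have y4 : A.Lam {k, y, a, o} (dl y - dl a - tz • dl o) := c3 1 y1 j ko (-1) o2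
      have y5 : A.Lam {y, a, o} (dl y - dl a - tz • dl o) := d0.drop y4
      simpa using lle (x := y) (a :> o :> o :> 0) y5
    have l0 : A.l y ≠ 0 := fun h0 => by have := (l_zero h0).2; omega
    rcases (by omega : A.l y = 2 ∨ A.l y = 3) with e | e
    · exact oa (c1 (-1) (xeq y 1 j e y2 (c1 1 y1)))
    · have := A.inj (e.trans vl.symm) (y2.trans vr.symm)
      subst this
      have dy : A.Dom y {a, k} := domk (dl a + j • dl k) (c1 1 y1)
      have e1 : A.Lam {a, k} (dl a + (1 - j) • dl k) := dy.drop (c2 (T := {y, a, k}) 1 y1 (-1) v1)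
      rcases hj with rfl | rfl
      · have := lose _ (mkC (a :> k :> k :> 0) e1) bs bs
        simp at this
      · exact h.V.ne (A.sep (c1 1 e1))
  obtain ⟨y, hy⟩ := pick (A := A) {a, k} (dl a - dl k)
  have up : A.Neg y (k :> u) := by
    have da : A.Dom a (lts u) := domk (-vec u) (c1 1 u2.2 (by simp only [vec_cons]; module))
    have h1 : A.Lam (insert a (insert y (lts (k :> u)))) (dl y + vec (k :> u)) := c2 1 hy 1 u2.2 (by
      simp only [vec_cons]; module)
    exact da.drop h1
  have r1 : A.r y ≤ A.r a + 1 := by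
    have := A.r_le (arcs_cons lk lu) up
    simp at this; omega
  have yI : A.In y (a :> k :> k :> k :> 0) := mkIn _ (c2 (T := {y, a, k})
    (u := dl y - dl a - (3 : ℤ) • dl k) 1 hy (-1) k4)
  obtain ⟨m, m1, m2, m3⟩ := yI.circ (by simp [la, lk])
  have r2 := lose _ m2 bs bs
  simp at r2
  rcases (by omega : A.r y = A.r a + 1 ∨ A.r y = A.r a) with e | e
  · exact fin y (-1) (Or.inl rfl) (c1 1 hy) e fun e' => mm y (k :> u) e' e ⟨arcs_cons e' (arcs_cons lk lu), up.lam⟩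
      (by simp; omega) k bs oo
  · have lm : ∀ y ∈ m, A.l y = 1 := m2.arcs
    have C : A.Circ ((a :> k :> k :> 0) + (k :> m)) := m2.re _
    obtain ⟨w, w1, w2, -, w3⟩ := C.split
    obtain ⟨m', p1, p2, -⟩ := w1.circ (by simp [la, lk])
    have r3 := lose _ p2 bs bs
    simp at r3 w3
    exact fin w 2 (Or.inr rfl) w1.lam oo fun e' => mm w (k :> m) e' oo
      ⟨arcs_cons e' (arcs_cons lk lm), w2.lam⟩ (by simp; omega) k bs oo


theorem kv (h : A.Ctx a b M) (K : A.KK k o) {U : Multiset R}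
    (lU : ∀ y ∈ U, A.l y = 1) (aU : a ∈ U) (bU : b ∈ U) (cU : U.card = M)
    (hU : A.Lam (lts (k :> U)) (vec U - dl k)) (ka : k ≠ a) :
    A.Viol a k ∧ ∃ M', A.Mn a k M' ∧ M ≤ M' ∧ M' ≤ M + 1 := by
  have la := h.V.la
  have ra := h.V.r2
  have lk := K.lk
  have rk := K.rk
  have V : A.Viol a k := by
    refine ⟨la, lk, ka.symm, fun i1 => ?_, fun i2 => ?_, fun s => K.nq ((s.cc la lk ra).1.2.2.1.q lk), fun s => ?_⟩
    · have := rep_le (n := 2) la (K.d0.drop (T := {a}) i1) oo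
      omega
    · have : A.Circ (k :> U) := mkC _ (c2 (T := lts (k :> U)) (u := vec U + dl k) 1 hU 1 i2
        (s' := ⟨by rintro x (rfl | rfl) <;> simp [aU]⟩))
      have := h.lose this (by simp [aU]) (by simp [bU])
      simp at this; omega
    · have := (s.cc lk la oo).1.2.1; omega
  obtain ⟨M', hM'⟩ := mn_ex (A := A) la lk
  refine ⟨V, M', hM', h.mn _ _ _ V hM', ?_⟩
  obtain ⟨U', rfl⟩ := Multiset.exists_cons_of_mem aU
  have lU' : ∀ y ∈ U', A.l y = 1 := fun y hy => lU y (by simp [hy])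
  have := hM'.2 (k :> k :> U') (mkC _ (c2 (T := lts (k :> a :> U')) (u := vec (a :> U') + (3 : ℤ) • dl k)
    1 hU 1 K.k4))
  simp at this cU; omega

theorem kfin2 (h : A.Ctx a b M) (K : A.KK k o) {P : Multiset R}
    (lU : ∀ y ∈ b :> P, A.l y = 1) (aU : a ∈ P) (cU : P.card + 1 = M)
    (hU : A.Lam (lts (k :> b :> P)) (vec (b :> P) - dl k)) (V : A.Viol a k) (hM : A.Mn a k M) : False := by
  have lP : ∀ y ∈ P, A.l y = 1 := fun y hy => lU y (by simp [hy])
  obtain ⟨z, z1, zl, zr⟩ := h.V.zz h.hM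
  obtain ⟨y, y1, yl, yr⟩ := V.zz hM
  have := A.inj (zl.trans yl.symm) oo
  subst this
  have e : A.Lam {b, a, k} (dl b - dl k) := In2.canc z1.symm y1
  have db : A.Dom b {a, k} := domk (dl k) (c1 1 e)
  have sa : SubC {a, k} (lts (k :> P)) := ⟨by rintro x (rfl | rfl) <;> simp [aU]⟩
  have sb : SubC {b, a, k} (insert b (lts (k :> P))) := ⟨by rintro x (rfl | rfl | rfl) <;> simp [aU]⟩
  have h1 : A.Lam (insert b (lts (k :> P))) (vec P) := c2 1 hU (-1) e (by simp only [vec_cons]; module)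
  have h2 : A.Lam (lts (k :> P)) (vec P) := db.drop h1
  have h3 : A.Lam (lts P) (vec P) := K.d0.drop (T := lts P) (A.mono h2 (show _ ⊆ insert k (lts P) from fun x hx => by simpa using hx))
  exact kfinal ⟨V, hM, h.mn⟩ K ⟨lP, h3⟩ aU cU

theorem kcase (h : A.Ctx a b M) (g : A.Good a b M (o :> o :> U))
    (ro : A.r o = 1) (hs : A.In2 s o o) (hn : A.Neg s U) (sl : A.l s = 2) (sr : A.r s = 1) : False := by
  have ra := h.V.r2
  have rb := h.V.symm.r2
  have lo : A.l o = 1 := g.C.1 o bs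
  have lU : ∀ y ∈ U, A.l y = 1 := g.C.arcs
  have o2 := two_q lo ro
  have ao : a ≠ o := by rintro rfl; omega
  have bo : b ≠ o := by rintro rfl; omega
  have aU : a ∈ U := by have := g.am; simpa [ao] using this
  have bU : b ∈ U := by have := g.bm; simpa [bo] using this
  have cU : U.card = M := by have := g.card; simpa using this
  obtain ⟨k, k1, lk, rk⟩ := inv (A := A) s
  rw [sr] at lk
  rw [sl] at rk
  have ko : A.Lam {k, o} (dl k) := by
    have e1 : A.Lam {s, k, o} (dl k) := c3 1 k1 (-1) hs (-1) o2
    exact hs.dom.drop e1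
  have ds : A.Dom s {k} := domk (-dl k) (c1 1 k1)
  have hU : A.Lam (lts (k :> U)) (vec U - dl k) := by
    have e1 : A.Lam (insert s (lts (k :> U))) (vec U - dl k) := c2 1 hn (-1) k1
    exact ds.drop e1
  have nq : ¬ A.QP k := fun q => g.kk o k U rfl ro lk rk (mkC _ (c2 (T := lts (k :> U))
    (u := vec U + tz • dl k) 1 hU 1 q (by rw [rk]; push_cast; module)))
  have K := kk_of lk rk lo ro ko nq
  have same : ∀ a b, A.Ctx a b M → a ∈ U → b ∈ U → k = b → False := by
    rintro a b h aU bU rfl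
    obtain ⟨P, rfl⟩ := Multiset.exists_cons_of_mem bU
    have e1 : A.Lam (lts (k :> P)) (vec P) := c1 1 hU (by simp only [vec_cons]; module)
    have e2 : A.Lam (lts P) (vec P) := K.d0.drop (T := lts P) (A.mono e1 (show _ ⊆ insert k (lts P) from fun x hx => by simpa using hx))
    exact kfinal h K ⟨fun y hy => lU y (by simp [hy]), e2⟩ (by simpa [h.V.ne] using aU) (by simpa using cU)
  by_cases ka : k = a
  · exact same b a h.symm bU aU ka
  by_cases kb : k = b
  · exact same a b h aU bU kb
  obtain ⟨V, M1, hM1, q1, q2⟩ := kv h K lU aU bU cU hU ka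
  obtain ⟨V', M2, hM2, q3, q4⟩ := kv h.symm K lU bU aU cU hU kb
  have fin : ∀ a b, A.Ctx a b M → a ∈ U → b ∈ U → A.Viol a k → A.Mn a k M → False := by
    intro a b h aU bU V hM
    obtain ⟨P, rfl⟩ := Multiset.exists_cons_of_mem bU
    exact kfin2 h K lU (by simpa [h.V.ne] using aU) (by simpa using cU) hU V hM
  rcases (by omega : M1 = M ∨ M1 = M + 1) with rfl | rfl
  · exact fin a b h aU bU V hM1
  rcases (by omega : M2 = M ∨ M2 = M + 1) with rfl | rfl
  · exact fin b a h.symm bU aU V' hM2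
  obtain ⟨z, z1, zl, zr⟩ := V.zz hM1
  obtain ⟨y, y1, yl, yr⟩ := V'.zz hM2
  have := A.inj (zl.trans yl.symm) oo
  subst this
  exact h.V.ne (A.sep (K.d0.drop (T := {a, b}) (In2.canc z1 y1.symm)))

theorem DL (h : A.Ctx a b M) (g : A.Good a b M (c :> c :> U))
    (ca : c ≠ a) (cb : c ≠ b) (he : e = a ∨ e = b) (ii : A.II c e) :
    (A.Lam (lts U) (tz • vec U)) ∧ ∃ s, A.In2 s c c ∧ A.Neg s U ∧ A.Lam {s, e} (tz • dl s) ∧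
      (2 ≤ A.r c → ∃ d, A.CC c d ∧ A.Lam {d, e} (dl d) ∧ A.l s = 2 ∧ A.r s = A.r c) := by
  have lc : A.l c = 1 := g.C.1 c bs
  have lU : ∀ y ∈ U, A.l y = 1 := g.C.arcs
  have aU : a ∈ U := by have := g.am; simpa [ca.symm] using this
  have bU : b ∈ U := by have := g.bm; simpa [cb.symm] using this
  have cU : U.card = M := by have := g.card; simpa using this
  have eU : e ∈ U := by rcases he with rfl | rfl <;> assumption
  have nU : ¬ A.Circ U := fun C => by have := h.lose C aU bU; omega
  obtain ⟨s, s1, s2, sl, -⟩ := g.C.split2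
  have sl2 : A.l s = 2 := by
    by_contra h'
    obtain ⟨m, m1, m2, -⟩ := short s2 lU
    have := h.lose m2 (by simp [aU]) (by simp [bU])
    simp at this; omega
  have no : ¬ A.Lam {s, e} (dl s) := fun h1 => by
    have d : A.Dom s {e} := domk 0 (c1 1 h1)
    refine nU ⟨lU, d.drop (T := lts U) (c2 (T := insert s (lts U)) (u := vec U) 1 s2 (-1) h1
      (s' := ⟨by rintro x (rfl | rfl) <;> simp [eU]⟩)) (s' := ⟨by rintro x rfl; exact eU⟩)⟩
  suffices A.Lam {s, e} (tz • dl s) ∧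
      (2 ≤ A.r c → ∃ d, A.CC c d ∧ A.Lam {d, e} (dl d) ∧ A.l s = 2 ∧ A.r s = A.r c) by
    refine ⟨?_, s, s1, s2, this⟩
    have d : A.Dom s (lts U) := domk (-vec U) (c1 1 s2)
    exact d.drop (T := lts U) (c2 (T := insert s (lts U)) (u := tz • vec U) 2 s2 (-1) this.1
      (s' := ⟨by rintro x (rfl | rfl) <;> simp [eU]⟩))
  by_cases rc : A.r c = 1
  · have o2 := two_q lc rc
    have r2 : A.r s ≤ 2 := rle (x := s) (c :> c :> 0) (c2 (T := {s, c}) (u := dl s + tz • dl c) 1 s1 2 o2)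
    have r0 : A.r s ≠ 0 := fun h0 => by have := (r_zero h0).2; omega
    rcases (by omega : A.r s = 1 ∨ A.r s = 2) with r | r
    · exact (kcase h g rc s1 s2 sl2 r).elim
    · exact ⟨c1 1 (inv2 sl2 r), fun h => by omega⟩
  have rc2 : 2 ≤ A.r c := by have := r_pos lc; omega
  obtain ⟨y, y1, y2⟩ := split {c} {e} (tz • dl c) 0 ii
  have yc : A.In2 y c c := c1 1 y1
  have y3 : A.Lam {y, e} (dl y) := c1 1 y2
  have sy : y ≠ s := by rintro rfl; exact no y3
  rcases T3 lc rc2 with ⟨_, t, -, -, -, ht⟩ | ⟨_, _, t, -, -, -, -, ht⟩ | ⟨d, hd, ht⟩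
  · exact (sy ((ht y yc).trans (ht s s1).symm)).elim
  · exact (sy ((ht y yc).trans (ht s s1).symm)).elim
  · have hs : A.l s = 2 ∧ A.r s = A.r c := by
      rcases ht s s1 with rfl | h'
      · have := hd.1.1; omega
      · exact h'
    have yd : y = d := (ht y yc).resolve_right fun h' => sy (A.ij)
    subst yd
    refine ⟨?_, fun _ => ⟨y, hd, y3, hs⟩⟩
    have h1 := (hd.tau lc s1 hs.1 hs.2).2
    have dy : A.Dom y {e} := domk 0 (c1 1 y3)
    have h2 : A.Lam {y, s, e} (tz • dl s) := c2 1 h1 (-(A.r c - 2 : ℤ)) y3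
    exact dy.drop h2


theorem Ctx.M3 (h : A.Ctx a b M) : 3 ≤ M := by
  have h1 := h.V.r2
  have h2 := h.V.symm.r2
  have h3 := h.V.T5' h.hM
  by_contra h'
  exact h.V.ne (A.inj (by rw [h.V.la, h.V.lb]) oo)

def TL (A : Sys R) (a b : R) (M : ℕ) (W' : Multiset R) (x : R) (i : ℕ) : Prop :=
  ∃ U t, W' = x :> U ∧ A.In t (a :> b :> x :> 0) ∧ A.Neg t U ∧ A.l t = i ∧ A.r t + 1 = M ∧
    (a ∈ U → b ∈ U → i = 3)

theorem TLex (h : A.Ctx a b M) (g : A.Good a b M (a :> b :> W'))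
    (hx : x ∈ W') : ∃ i, 1 ≤ i ∧ i ≤ 3 ∧ A.TL a b M W' x i := by
  have M3 := h.M3
  obtain ⟨U, rfl⟩ := Multiset.exists_cons_of_mem hx
  have cU : U.card + 1 = M := by have := g.card; simpa using this
  have C : A.Circ ((a :> b :> x :> 0) + U) := by simpa using g.C
  have lU : ∀ y ∈ U, A.l y = 1 := C.arcs
  obtain ⟨t, t1, t2, t3, t4⟩ := C.split
  obtain ⟨m, m1, m2, -⟩ := t1.circ C.arcs
  have := h.lose m2 bs bs
  simp at this t3
  refine ⟨A.l t, ?_, t3, U, t, rfl, t1, t2, rfl, by omega, fun aU bU => ?_⟩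
  · by_contra h'
    have := (l_zero (show A.l t = 0 by omega)).2
    omega
  · obtain ⟨m', p1, p2, -⟩ := short t2 lU
    have := h.lose p2 (by simp [aU]) (by simp [bU])
    simp at this; omega

theorem TLinj (h : A.Ctx a b M) (g : A.Good a b M (a :> b :> W'))
    (hx : A.TL a b M W' x i) (hy : A.TL a b M W' y i) : x = y := by
  obtain ⟨U, t, e1, t1, -, t2, t3, -⟩ := hx
  obtain ⟨U', t', e1', t1', -, t2', t3', -⟩ := hy
  have := A.inj (t2.trans t2'.symm) oo
  subst this
  have dt : A.Dom t (lts (a :> b :> x :> 0)) := domk (vec (a :> b :> x :> 0)) t1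
  have E : A.Lam {x, y, a, b} (dl x - dl y) := by
    have : A.Lam {t, x, y, a, b} (dl x - dl y) := c2 (-1) t1 1 t1' (by simp only [vec_cons]; module)
    exact dt.drop this
  have xW : x ∈ a :> b :> W' := by rw [e1]; simp
  have yW : y ∈ a :> b :> W' := by rw [e1']; simp
  by_contra ne
  by_cases xa : x = a
  · subst xa
    by_cases yb : y = b
    · subst yb; exact ne (A.sep (c1 1 E))
    · exact g.f1 y yW (Ne.symm ne) yb (c1 (-1) E)
  by_cases xb : x = b
  · subst xb
    by_cases yb : y = a
    · subst yb; exact ne (A.sep (c1 1 E))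
    · exact g.f1' y yW yb (Ne.symm ne) (c1 (-1) E)
  by_cases ya : y = a
  · subst ya; exact g.f1 x xW xa xb (c1 1 E)
  by_cases yb : y = b
  · subst yb; exact g.f1' x xW xa xb (c1 1 E)
  exact g.f3 x xW y yW xa xb ya yb ne E

theorem Good.mult (h : A.Ctx a b M) (g : A.Good a b M (c :> c :> c :> U))
    (ca : c ≠ a) (cb : c ≠ b) (he : e = a ∨ e = b) (ii : A.II c e) : False := by
  have aU : a ∈ U := by have := g.am; simpa [ca.symm] using this
  have bU : b ∈ U := by have := g.bm; simpa [cb.symm] using this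
  have eU : e ∈ U := by rcases he with rfl | rfl <;> assumption
  have cU := g.card
  have : A.Circ (c :> U) := ⟨g.C.arcs, c2 1 g.C.2 (-1) ii (by simp only [vec_cons]; module)
    (s' := ⟨by rintro x (rfl | rfl) <;> simp [eU]⟩)⟩
  have := h.lose this (by simp [aU]) (by simp [bU])
  simp at this cU; omega

theorem five (h : A.Ctx a b M) (rb : A.r b = 2) (ra : A.r a = 3) (ro : A.r o = 1)
    (cc : A.CC b o) (C : A.Circ (b :> b :> a :> x :> o :> 0)) : False := by
  have la := h.V.la
  have lb := h.V.lb
  obtain ⟨s, s1, s2, -, -⟩ := C.split2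
  rcases T3C lb oo cc s1 with rfl | ⟨sl, sr⟩
  · have C' : A.Circ (a :> x :> s :> s :> 0) := ⟨arcs_cons la (arcs_cons (C.1 x bs)
      (arcs_cons cc.1.1 (arcs_cons cc.1.1 arcs_zero))), s2.lam⟩
    rcases mmlet la C' bs (by simp; omega) (show s ∈ _ by simp) with e | e
    · subst e; omega
    · omega
  · rcases T3 la oo with ⟨_, t, tl, tr, t1, -⟩ | ⟨_, d, _, hd, -⟩ | ⟨d, hd, -⟩
    · have := A.inj (tl.trans sl.symm) oo
      subst this
      have e1 : A.Lam {t, a, b} (tz • dl a - tz • dl b) := c2 (-1) t1 1 s1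
      exact h.V.P h.hM (-2) (c1 1 (t1.dom.drop (T := {a, b}) e1))
    · have : d = b := A.inj (by rw [hd.1.1, lb]) (by have := hd.1.2.1; omega)
      subst this; exact h.V.na hd.2
    · have : d = b := A.inj (by rw [hd.1.1, lb]) (by have := hd.1.2.1; omega)
      subst this; exact h.V.s1 hd.2

theorem B1a {k : ℕ} (h : A.Ctx a b M) (g : A.Good a b M (a :> a :> b :> b :> rp (k + 1) c))
    (ca : c ≠ a) (cb : c ≠ b) (he : e = a ∨ e = b) (ii : A.II c e) (hk : k ≤ 1)
    (tn : A.Neg t (b :> rp (k + 1) c)) (tl : A.l t = 1) (tr : A.r t + 1 = M) : False := by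
  have la := h.V.la
  have lb := h.V.lb
  have ra := h.V.r2
  have rb := h.V.symm.r2
  have lc : A.l c = 1 := g.C.1 c bs
  have cd := g.card
  have f2 := g.f2 h (show c ∈ _ by simp) ca cb
  simp at cd
  have C : A.Circ (t :> b :> rp (k + 1) c) := ⟨arcs_cons tl (arcs_cons lb (arcs_rep lc)), tn.lam⟩
  have q1 := mmlet tl C bs (by simp; omega) (show b ∈ _ by simp)
  have q2 := mmlet tl C bs (by simp; omega) (show c ∈ _ by simp)
  rcases (by omega : k = 0 ∨ k = 1) with rfl | rfl
  · rcases q1 with rfl | q1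
    · have ro : A.r c = 1 := by
        rcases q2 with q2 | q2
        · exact absurd q2 cb
        · omega
      have ss : A.SS b c := c2 1 C.2 (-1) (two_q lc ro) (by simp only [vec_cons, vec_rep]; push_cast; module)
      have r3 := (h.V.T5' h.hM).1
      have : A.r a ≠ A.r b := fun e' => h.V.ne (A.inj (by rw [la, lb]) e')
      exact five h oo oo ro (ss.cc lb lc rb) (g.C.re (b :> b :> a :> a :> c :> 0))
    · omega
  · have : ∃ f, (A.CC t f ∨ A.DD t f) ∧ ((b = t ∧ c = f) ∨ (b = f ∧ c = t)) := by
      have key : ∀ f, A.Mx t f → ((b = t ∧ c = f) ∨ (b = f ∧ c = t)) := fun f hf => by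
        have w1 := hf.2.2.2 _ C bs (by simp; omega) b bs
        have w2 := hf.2.2.2 _ C bs (by simp; omega) c bs
        rcases w1 with w1 | w1 <;> rcases w2 with w2 | w2
        · exact absurd (w2.trans w1.symm) cb
        · exact Or.inl ⟨w1, w2⟩
        · exact Or.inr ⟨w1, w2⟩
        · exact absurd (w2.trans w1.symm) cb
      rcases MM3 tl with p | ⟨f, hf⟩ | ⟨f, hf⟩
      · exact absurd ((p _ C bs (by simp; omega) c bs).trans
          (p _ C bs (by simp; omega) b bs).symm) cb
      · exact ⟨f, Or.inl hf, key f hf.1⟩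
      · exact ⟨f, Or.inr hf, key f hf.1⟩
    obtain ⟨f, hf, ⟨rfl, rfl⟩ | ⟨rfl, rfl⟩⟩ := this
    · have pf : A.Mx b c := hf.elim (·.1) (·.1)
      have q := pf.2.2.1.q lc
      have : A.r c = 2 := by have := pf.2.1; omega
      rw [this] at q
      refine f2 ?_
      rcases he with rfl | rfl
      · exact c2 1 q (-1) ii
      · exact c2 1 q (-1) ii
    · have q : A.Lam {c, b} (dl b + (3 : ℤ) • dl c) := C.lam
      rcases hf with hf | hf
      · have := hf.circ lc C bs (by simp; omega)
        have e2 := congrArg vec this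
        have e3 := congrFun e2 c
        classical
        rw [vec_apply, vec_apply] at e3
        simp [Multiset.count_cons, Multiset.count_replicate, cb, cb.symm] at e3
      · rcases hf.circ lc C bs (by simp; omega) with this | qp
        · have e2 := congrArg vec this
          have e3 := congrFun e2 c
          classical
          rw [vec_apply, vec_apply] at e3
          simp [Multiset.count_cons, Multiset.count_replicate, cb, cb.symm] at e3
        · have h3 : A.r c = 3 := by omega
          unfold QP at qp
          rw [h3] at qp
          exact cb (A.sep (c2 1 qp (-1) q))


def K1 (A : Sys R) (a b : R) (W : Multiset R) : Prop := ∀ c ∈ W, c ≠ a → c ≠ b → ∃ e, (e = a ∨ e = b) ∧ A.II c e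

theorem K1.symm (k : A.K1 a b W) : A.K1 b a W := fun c hc h1 h2 => by
  obtain ⟨e, he, ii⟩ := k c hc h2 h1
  exact ⟨e, he.symm, ii⟩

theorem allrep (h : ∀ x ∈ X, ∀ y ∈ X, x = y) : X = 0 ∨ ∃ x k, X = rp (k + 1) x := by
  rcases X.empty_or_exists_mem with rfl | ⟨x, hx⟩
  · exact Or.inl rfl
  · obtain ⟨Y, rfl⟩ := Multiset.exists_cons_of_mem hx
    refine Or.inr ⟨x, Y.card, ?_⟩
    have := Multiset.eq_replicate_card.2 (fun y hy => h y hy x hx)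
    rwa [Multiset.card_cons] at this

theorem B1 (h : A.Ctx a b M) (g : A.Good a b M (a :> a :> b :> b :> X))
    (K : A.K1 a b (a :> a :> b :> b :> X)) : False := by
  have g' : A.Good a b M (a :> b :> (a :> b :> X)) := by
    rwa [show (a :> b :> (a :> b :> X)) = a :> a :> b :> b :> X by rw [Multiset.cons_swap b a]]
  have T3 : ∀ x ∈ X, A.TL a b M (a :> b :> X) x 3 := fun x hx => by
    obtain ⟨i, -, -, T⟩ := TLex h g' (x := x) (by simp [hx])
    obtain ⟨U, t, e, t1, t2, t3, t4, t5⟩ := id T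
    obtain ⟨X', rfl⟩ := Multiset.exists_cons_of_mem hx
    have e' : a :> b :> x :> X' = x :> a :> b :> X' := by
      rw [Multiset.cons_swap b, Multiset.cons_swap a]
    rw [e', Multiset.cons_inj_right] at e
    subst e
    rw [← t5 bs bs]; exact T
  rcases allrep (fun x hx y hy => TLinj h g' (T3 x hx) (T3 y hy)) with rfl | ⟨c, k, rfl⟩
  · exact h.V.P h.hM 2 g.C.lam
  by_cases ca : c = a
  · subst ca
    exact h.symm.V.P h.symm.hM (k + 3) g.C.lam
  by_cases cb : c = b
  · subst cb
    exact h.V.P h.hM (k + 3) g.C.lam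
  obtain ⟨e, he, ii⟩ := K c bs ca cb
  rcases (by by_cases hk : k ≤ 1; exact Or.inl hk; exact Or.inr ⟨k - 2, by omega⟩ : k ≤ 1 ∨ ∃ k', k = k' + 2) with hk | ⟨k, rfl⟩
  · have q := T3 c bs
    obtain ⟨i, i1, i2, Ta⟩ := TLex h g' (x := a) bs
    obtain ⟨j, j1, j2, Tb⟩ := TLex h g' (x := b) bs
    have n1 : i ≠ j := by rintro rfl; exact h.V.ne (TLinj h g' Ta Tb)
    have n2 : i ≠ 3 := by rintro rfl; exact ca (TLinj h g' q Ta)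
    have n3 : j ≠ 3 := by rintro rfl; exact cb (TLinj h g' q Tb)
    rcases (by omega : i = 1 ∨ j = 1) with rfl | rfl
    · obtain ⟨U, t, e, t1, t2, t3, t4, t5⟩ := Ta
      rw [Multiset.cons_inj_right] at e
      subst e
      exact B1a h g ca cb he ii hk t2 t3 t4
    · obtain ⟨U, t, e, t1, t2, t3, t4, t5⟩ := Tb
      rw [Multiset.cons_swap, Multiset.cons_inj_right] at e
      subst e
      have g2 : A.Good b a M (b :> b :> a :> a :> rp (k + 1) c) := by
        have := g.symm
        rwa [Multiset.cons_swap a b, Multiset.cons_swap a b, Multiset.cons_swap a b, Multiset.cons_swap a b] at this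
      exact B1a h.symm g2 cb ca he.symm ii hk t2 t3 t4
  · have e0 : a :> a :> b :> b :> rp (k + 2 + 1) c = c :> c :> c :> (a :> a :> b :> b :> rp k c) := by
      apply vec_inj; simp only [vec_cons, vec_rep]; push_cast; module
    rw [e0] at g
    exact g.mult h ca cb he ii

theorem B3 (h : A.Ctx a b M) (g : A.Good a b M (a :> b :> x :> U))
    (K : A.K1 a b (a :> b :> x :> U)) (aU : a ∉ x :> U) (yU : y ∈ U) (zU : z ∈ U) (xy : x ≠ y) (xz : x ≠ z)
    (yz : y ≠ z) (ti : A.In t (a :> b :> x :> 0)) (tn : A.Neg t U) (tl : A.l t = 1) (tr : A.r t + 1 = M) : False := by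
  have M3 := h.M3
  have la := h.V.la
  have lb := h.V.lb
  have cd := g.card
  have C : A.Circ (t :> U) := ⟨arcs_cons tl g.C.arcs, tn.lam⟩
  have cC : (t :> U).card = A.r t + 1 := by simp at cd ⊢; omega
  have key : ∀ f, A.Mx t f → t ∈ U ∧ f ∈ U ∧ x ≠ t ∧ x ≠ f ∧ t ≠ f := fun f hf => by
    have w1 := hf.2.2.2 _ C bs cC y (by simp [yU])
    have w2 := hf.2.2.2 _ C bs cC z (by simp [zU])
    have : t ≠ f := by rintro rfl; have := hf.2.1; omega
    rcases w1 with rfl | rfl <;> rcases w2 with rfl | rfl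
    · exact absurd rfl yz
    · exact ⟨yU, zU, xy, xz, yz⟩
    · exact ⟨zU, yU, xz, xy, yz.symm⟩
    · exact absurd rfl yz
  rcases MM3 tl with p | ⟨f, hf⟩ | ⟨f, hf⟩
  · exact yz ((p _ C bs cC y (by simp [yU])).trans (p _ C bs cC z (by simp [zU])).symm)
  · obtain ⟨tU, fU, xt, xf, tf⟩ := key f hf.1
    have e := hf.circ tl C bs cC
    rw [show rp 2 t = t :> t :> 0 from rfl, Multiset.cons_add, Multiset.cons_add, zero_add,
      Multiset.cons_inj_right] at e
    have rf := hf.1.2.1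
    have lf := hf.1.1
    have pf := hf.1.2.2.1
    subst e
    have ax : x ≠ a := by rintro rfl; simp at aU
    have ta : t ≠ a := by rintro rfl; simp at aU
    have fa : f ≠ a := by rintro rfl; exact aU (by simp [fU])
    by_cases fb : f = b
    · subst fb
      obtain ⟨e, he, ii⟩ := K t bs ta tf
      rcases he with rfl | rfl
      · obtain ⟨y', y1, y2⟩ := A.split {t} {e} (tz • dl t) 0 ii
        have y3 : A.In2 y' t t := c1 1 y1
        rcases T3C tl oo hf y3 with rfl | ⟨yl, yr⟩
        · exact h.V.nb (c1 1 y2)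
        obtain ⟨e2, he2, i2⟩ := K x bs ax xf
        have q : A.Lam {x, e, f, t} (tz • dl e + dl f) := by
          rcases he2 with rfl | rfl
          · exact c3 (-2) ti 1 hf.2 (-1) i2 (by simp only [vec_cons, vec_zero]; module)
          · exact c3 (-2) ti 1 hf.2 (-1) i2 (by simp only [vec_cons, vec_zero]; module)
        have dx : A.Dom x {e, f, t} := domk (dl t - dl e - dl f) (c1 (-1) ti (by simp only [vec_cons, vec_zero]; module))
        have q2 : A.Lam {t, e, f} (tz • dl e + dl f) := dx.drop q
        rcases hf.HC tl (OvC.out) q2 with q3 | ⟨t', l1, r1, -, q3⟩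
        · exact h.V.P h.hM 1 (c1 1 q3)
        · obtain rfl := A.inj (l1.trans yl.symm) (r1.trans yr.symm)
          have d : A.Dom t' {e} := domk 0 (c1 1 y2)
          have q4 : A.Lam {t', e, f} (tz • dl e + tz • dl f) := c2 1 q3 1 y2
          exact h.V.P h.hM 2 (d.drop q4)
      · have : A.Lam {t} ((2 : ℕ) • dl t) := hf.dom.drop (c1 1 ii (T := {e, t}))
        have := rep_le (n := 2) tl (c1 1 this) oo
        omega
    · obtain ⟨e, he, ii⟩ := K f (by simp [fU]) fa fb
      have e0 : ∀ k, a :> b :> x :> t :> rp (k + 3) f = f :> f :> f :> (a :> b :> x :> t :> rp k f) :=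
        fun k => by apply vec_inj; simp only [vec_cons, vec_rep]; push_cast; module
      have f2 := g.f2 h (show f ∈ _ by simp [fU]) fa fb
      have q := pf.q lf
      have rp := r_pos lf
      rcases (by by_cases hk : A.r f ≤ 2; exact Or.inl hk; exact Or.inr ⟨A.r f - 3, by omega⟩ :
        A.r f ≤ 2 ∨ ∃ k', A.r f = k' + 3) with hk | ⟨k, hk⟩
      · rcases (by omega : A.r f = 1 ∨ A.r f = 2) with h1 | h1
        · have r1 := h.V.r2
          have r2 := h.V.symm.r2
          obtain ⟨r3, r4⟩ := h.V.T5' h.hM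
          have n1 : A.r a ≠ A.r b := fun e' => h.V.ne (A.inj (by rw [la, lb]) e')
          have n2 : A.r a ≠ A.r t := fun e' => ta (A.inj (by rw [la, tl]) e'.symm)
          have : t = b := A.inj (by rw [lb, tl]) oo
          subst this
          rw [h1] at g
          exact five h oo oo h1 hf (g.C.re (t :> t :> a :> x :> f :> 0))
        · rw [h1] at q
          refine f2 ?_
          rcases he with rfl | rfl
          · exact c2 1 q (-1) ii
          · exact c2 1 q (-1) ii
      · rw [hk, e0] at g
        exact g.mult h fa fb he ii
  · obtain ⟨tU, fU, xt, xf, tf⟩ := key f hf.1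
    obtain ⟨U', rfl⟩ := Multiset.exists_cons_of_mem tU
    have fU' : f ∈ U' := by simpa [tf.symm] using fU
    have : A.Circ (a :> b :> x :> U') := by
      refine ⟨g.C.arcs, ?_⟩
      have d := hf.dom
      have : A.Lam (insert t (lts (a :> b :> x :> U'))) (vec (a :> b :> x :> U')) :=
        c2 1 g.C.2 (-1) hf.2 (by simp only [vec_cons]; module)
          (s' := ⟨by rintro w (rfl | rfl) <;> simp [fU', Set.mem_insert_iff, lts]⟩)
      exact d.drop this (s' := ⟨by rintro w rfl; simp [fU', lts]⟩)
    have := h.lose this bs bs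
    simp at this cd; omega


theorem nde (h : A.Ctx a b M) (hd : d = a ∨ d = b) (he : e = a ∨ e = b)
    (q : A.Lam {d, e} (dl d)) : False := by
  rcases hd with rfl | rfl <;> rcases he with rfl | rfl
  · exact not1 h.V.la (c1 1 q)
  · exact h.V.na q
  · exact h.V.nb (c1 1 q)
  · exact not1 h.V.lb (c1 1 q)

theorem B21 (h : A.Ctx a b M) (g : A.Good a b M (c :> c :> a :> b :> c' :> 0))
    (K : A.K1 a b (c :> c :> a :> b :> c' :> 0)) (ca : c ≠ a) (cb : c ≠ b) (ca' : c' ≠ a) (cb' : c' ≠ b)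
    (cc : c ≠ c') : False := by
  have la := h.V.la
  have lb := h.V.lb
  have lc : A.l c = 1 := g.C.1 c bs
  have lc' : A.l c' = 1 := g.C.1 c' bs
  have cd := g.card
  have r1 := h.V.r2
  have r2 := h.V.symm.r2
  obtain ⟨r3, r4⟩ := h.V.T5' h.hM
  have n1 : A.r a ≠ A.r b := fun e' => h.V.ne (A.inj (by rw [la, lb]) e')
  have n2 : A.r c ≠ A.r a := fun e' => ca (A.inj (by rw [la, lc]) e')
  have n3 : A.r c ≠ A.r b := fun e' => cb (A.inj (by rw [lb, lc]) e')
  have n4 : A.r c' ≠ A.r a := fun e' => ca' (A.inj (by rw [la, lc']) e')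
  have n5 : A.r c' ≠ A.r b := fun e' => cb' (A.inj (by rw [lb, lc']) e')
  have n6 : A.r c ≠ A.r c' := fun e' => cc (A.inj (by rw [lc, lc']) e')
  have b1 := g.C.le c
  have b2 := g.C.le c'
  have p1 := r_pos lc
  have p2 := r_pos lc'
  simp only [Multiset.card_cons, Multiset.card_zero] at cd b1 b2
  have hab : ∀ d, A.l d = 1 → A.r d = 3 → d = a ∨ d = b := fun d ld rd => by
    rcases (by omega : A.r a = 3 ∨ A.r b = 3) with q | q
    · exact Or.inl (A.inj (by rw [la, ld]) oo)
    · exact Or.inr (A.inj (by rw [lb, ld]) oo)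
  obtain ⟨e, he, ii⟩ := K c bs ca cb
  obtain ⟨e', he', ii'⟩ := K c' bs ca' cb'
  obtain ⟨D, s, -, -, -, D2⟩ := DL h g ca cb he ii
  rcases (by omega : A.r c = 4 ∨ A.r c' = 4) with q | q
  · obtain ⟨d, d1, d2, -⟩ := D2 oo
    have := d1.1.2.1
    exact nde h (hab d d1.1.1 oo) he d2
  · have D3 : A.Lam {c', a, b} (tz • dl a + tz • dl b) := by
      rcases he' with rfl | rfl
      · exact c2 1 D (-1) ii' (by simp only [vec_cons, vec_zero]; module)
      · exact c2 1 D (-1) ii' (by simp only [vec_cons, vec_zero]; module)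
    obtain ⟨y, y1, y2⟩ := A.split {c'} {e'} (tz • dl c') 0 ii'
    have y3 : A.In2 y c' c' := c1 1 y1
    have dy : A.Dom y {e'} := domk 0 (c1 1 y2)
    have me : SubC {e'} ({a, b} : Set R) := ⟨by rintro w rfl; exact he'⟩
    have sing : (∃ s, A.In2 s c' c' ∧ ∀ x, A.In2 x c' c' → x = s) → False := by
      rintro ⟨s', s1, s2⟩
      obtain rfl := s2 y y3
      have D4 : A.Lam {y, a, b} (tz • dl a + tz • dl b) := (single s1 s2).drop (c1 1 D3 (T := {c', y, a, b}))
      exact h.V.P h.hM 2 (dy.drop D4)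
    rcases T3 lc' oo with ⟨_, s', -, -, s1, s2⟩ | ⟨_, d, s', -, -, -, s1, s2⟩ | ⟨d, d1, d2⟩
    · exact sing ⟨s', s1, s2⟩
    · exact sing ⟨s', s1, s2⟩
    · have := d1.1.2.1
      have hd := hab d d1.1.1 oo
      have md : SubC {d} ({a, b} : Set R) := ⟨by rintro w rfl; exact hd⟩
      rcases d2 y y3 with rfl | ⟨yl, yr⟩
      · exact nde h hd he' (c1 1 y2)
      rcases d1.HC lc' (S := {a, b}) OvC.out D3 with q3 | ⟨t, t1, t2, -, q3⟩
      · exact h.V.P h.hM 2 (c1 1 q3 (s := ⟨by rintro w (rfl | hw); exact hd; exact hw⟩))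
      · obtain rfl := A.inj (t1.trans yl.symm) (t2.trans yr.symm)
        have s5 : SubC {t, e'} ({t, a, b} : Set R) := ⟨by rintro w (rfl | rfl); exact Or.inl rfl; exact Or.inr he'⟩
        have s6 : SubC (insert d (insert t {a, b})) ({t, a, b} : Set R) := ⟨by
          rintro w (rfl | rfl | hw); exact Or.inr hd; exact Or.inl rfl; exact Or.inr hw⟩
        have md' : MemC d ({a, b} : Set R) := ⟨hd⟩
        have q4 : A.Lam {t, a, b} (tz • dl a + tz • dl b + dl d) := c2 1 q3 1 y2
        have q5 : A.Lam {a, b} (tz • dl a + tz • dl b + dl d) := dy.drop q4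
        rcases hd with rfl | rfl
        · exact h.symm.V.P h.symm.hM 3 (c1 1 q5)
        · exact h.V.P h.hM 3 (c1 1 q5)

theorem B22 (h : A.Ctx a b M) (g : A.Good a b M (c :> c :> a :> b :> c' :> c' :> 0))
    (K : A.K1 a b (c :> c :> a :> b :> c' :> c' :> 0)) (ca : c ≠ a) (cb : c ≠ b) (ca' : c' ≠ a) (cb' : c' ≠ b)
    (r2 : 2 ≤ A.r c') : False := by
  have la := h.V.la
  have lb := h.V.lb
  have lc : A.l c = 1 := g.C.1 c bs
  have lc' : A.l c' = 1 := g.C.1 c' bs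
  have cd := g.card
  have g' : A.Good a b M (c' :> c' :> a :> b :> c :> c :> 0) := by
    rwa [show c' :> c' :> a :> b :> c :> c :> 0 = c :> c :> a :> b :> c' :> c' :> 0 by
      apply vec_inj; simp only [vec_cons]; module]
  obtain ⟨e, he, ii⟩ := K c bs ca cb
  obtain ⟨e', he', ii'⟩ := K c' bs ca' cb'
  obtain ⟨-, s, s1, s2, s3, -⟩ := DL h g ca cb he ii
  obtain ⟨-, s', p1, -, p3, p4⟩ := DL h g' ca' cb' he' ii'
  obtain ⟨d, d1, d2, d3, d4⟩ := p4 r2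
  obtain ⟨y, y1, y2⟩ := A.split {c'} {s, a, b} (tz • dl c') (dl s + dl a + dl b) s2 (by
    simp only [vec_cons, vec_zero]; module)
  have y3 : A.In2 y c' c' := c1 1 y1
  have me : MemC e ({a, b} : Set R) := ⟨he⟩
  have me' : MemC e' ({a, b} : Set R) := ⟨he'⟩
  have dd : A.Dom d {e'} := domk 0 (c1 1 d2)
  rcases T3C lc' r2 d1 y3 with rfl | ⟨yl, yr⟩
  · have q1 : A.Lam (insert y (insert s {a, b})) (dl s + dl a + dl b) := c2 1 y2 (-1) d2
    have q2 : A.Lam (insert s {a, b}) (dl s + dl a + dl b) := dd.drop q1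
    have q3 : A.Lam {s, c, a, b} (tz • dl c + dl a + dl b) := c2 1 q2 (-1) s1
    have q4 : A.Lam {c, a, b} (tz • dl c + dl a + dl b) := s1.dom.drop q3
    have := h.lose (mkC (c :> c :> a :> b :> 0) q4) bs bs
    simp at this cd; omega
  · obtain rfl := A.inj (yl.trans d3.symm) (yr.trans d4.symm)
    have q1 : A.Lam (insert y (insert s {a, b})) (tz • dl a + tz • dl b) := c3 2 y2 (-1) p3 (-1) s3
    have ds : A.Dom s {y, a, b} := domk (- dl y - dl a - dl b) (c1 1 y2)
    have q2 : A.Lam (insert y {a, b}) (tz • dl a + tz • dl b) := ds.drop q1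
    have q3 : A.Lam (insert d {a, b}) (tz • dl a + tz • dl b) :=
      (d1.tau lc' p1 d3 d4).1.drop (c1 1 q2 (T := {y, d, a, b}))
    exact h.V.P h.hM 2 (dd.drop q3)

theorem B2x (h : A.Ctx a b M) (g : A.Good a b M (a :> b :> (rp i b + rp j c)))
    (K : A.K1 a b (a :> b :> (rp i b + rp j c))) (ca : c ≠ a) : False := by
  by_cases cb : c = b
  · subst cb
    exact h.V.P h.hM (2 * (i + j + 1)) (c1 2 g.C.2 (by simp only [vec_cons, vec_add, vec_rep]; push_cast; module))
  rcases j with _ | j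
  · exact h.V.P h.hM (2 * (i + 1)) (c1 2 g.C.2 (by simp only [vec_cons, vec_add, vec_rep]; push_cast; module))
  obtain ⟨e, he, ii⟩ := K c bs ca cb
  rcases j with _ | _ | j
  · have me : MemC e ({a, b} : Set R) := ⟨he⟩
    have q : A.Lam (insert c {a, b}) (tz • dl a + (2 * (i + 1) : ℤ) • dl b) :=
      c2 2 g.C.2 (-1) ii (by simp only [vec_cons, vec_add, vec_rep]; push_cast; module)
    have dc : A.Dom c {a, b} := domk (- dl a - (i + 1 : ℤ) • dl b)
      (c1 1 g.C.2 (by simp only [vec_cons, vec_add, vec_rep]; push_cast; module))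
    exact h.V.P h.hM _ (dc.drop q)
  · have g' : A.Good a b M (c :> c :> (a :> b :> rp i b)) := by
      rwa [show c :> c :> (a :> b :> rp i b) = a :> b :> (rp i b + rp (0 + 1 + 1) c) by
        apply vec_inj; simp only [vec_cons, vec_add, vec_rep]; push_cast; module]
    obtain ⟨D, -⟩ := DL h g' ca cb he ii
    exact h.V.P h.hM (2 * (i + 1)) (c1 1 D (by simp only [vec_cons, vec_add, vec_rep]; push_cast; module))
  · have g' : A.Good a b M (c :> c :> c :> (a :> b :> (rp i b + rp j c))) := by
      rwa [show c :> c :> c :> (a :> b :> (rp i b + rp j c)) = a :> b :> (rp i b + rp (j + 1 + 1 + 1) c) by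
        apply vec_inj; simp only [vec_cons, vec_add, vec_rep]; push_cast; module]
    exact g'.mult h ca cb he ii

theorem B2y (h : A.Ctx a b M) (g : A.Good a b M (a :> b :> (rp i c + rp j c')))
    (K : A.K1 a b (a :> b :> (rp i c + rp j c'))) (ca : c ≠ a) (cb : c ≠ b) (ca' : c' ≠ a) (cb' : c' ≠ b)
    (cc : c ≠ c') : False := by
  have mul : ∀ c c' i j, c ≠ a → c ≠ b → A.Good a b M (a :> b :> (rp i c + rp j c')) →
      A.K1 a b (a :> b :> (rp i c + rp j c')) → i ≤ 2 := by
    intro c c' i j ca cb g K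
    by_contra hi
    obtain ⟨k, rfl⟩ : ∃ k, i = k + 3 := ⟨i - 3, by omega⟩
    obtain ⟨e, he, ii⟩ := K c bs ca cb
    have g' : A.Good a b M (c :> c :> c :> (a :> b :> (rp k c + rp j c'))) := by
      rwa [show c :> c :> c :> (a :> b :> (rp k c + rp j c')) = a :> b :> (rp (k + 3) c + rp j c') by
        apply vec_inj; simp only [vec_cons, vec_add, vec_rep]; push_cast; module]
    exact g'.mult h ca cb he ii
  have m1 := mul c c' i j ca cb g K
  have m2 := mul c' c j i ca' cb' (by rwa [add_comm]) (by rwa [add_comm])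
  have M3 := h.M3
  have cd := g.card
  simp at cd
  have e1 : c ∈ a :> b :> (rp i c + rp j c') := by
    obtain ⟨k, rfl⟩ : ∃ k, i = k + 1 := ⟨i - 1, by omega⟩
    simp
  have e2 : c' ∈ a :> b :> (rp i c + rp j c') := by
    obtain ⟨k, rfl⟩ : ∃ k, j = k + 1 := ⟨j - 1, by omega⟩
    simp
  have r1 : A.r c ≠ A.r c' := fun e => cc (A.inj (by rw [g.C.1 c e1, g.C.1 c' e2]) e)
  have p1 := r_pos (g.C.1 c e1)
  have p2 := r_pos (g.C.1 c' e2)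
  rcases (by omega : (i = 2 ∧ j = 1) ∨ (i = 1 ∧ j = 2) ∨ (i = 2 ∧ j = 2)) with ⟨rfl, rfl⟩ | ⟨rfl, rfl⟩ | ⟨rfl, rfl⟩
  · have e : a :> b :> (rp 2 c + rp 1 c') = c :> c :> a :> b :> c' :> 0 := by
      apply vec_inj; simp only [vec_cons, vec_add, vec_rep, vec_zero]; push_cast; module
    rw [e] at g K
    exact B21 h g K ca cb ca' cb' cc
  · have e : a :> b :> (rp 1 c + rp 2 c') = c' :> c' :> a :> b :> c :> 0 := by
      apply vec_inj; simp only [vec_cons, vec_add, vec_rep, vec_zero]; push_cast; module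
    rw [e] at g K
    exact B21 h g K ca' cb' ca cb cc.symm
  · rcases (by omega : 2 ≤ A.r c' ∨ 2 ≤ A.r c) with q | q
    · have e : a :> b :> (rp 2 c + rp 2 c') = c :> c :> a :> b :> c' :> c' :> 0 := by
        apply vec_inj; simp only [vec_cons, vec_add, vec_rep, vec_zero]; push_cast; module
      rw [e] at g K
      exact B22 h g K ca cb ca' cb' q
    · have e : a :> b :> (rp 2 c + rp 2 c') = c' :> c' :> a :> b :> c :> c :> 0 := by
        apply vec_inj; simp only [vec_cons, vec_add, vec_rep, vec_zero]; push_cast; module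
      rw [e] at g K
      exact B22 h g K ca' cb' ca cb q

theorem B2 (h : A.Ctx a b M) (g : A.Good a b M (a :> b :> W'))
    (K : A.K1 a b (a :> b :> W')) (aW : a ∉ W') : False := by
  have M3 := h.M3
  have cd := g.card
  have b3 : ∀ x ∈ W', ∀ y ∈ W', ∀ z ∈ W', x ≠ y → x ≠ z → y ≠ z → A.TL a b M W' x 1 → False := by
    rintro x hx y hy z hz xy xz yz ⟨U, t, rfl, t1, t2, t3, t4, -⟩
    exact B3 h g K aW (by simpa [xy.symm] using hy) (by simpa [xz.symm] using hz) xy xz yz t1 t2 t3 t4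
  have b4 : ∀ x ∈ W', ∀ y ∈ W', ∀ z ∈ W', x ≠ y → x ≠ z → y ≠ z → False := by
    intro x hx y hy z hz xy xz yz
    obtain ⟨i, i1, i2, T1⟩ := TLex h g hx
    obtain ⟨j, j1, j2, T2⟩ := TLex h g hy
    obtain ⟨k, k1, k2, T3⟩ := TLex h g hz
    have q1 : i ≠ j := by rintro rfl; exact xy (TLinj h g T1 T2)
    have q2 : i ≠ k := by rintro rfl; exact xz (TLinj h g T1 T3)
    have q3 : j ≠ k := by rintro rfl; exact yz (TLinj h g T2 T3)
    rcases (by omega : i = 1 ∨ j = 1 ∨ k = 1) with rfl | rfl | rfl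
    · exact b3 x hx y hy z hz xy xz yz T1
    · exact b3 y hy x hx z hz xy.symm yz xz T2
    · exact b3 z hz x hx y hy xz.symm yz.symm xy T3
  have caseb : ∀ c, c ≠ a → (∀ y ∈ W', y = b ∨ y = c) → False := by
    intro c ca hc
    obtain ⟨i, j, -, rfl⟩ := two_letters hc
    exact B2x h g K ca
  by_cases H : ∃ c ∈ W', c ≠ b
  · obtain ⟨c, hc, cb⟩ := H
    have ca : c ≠ a := by rintro rfl; exact aW hc
    by_cases H2 : ∃ c' ∈ W', c' ≠ b ∧ c' ≠ c
    · obtain ⟨c', hc', cb', cc⟩ := H2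
      have ca' : c' ≠ a := by rintro rfl; exact aW hc'
      obtain ⟨i, j, -, rfl⟩ := two_letters (m := W') (d := c) (f := c') (fun y hy => by
        by_contra hn
        push Not at hn
        exact b4 c hc c' hc' y hy cc.symm hn.1.symm hn.2.symm)
      exact B2y h g K ca cb ca' cb' cc.symm
    · push Not at H2
      exact caseb c ca fun y hy => by
        by_cases yb : y = b
        · exact Or.inl yb
        · exact Or.inr (H2 y hy yb)
  · push Not at H
    exact caseb b h.V.ne.symm fun y hy => Or.inl (H y hy)

theorem CaseB (h : A.Ctx a b M) (g : A.Good a b M W) (K : A.K1 a b W) : False := by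
  obtain ⟨W', rfl⟩ := two_of_mem g.am g.bm h.V.ne.symm
  by_cases aW : a ∈ W'
  · by_cases bW : b ∈ W'
    · obtain ⟨X, rfl⟩ := two_of_mem aW bW h.V.ne.symm
      rw [Multiset.cons_swap b a] at g K
      exact B1 h g K
    · rw [Multiset.cons_swap a b] at g K
      exact B2 h.symm g.symm K.symm bW
  · exact B2 h g K aW

def K2 (A : Sys R) (a b c : R) : Prop := c ≠ a ∧ c ≠ b ∧ A.II a c ∧ A.II b c ∧ ¬ A.II c a ∧ ¬ A.II c b

theorem CaseB' (h : A.Ctx a b M) (hi : 1 ≤ i) (hj : 1 ≤ j)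
    (ex : ∃ m, A.Cls a b M i j m) : ∃ W c, A.Cls a b M i j W ∧ A.Good a b M W ∧ c ∈ W ∧ A.K2 a b c := by
  obtain ⟨W, w1, g⟩ := good_ex h hi hj ex
  by_contra hn
  refine CaseB h g fun c hc ca cb => ?_
  rcases g.K h hc ca cb with k | k | k
  · exact ⟨a, Or.inl rfl, k⟩
  · exact ⟨b, Or.inr rfl, k⟩
  by_cases k1 : A.II c a
  · exact ⟨a, Or.inl rfl, k1⟩
  by_cases k2 : A.II c b
  · exact ⟨b, Or.inr rfl, k2⟩
  exact absurd ⟨W, c, w1, g, hc, ca, cb, k.1, k.2, k1, k2⟩ hn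


theorem Neg.le (h : A.Neg y m) (hm : ∀ x ∈ m, A.l x = 1) : A.r y ≤ m.card := A.r_le hm h

/-- the elements of a product of two arcs, with a general circuit through the second arc -/
theorem inv0 (lx : A.l x = 1) (lc : A.l c = 1) (xc : x ≠ c)
    (xH : ¬ A.Lam {x, c} (dl x)) (cH : ¬ A.Lam {x, c} (dl c)) (hx : ∀ m', A.Circ m' → c ∈ m' → m'.card = A.r c + 1 → x ∉ m')
    (hy : A.In2 y x c) (hm : ∀ z ∈ m, A.l z = 1) (cm : m.card = A.r c) (N : A.Neg y (x :> m)) :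
    A.l y = 2 ∧ (A.r y = A.r c ∨ A.r y = A.r c + 1) := by
  have r1 := r_pos lc
  have h1 := N.le (arcs_cons lx hm)
  simp only [Multiset.card_cons] at h1
  obtain ⟨m', q1, q2⟩ := hy.circ lx lc
  have h2 : A.r c ≤ A.r y := by
    have := q2.le c
    simp only [Multiset.card_cons] at this
    by_contra h'
    exact hx _ q2 bs (by simp only [Multiset.card_cons]; omega) bs
  rcases hy.lor lx lc oo with hl | hl
  · exfalso
    rcases (by omega : A.r y = A.r c ∨ A.r y = A.r c + 1) with e | e
    · obtain rfl := A.inj (hl.trans lc.symm) e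
      exact xH (c1 (-1) hy)
    · have C : A.Circ (y :> x :> m) := ⟨arcs_cons hl (arcs_cons lx hm), N.lam⟩
      rcases mmlet hl C bs (by simp only [Multiset.card_cons]; omega) (show x ∈ _ by simp) with rfl | e'
      · exact cH (c1 (-1) hy)
      · exact xc (A.inj (lx.trans lc.symm) oo)
  · exact ⟨hl, by omega⟩

theorem Ip (lx : A.l x = 1) (lc : A.l c = 1) (pc : A.PureL c) (xc : x ≠ c)
    (xH : ¬ A.Lam {x, c} (dl x)) (cH : ¬ A.Lam {x, c} (dl c)) (ii : A.II x c) (hy : A.In2 y x c) :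
    A.l y = 2 ∧ A.r y = A.r c + 1 := by
  have q := pc.q lc
  have r1 := r_pos lc
  obtain ⟨n, hn⟩ : ∃ n, A.r c = n + 1 := ⟨A.r c - 1, by omega⟩
  rw [hn] at q
  have N : A.Neg y (x :> rp (n + 1) c) := c3 1 hy 1 ii 1 q (by simp only [vec_cons, vec_rep]; push_cast; module)
  obtain ⟨e1, e2⟩ := inv0 lx lc xc xH cH (fun m' h1 h2 h3 h4 => xc (pc m' h1 h2 h3 x h4)) hy (arcs_rep lc) (by simp [hn]) N
  refine ⟨e1, e2.resolve_left fun e => cH (XB lx lc pc xc hy e1 e ii xH)⟩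

theorem Inv (lx : A.l x = 1) (lc : A.l c = 1) (r2 : 2 ≤ A.r x) (rc : 2 ≤ A.r c) (xc : x ≠ c)
    (xH : ¬ A.Lam {x, c} (dl x)) (ii : A.II x c) (ni : ¬ A.II c x) :
    (∀ y, A.In2 y x c → A.l y = 2 ∧ A.r y = A.r c + 1) ∨
    ∃ f, A.DD c f ∧ A.Lam {x, f} (dl x) ∧ ∀ y, A.In2 y x c → A.l y = 2 ∧ A.r y = A.r c := by
  have cH : ¬ A.Lam {x, c} (dl c) := fun h => ni (c1 2 h)
  rcases MM3 lc with p | ⟨f, hf⟩ | ⟨f, hf⟩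
  · exact Or.inl fun y hy => Ip lx lc p xc xH cH ii hy
  · left
    have rf := hf.1.2.1
    have lf := hf.1.1
    have q := hf.1.2.2.1.q lf
    have xf : x ≠ f := by
      rintro rfl
      have q4 : A.Lam {c} ((4 : ℤ) • dl c) := hf.dom.drop (U := {c, x}) (c2 2 hf.2 1 ii)
      have := rep_le (n := 4) lc (c1 1 q4) oo
      have h3 : A.r x = 2 := by omega
      rw [h3] at q
      have q5 : A.Lam {c, x} (tz • dl c) := c3 1 hf.2 1 q (-1) ii
      exact ni q5
    intro y hy
    obtain ⟨n, hn⟩ : ∃ n, A.r f = n + 1 := ⟨A.r f - 1, by omega⟩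
    rw [hn] at q
    have N : A.Neg y (x :> c :> rp (n + 1) f) := c4 1 hy 1 ii 1 q 1 hf.2 (by simp only [vec_cons, vec_rep]; push_cast; module)
    obtain ⟨e1, e2⟩ := inv0 lx lc xc xH cH (fun m' h1 h2 h3 h4 => (hf.1.2.2.2 m' h1 h2 h3 x h4).elim xc xf) hy
      (arcs_cons lc (arcs_rep lf)) (by simp; omega) N
    refine ⟨e1, e2.resolve_left fun e => ?_⟩
    have t0 : ∀ t, A.l t = 2 → A.r t = A.r c → A.In2 t c c → False := fun t t1 t2 t3 => by
      obtain rfl := A.inj (t1.trans e1.symm) (t2.trans e.symm)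
      have q : A.Lam {t, x, c} (dl x - dl c) := c2 (-1) hy 1 t3
      have q' : A.Lam {x, c} (dl x - dl c) := hy.dom.drop q
      exact ni (c2 1 ii (-2) q')
    have iif : A.II x f := by
      rcases hf.HC lc (S := {x}) (v := tz • dl x) OvC.out (c1 1 ii) with q | ⟨t, t1, t2, t3, -⟩
      · exact c1 1 q
      · exact (t0 t t1 t2 t3).elim
    have fH : ¬ A.Lam {x, f} (dl f) := fun h => by
      have : A.Lam (insert f {c, x}) (tz • dl c) := c2 1 hf.2 1 h
      exact ni ((hf.dom).drop this)
    have xH' : ¬ A.Lam {x, f} (dl x) := fun h => xH (hf.dom.drop (c1 1 h (T := {f, x, c})))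
    obtain ⟨w, hw⟩ := A.pick2 x f
    obtain ⟨w1, w2⟩ := Ip lx lf hf.1.2.2.1 xf xH' fH iif hw
    obtain rfl := A.inj (w1.trans e1.symm) oo
    have q' : A.Lam (insert f {x, c}) (dl c) := c2 (-1) (In2.canc hy.symm hw) 1 hf.2
    exact cH (hf.dom.drop q')
  · have rf := hf.1.2.1
    have lf := hf.1.1
    have q := hf.1.2.2.1.q lf
    have xf : x ≠ f := by rintro rfl; exact ni (c1 2 hf.2)
    obtain ⟨n, hn⟩ : ∃ n, A.r f = n + 1 := ⟨A.r f - 1, by omega⟩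
    rw [hn] at q
    have hx : ∀ m', A.Circ m' → c ∈ m' → m'.card = A.r c + 1 → x ∉ m' :=
      fun m' h1 h2 h3 h4 => (hf.1.2.2.2 m' h1 h2 h3 x h4).elim xc xf
    have N0 : ∀ y, A.In2 y x c → A.l y = 2 ∧ (A.r y = A.r c ∨ A.r y = A.r c + 1) := fun y hy => by
      have N' : A.Lam (insert c (insert y (lts (x :> rp (n + 2) f)))) (dl y + vec (x :> rp (n + 2) f)) :=
        c4 1 hy 1 ii 1 q 1 hf.2 (by simp only [vec_cons, vec_rep]; push_cast; module)
      have N : A.Neg y (x :> rp (n + 2) f) := hf.dom.drop N'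
      exact inv0 lx lc xc xH cH hx hy (arcs_rep lf) (by simp; omega) N
    by_cases xH' : A.Lam {x, f} (dl x)
    · right
      refine ⟨f, hf, xH', fun y hy => ?_⟩
      obtain ⟨e1, e2⟩ := N0 y hy
      refine ⟨e1, e2.resolve_right fun e => ?_⟩
      have dx : A.Dom x {f} := domk 0 (c1 1 xH')
      have N1 : A.Lam (insert c (insert x (insert y (lts (rp (n + 2) f))))) (dl y + vec (rp (n + 2) f)) :=
        c4 1 hy 1 q 1 hf.2 1 xH' (by simp only [vec_cons, vec_rep]; push_cast; module)
      have N2 : A.Lam (insert x (insert y (lts (rp (n + 2) f)))) (dl y + vec (rp (n + 2) f)) := hf.dom.drop N1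
      have N : A.Neg y (rp (n + 2) f) := dx.drop N2
      have := N.le (arcs_rep lf)
      simp at this; omega
    · left
      intro y hy
      obtain ⟨e1, e2⟩ := N0 y hy
      refine ⟨e1, e2.resolve_left fun e => ?_⟩
      have iif : A.II x f := hf.dom.drop (c1 1 ii (T := {c, x, f}))
      have fH : ¬ A.Lam {x, f} (dl f) := fun h => by
        have df : A.Dom f {x} := domk 0 (c1 1 h)
        have : A.Lam {c, x} (dl c) := df.drop (c1 1 hf.2 (T := {f, c, x}))
        exact cH (c1 1 this)
      obtain ⟨w, hw⟩ := A.pick2 x f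
      obtain ⟨w1, w2⟩ := Ip lx lf hf.1.2.2.1 xf xH' fH iif hw
      obtain rfl := A.inj (w1.trans e1.symm) oo
      have q' : A.Lam (insert c {x, f}) (dl f) := c2 (-1) (In2.canc hy.symm hw) 1 hf.2
      exact fH (hf.dom.drop q')


open Classical in
theorem dropA (q : A.Lam {b, c} (dl b)) (C : A.Circ W) (hc : c ∈ W) (cb : c ≠ b) :
    ∃ U, W = rp (W.count b) b + U ∧ A.Circ U ∧ ∀ x, x ≠ b → (x ∈ W → x ∈ U) ∧ U.count x = W.count x := by
  have e : W = rp (W.count b) b + W.filter (fun x => ¬ x = b) := by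
    have := Multiset.filter_add_not (fun x => x = b) W
    refine this.symm.trans ?_
    congr 1
    convert Multiset.filter_eq' W b
  have cU : c ∈ W.filter (fun x => ¬ x = b) := by simp [hc, cb]
  refine ⟨_, e, ⟨fun y hy => C.1 y (Multiset.mem_of_mem_filter hy), ?_⟩, fun x hx => ⟨fun h => by simp [h, hx], ?_⟩⟩
  · rw [e] at C
    have d : A.Dom b {c} := domk 0 (c1 1 q)
    have m1 : MemC c (lts (W.filter (fun x => ¬ x = b))) := ⟨cU⟩
    generalize W.filter (fun x => ¬ x = b) = U at *
    have : A.Lam (insert b (lts U)) (vec U) := c2 1 C.2 (-(W.count b : ℤ)) q (by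
      simp only [vec_add, vec_rep]; push_cast; module)
    exact d.drop this
  · rw [Multiset.count_filter, if_pos hx]

theorem acirc (C : A.Circ U) (ha : a ∈ U) (hc : c ∈ U) (ac : a ≠ c) :
    ∃ y, A.In2 y a c ∧ A.r y + 2 ≤ U.card := by
  obtain ⟨U', rfl⟩ := two_of_mem ha hc ac.symm
  obtain ⟨y, y1, y2, -, y3⟩ := C.split2
  exact ⟨y, y1, by simpa using y3⟩

open Classical in
def OI (A : Sys R) (a b c : R) (M : ℕ) (W : Multiset R) : Prop :=
  ¬ A.Lam {a, c} (dl a) ∧ A.Lam {b, c} (dl b) ∧ M = A.r c + 2 ∧ (∀ y, A.In2 y a c → A.l y = 2 ∧ A.r y = A.r c + 1) ∧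
    W.count b = 1 ∧ W.count a ≤ 2

theorem K2.symm (k : A.K2 a b c) : A.K2 b a c := ⟨k.2.1, k.1, k.2.2.2.1, k.2.2.1, k.2.2.2.2.2, k.2.2.2.2.1⟩

theorem K2.r2 (k : A.K2 a b c) (lc : A.l c = 1) : 2 ≤ A.r c := by
  by_contra h
  have := r_pos lc
  exact k.2.2.2.2.1 (c1 1 (two_q lc oo))

theorem DD.q (hf : A.DD c f) : A.Lam {f} ((A.r c : ℤ) • dl f) := by
  have := hf.1.2.2.1.q hf.1.1
  have h := hf.1.2.1
  rw [← h]; push_cast; exact this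

theorem outout (h : A.Ctx a b M) (g : A.Good a b M W) (hc : c ∈ W)
    (k : A.K2 a b c) (na : ¬ A.Lam {a, c} (dl a)) (nb : ¬ A.Lam {b, c} (dl b)) : False := by
  have la := h.V.la
  have lb := h.V.lb
  have lc := g.C.1 c hc
  have rc := k.r2 lc
  have cd := g.card
  obtain ⟨ca, cb, ia, ib, nia, nib⟩ := k
  have f1 := g.f1 c hc ca cb
  have f1' := g.f1' c hc ca cb
  obtain ⟨z, z1, z2, z3⟩ := h.V.zz h.hM
  obtain ⟨ya, ya1, ya2⟩ := acirc g.C g.am hc ca.symm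
  obtain ⟨yb, yb1, yb2⟩ := acirc g.C g.bm hc cb.symm
  have mixed : ∀ a b, A.Ctx a b M → A.II b c → A.In2 z a b → c ≠ a → (¬ A.Lam {c, a, b} (dl c - dl a)) →
      (∀ y, A.In2 y b c → A.l y = 2 ∧ A.r y = A.r c + 1) → (∃ y, A.In2 y b c ∧ A.r y + 2 ≤ W.card) →
      (∃ f, A.DD c f ∧ A.Lam {a, f} (dl a)) → False := by
    rintro a b h ib z1 ca f1 I2 ⟨yb, yb1, yb2⟩ ⟨f, hf, af⟩
    have lf := hf.1.1
    obtain ⟨e1, e2⟩ := I2 yb yb1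
    have da : A.Dom a {f} := domk 0 (c1 1 af)
    have q := hf.q
    obtain ⟨n, hn⟩ : ∃ n, A.r c = n + 1 := ⟨A.r c - 1, by omega⟩
    rw [hn] at q
    have N1 : A.Lam (insert c (insert a (insert z (lts (b :> rp (n + 1) f))))) (dl z + vec (b :> rp (n + 1) f)) :=
      c4 1 z1 1 ib 1 q 1 af (by simp only [vec_cons, vec_rep]; push_cast; module)
    have N2 : A.Lam (insert a (insert z (lts (b :> rp (n + 1) f)))) (dl z + vec (b :> rp (n + 1) f)) := hf.dom.drop N1
    have N : A.Neg z (b :> rp (n + 1) f) := da.drop N2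
    have := N.le (arcs_cons h.V.lb (arcs_rep lf))
    simp at this
    obtain rfl := A.inj (e1.trans z2.symm) oo
    exact f1 (c1 (-1) (In2.canc z1 yb1))
  rcases Inv la lc h.V.r2 rc ca.symm na ia nia with I1 | ⟨f, hf, af, I1⟩ <;>
  rcases Inv lb lc h.V.symm.r2 rc cb.symm nb ib nib with I2 | ⟨f', hf', bf, I2⟩
  · obtain ⟨e1, e2⟩ := I1 ya ya1
    obtain ⟨e3, e4⟩ := I2 yb yb1
    obtain rfl := A.inj (e1.trans e3.symm) (e2.trans e4.symm)
    have E : A.Lam {a, b, c} (dl a - dl b) := c1 1 (In2.canc ya1 yb1.symm)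
    obtain ⟨m, m1, m2⟩ := arc_circ lc
    have C : A.Circ (a :> b :> c :> m) := ⟨arcs_cons la (arcs_cons lb m2.1), c3 (-1) E 1 ia 1 m2.2 (by
      simp only [vec_cons]; module)⟩
    have := h.lose C bs bs
    simp only [Multiset.card_cons] at this
    obtain rfl := A.inj (e1.trans z2.symm) oo
    exact f1' (c1 (-1) (In2.canc z1.symm ya1))
  · exact mixed b a h.symm ia z1.symm cb (fun q => f1' (c1 1 q)) I1 ⟨ya, ya1, ya2⟩ ⟨f', hf', bf⟩
  · exact mixed a b h ib z1 ca f1 I2 ⟨yb, yb1, yb2⟩ ⟨f, hf, af⟩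
  · have : f' = f := A.inj (by rw [hf.1.1, hf'.1.1]) (by have := hf.1.2.1; have := hf'.1.2.1; omega)
    subst this
    have lf := hf.1.1
    obtain ⟨e1, e2⟩ := I1 ya ya1
    have da : A.Dom a {f'} := domk 0 (c1 1 af)
    have db : A.Dom b {f'} := domk 0 (c1 1 bf)
    have q := hf.q
    obtain ⟨n, hn⟩ : ∃ n, A.r c = n + 1 := ⟨A.r c - 1, by omega⟩
    rw [hn] at q
    have N1 : A.Lam (insert b (insert a (insert z (lts (rp (n + 1) f'))))) (dl z + vec (rp (n + 1) f')) :=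
      c4 1 z1 1 bf 1 q 1 af (by simp only [vec_cons, vec_rep]; push_cast; module)
    have N2 : A.Lam (insert a (insert z (lts (rp (n + 1) f')))) (dl z + vec (rp (n + 1) f')) := db.drop N1
    have N : A.Neg z (rp (n + 1) f') := da.drop N2
    have := N.le (arcs_rep lf)
    simp at this
    obtain rfl := A.inj (e1.trans z2.symm) oo
    exact f1' (c1 (-1) (In2.canc z1.symm ya1))

theorem outin (h : A.Ctx a b M) (g : A.Good a b M W) (hc : c ∈ W)
    (k : A.K2 a b c) (na : ¬ A.Lam {a, c} (dl a)) (nb : A.Lam {b, c} (dl b)) : A.OI a b c M W := by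
  classical
  have la := h.V.la
  have lb := h.V.lb
  have lc := g.C.1 c hc
  have rc := k.r2 lc
  have cd := g.card
  obtain ⟨ca, cb, ia, ib, nia, nib⟩ := k
  obtain ⟨z, z1, z2, z3⟩ := h.V.zz h.hM
  have db : A.Dom b {c} := domk 0 (c1 1 nb)
  obtain ⟨U, eU, CU, hU⟩ := dropA nb g.C hc cb
  have cU := (hU c cb).1 hc
  have aU := (hU a h.V.ne).1 g.am
  obtain ⟨y, y1, y2⟩ := acirc CU aU cU ca.symm
  have e1 := congrArg Multiset.card eU
  rw [Multiset.card_add, Multiset.card_replicate] at e1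
  have jb : 1 ≤ W.count b := Multiset.one_le_count_iff_mem.2 g.bm
  rcases Inv la lc h.V.r2 rc ca.symm na ia nia with I1 | ⟨f, hf, af, I1⟩
  · obtain ⟨m, m1, m2⟩ := arc_circ lc
    have C : A.Circ (a :> a :> b :> c :> m) := ⟨arcs_cons la (arcs_cons la (arcs_cons lb m2.1)),
      c3 1 nb 1 ia 1 m2.2 (by simp only [vec_cons]; module)⟩
    have l1 := h.lose C bs bs
    simp only [Multiset.card_cons] at l1
    obtain ⟨q1, q2⟩ := I1 y y1
    refine ⟨na, nb, by omega, I1, by omega, ?_⟩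
    by_contra hn
    have : (a :> a :> a :> 0) ≤ U := by
      have := Multiset.le_count_iff_replicate_le.1 (show 3 ≤ U.count a by rw [(hU a h.V.ne).2]; omega)
      exact this
    obtain ⟨X, rfl⟩ := Multiset.le_iff_exists_add.1 this
    have cX : c ∈ X := by simpa [ca] using cU
    have mX : MemC c (lts X) := ⟨cX⟩
    have C' : A.Circ (a :> X) := ⟨CU.arcs, c2 1 CU.2 (-1) ia (by simp only [vec_cons, vec_add, vec_zero]; module)⟩
    obtain ⟨y', y1', y2'⟩ := acirc C' (show a ∈ _ by simp) (show c ∈ _ by simp [cX]) ca.symm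
    obtain ⟨q1', q2'⟩ := I1 y' y1'
    simp at y2' e1
    omega
  · exfalso
    obtain ⟨q1, q2⟩ := I1 y y1
    have lf := hf.1.1
    have da : A.Dom a {f} := domk 0 (c1 1 af)
    have q := hf.q
    obtain ⟨n, hn⟩ : ∃ n, A.r c = n + 1 := ⟨A.r c - 1, by omega⟩
    rw [hn] at q
    have N0 : A.Lam (insert b (insert c (insert a (insert z (lts (rp (n + 1) f)))))) (dl z + vec (rp (n + 1) f)) :=
      c4 1 z1 1 nb 1 q 1 af (by simp only [vec_cons, vec_rep]; push_cast; module)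
    have N1 : A.Lam (insert c (insert a (insert z (lts (rp (n + 1) f))))) (dl z + vec (rp (n + 1) f)) := db.drop N0
    have N2 : A.Lam (insert a (insert z (lts (rp (n + 1) f)))) (dl z + vec (rp (n + 1) f)) := hf.dom.drop N1
    have N : A.Neg z (rp (n + 1) f) := da.drop N2
    have := N.le (arcs_rep lf)
    simp at this
    omega

open Classical in
theorem inin (h : A.Ctx a b M) (g : A.Good a b M W) (hc : c ∈ W)
    (k : A.K2 a b c) (na : A.Lam {a, c} (dl a)) (nb : A.Lam {b, c} (dl b)) :
    M = A.r c + 1 ∧ W.count a = 1 ∧ W.count b = 1 := by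
  have lc := g.C.1 c hc
  have cd := g.card
  obtain ⟨ca, cb, ia, ib, nia, nib⟩ := k
  obtain ⟨U, eU, CU, hU⟩ := dropA nb g.C hc cb
  have cU := (hU c cb).1 hc
  obtain ⟨X, eX, CX, hX⟩ := dropA na CU cU ca
  have cX := (hX c ca).1 cU
  rw [(hU a h.V.ne).2] at eX
  have e1 := congrArg Multiset.card eU
  rw [Multiset.card_add, Multiset.card_replicate] at e1
  have e2 := congrArg Multiset.card eX
  rw [Multiset.card_add, Multiset.card_replicate] at e2
  have jb : 1 ≤ W.count b := Multiset.one_le_count_iff_mem.2 g.bm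
  have ja : 1 ≤ W.count a := Multiset.one_le_count_iff_mem.2 g.am
  have := CX.le c (ha := ⟨cX⟩)
  obtain ⟨m, m1, m2⟩ := arc_circ lc
  have C : A.Circ (a :> b :> c :> m) := ⟨arcs_cons h.V.la (arcs_cons h.V.lb m2.1),
      c3 1 nb 1 na 1 m2.2 (by simp only [vec_cons]; module)⟩
  have l1 := h.lose C bs bs
  simp only [Multiset.card_cons] at l1
  exact ⟨by omega, by omega, by omega⟩

open Classical in
theorem KS (h : A.Ctx a b M) (g : A.Good a b M W) (hc : c ∈ W)
    (k : A.K2 a b c) : (A.Lam {a, c} (dl a) ∧ A.Lam {b, c} (dl b) ∧ M = A.r c + 1 ∧ W.count a = 1 ∧ W.count b = 1) ∨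
      A.OI a b c M W ∨ A.OI b a c M W := by
  by_cases na : A.Lam {a, c} (dl a) <;> by_cases nb : A.Lam {b, c} (dl b)
  · exact Or.inl ⟨na, nb, inin h g hc k na nb⟩
  · exact Or.inr (Or.inr (outin h.symm g.symm hc k.symm nb na))
  · exact Or.inr (Or.inl (outin h g hc k na nb))
  · exact (outout h g hc k na nb).elim


theorem CL (h : A.Ctx a b M) (hi : 1 ≤ i) (hj : 1 ≤ j) (hij : 4 ≤ i + j)
    (ex : ∃ m, A.Cls a b M i j m) : False := by
  obtain ⟨W, c, w, g, hc, k⟩ := CaseB' h hi hj ex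
  have w1 := w.2.2.1
  have w2 := w.2.2.2
  rcases KS h g hc k with ⟨-, -, -, k1, k2⟩ | ⟨-, -, -, -, k1, k2⟩ | ⟨-, -, -, -, k1, k2⟩ <;> omega

def Ex (A : Sys R) (a b x : R) (i j : ℕ) : Prop := A.Lam {x, a, b} (dl x - (i : ℤ) • dl a - (j : ℤ) • dl b)

theorem Ex.dom (h : A.Ex a b x i j) : A.Dom x {a, b} :=
  domk ((i : ℤ) • dl a + (j : ℤ) • dl b) (c1 1 h)

theorem Ex.symm (h : A.Ex a b x i j) : A.Ex b a x j i := c1 1 h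

theorem Ex.low (h : A.Ctx a b M) (e : A.Ex a b x (i + 1) (j + 1)) :
    M ≤ i + j + A.r x ∧ A.l x ≤ i + j + 2 ∧ (1 ≤ A.r x → 1 ≤ A.l x) ∧
      (i + j + A.r x = M → ∃ m, A.Cls a b M (i + 1) (j + 1) m) := by
  have ar : ∀ y ∈ rp (i + 1) a + rp (j + 1) b, A.l y = 1 := arcs_add (arcs_rep h.V.la) (arcs_rep h.V.lb)
  have h' : A.In x (rp (i + 1) a + rp (j + 1) b) := c1 1 e (by simp only [vec_add, vec_rep]; push_cast; module)
  obtain ⟨m, m1, m2, -⟩ := h'.circ ar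
  have l1 := h.lose m2 bs bs
  have l2 := A.l_le ar h'
  simp only [Multiset.card_add, Multiset.card_replicate] at l1 l2
  refine ⟨by omega, by omega, fun h1 => ?_, fun h1 => ⟨_, m2, ?_, ?_, ?_⟩⟩
  · by_contra h2
    have := (l_zero (show A.l x = 0 by omega)).2
    omega
  · simp only [Multiset.card_add, Multiset.card_replicate]; omega
  · simp only [Multiset.count_add, Multiset.count_replicate_self]; omega
  · simp only [Multiset.count_add, Multiset.count_replicate_self]; omega

theorem Ex.coll (e : A.Ex a b x i j) (e' : A.Ex a b y i' j') (l : A.l x = A.l y)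
    (r : A.r x = A.r y) : A.Lam {a, b} (((i : ℤ) - i') • dl a + ((j : ℤ) - j') • dl b) := by
  obtain rfl := A.inj l r
  have : A.Lam {x, a, b} (((i : ℤ) - i') • dl a + ((j : ℤ) - j') • dl b) := c2 (-1) e 1 e'
  exact e.dom.drop this

theorem ex_pick (a b : R) (i j : ℕ) : ∃ x, A.Ex a b x i j := by
  obtain ⟨x, h⟩ := A.pick {a, b} ((i : ℤ) • dl a + (j : ℤ) • dl b)
  exact ⟨x, c1 1 h⟩

theorem fin (l r n : ℕ) (h1 : 1 ≤ l) (h2 : l ≤ 4) (h3 : n ≤ r) (h4 : r ≠ n) (h5 : 1 ≤ r) (h6 : r ≤ n + 2)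
    (n1 : ¬ (l = 1 ∧ r = n + 2)) (n2 : ¬ (l = 2 ∧ r = n + 1)) (n3 : ¬ (l = 3 ∧ r = n + 1))
    (n4 : ¬ (l = 4 ∧ r = n + 1)) (n5 : ¬ (l = 2 ∧ r = n + 2)) (n6 : ¬ (l = 3 ∧ r = n + 2)) :
    (l = 1 ∧ r = n + 1) ∨ (l = 4 ∧ r = n + 2) := by
  obtain rfl | rfl : r = n + 1 ∨ r = n + 2 := by omega
  all_goals interval_cases l <;> simp_all

set_option maxHeartbeats 1000000 in
theorem case1 (h : A.Ctx a b M) (g : A.Good a b M W) (hc : c ∈ W)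
    (k : A.K2 a b c) (o : A.OI a b c M W) : False := by
  have la := h.V.la
  have lb := h.V.lb
  have lc := g.C.1 c hc
  have rc := k.r2 lc
  obtain ⟨na, nb, hM, I1, -, -⟩ := o
  obtain ⟨ca, cb, ia, ib, nia, nib⟩ := k
  have f2 := g.f2 h hc ca cb
  have db : A.Dom b {c} := domk 0 (c1 1 nb)
  have cls12 : (∃ m, A.Cls a b M 1 2 m) → False := fun ex => by
    obtain ⟨W, c', w, g, hc', k⟩ := CaseB' h oo oo ex
    have w2 := w.2.2.2
    rcases KS h g hc' k with ⟨-, -, -, k1, k2⟩ | ⟨-, -, -, -, k1, k2⟩ | ⟨-, k0, k3, -, k1, k2⟩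
    · omega
    · omega
    · obtain rfl := A.inj ((g.C.1 c' hc').trans lc.symm) oo
      exact na k0
  obtain ⟨m, m1, m2⟩ := arc_circ lc
  have up0 : ∀ x, A.Lam {x, c} (dl x) → A.r x ≤ A.r c + 1 := fun x hx => by
    have N : A.Neg x (c :> m) := c2 1 hx 1 m2.2
    have := N.le m2.1
    simp only [Multiset.card_cons] at this; omega
  have upA : ∀ x, A.Lam {x, a, b, c} (dl x + dl a) → A.r x ≤ A.r c + 2 ∧ ¬ (A.l x = 1 ∧ A.r x = A.r c + 2) := fun x hx => by
    have N0 : A.Lam (insert b (insert x (lts (a :> c :> m)))) (dl x + vec (a :> c :> m)) :=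
      c2 1 hx 1 m2.2 (by simp only [vec_cons]; module)
    have N : A.Neg x (a :> c :> m) := db.drop N0
    have q := N.le (arcs_cons la m2.1)
    simp only [Multiset.card_cons] at q
    refine ⟨by omega, fun ⟨lx, rx⟩ => ?_⟩
    have C : A.Circ (x :> a :> c :> m) := ⟨arcs_cons lx (arcs_cons la m2.1), N.lam⟩
    rcases mmlet lx C bs (by simp only [Multiset.card_cons]; omega) (show c ∈ _ by simp) with rfl | e
    · omega
    · omega
  obtain ⟨y0, y1⟩ := A.pick2 a c
  obtain ⟨y2, y3⟩ := I1 y0 y1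
  have isY : ∀ x, A.l x = 2 → A.r x = A.r c + 1 → A.In2 x a c := fun x h1 h2 => by
    rw [A.inj (h1.trans y2.symm) (h2.trans y3.symm)]; exact y1
  have notY : ∀ x, A.l x = 2 → A.r x = A.r c + 1 → A.Lam {x, c} (dl x) → False := fun x h1 h2 h3 => by
    have d : A.Dom x {c} := domk 0 (c1 1 h3)
    have : A.Lam (insert x {a, c}) (dl a + dl c) := c2 (-1) (isY x h1 h2) 1 h3
    exact two2 la lc h.V.r2 (d.drop this)
  have excl1 : ∀ g i j, A.l g = 1 → A.r g = A.r c + 1 → A.Ex a b g i j → A.Lam {g, c} (dl g) → b ≠ g → False :=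
      fun g i j lg rg e hg bg => by
    obtain ⟨w, hw⟩ := A.pick2 b g
    have dg : A.Dom g {c} := domk 0 (c1 1 hg)
    have q0 : A.Lam {b, g, w, c} (dl w) := c3 1 hw 1 nb 1 hg
    have q1 : A.Lam {g, w, c} (dl w) := db.drop q0
    have q2 : A.Lam {w, c} (dl w) := dg.drop q1
    have u := up0 w q2
    have bd := hw.bd lb lg
    by_cases e1 : A.r w = A.r c
    · obtain ⟨m, p1, p2⟩ := hw.circ lb lg
      rcases mmlet lg p2 bs (by simp only [Multiset.card_cons]; omega) (show b ∈ _ by simp) with e2 | e2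
      · exact bg e2
      · exact cb (A.inj (lc.trans lb.symm) oo)
    · have e2 : A.r w = A.r c + 1 := by omega
      rcases hw.lor lb lg oo with e3 | e3
      · obtain rfl := A.inj (e3.trans lg.symm) (e2.trans rg.symm)
        have q : A.Lam {w, a, b} (dl b) := c1 (-1) hw
        exact h.V.nb (e.dom.drop q)
      · exact notY w e3 e2 q2
  obtain ⟨z, z1, z2, z3⟩ := h.V.zz h.hM
  have ze : A.Ex a b z 1 1 := c1 1 z1
  have s0 : A.Lam {a, b, c} (tz • dl a + dl b) := c2 1 ia 1 nb
  obtain ⟨x0, x1, x2⟩ := split {a, b} {c} (tz • dl a + dl b) 0 s0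
  have xe : A.Ex a b x0 2 1 := c1 1 x1
  have x3 : A.Lam {x0, c} (dl x0) := c1 1 x2
  have x4 := up0 x0 x3
  have x5 := Ex.low (i := 1) (j := 0) h xe
  have rx : A.r x0 = A.r c + 1 := by omega
  have lx : A.l x0 = 3 := by
    have : A.l x0 = 1 ∨ A.l x0 = 2 ∨ A.l x0 = 3 := by omega
    rcases this with e | e | e
    · refine (excl1 x0 2 1 e rx xe x3 fun e => ?_).elim
      subst e
      have q : A.Lam {a, b} (tz • dl a) := c1 (-1) xe
      exact h.V.i1 q
    · exact (notY x0 e rx x3).elim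
    · exact e
  obtain ⟨y, ye⟩ := A.ex_pick a b 1 2
  have y5 := Ex.low (i := 0) (j := 1) h ye
  have y6 := upA y (c3 1 ye 1 ia 2 nb)
  have ry : A.r y = A.r c + 2 := by
    have : A.r y ≠ A.r c + 1 := fun e => cls12 (y5.2.2.2 oo)
    omega
  have ly : A.l y = 3 := by
    have : A.l y = 1 ∨ A.l y = 2 ∨ A.l y = 3 := by omega
    rcases this with e | e | e
    · exact (y6.2 ⟨e, ry⟩).elim
    · exact (h.V.nb (c1 1 (ye.coll ze oo oo))).elim
    · exact e
  have s2 : A.Lam {a, b, c} (tz • dl a + tz • dl b) := c2 1 ia 2 nb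
  obtain ⟨w, w1, w2⟩ := split {a, b} {c} (tz • dl a + tz • dl b) 0 s2
  have we : A.Ex a b w 2 2 := c1 1 w1
  have w3 : A.Lam {w, c} (dl w) := c1 1 w2
  have w4 := up0 w w3
  have w5 := Ex.low (i := 1) (j := 1) h we
  have rw' : A.r w = A.r c + 1 := by
    have : A.r w ≠ A.r c := fun e => CL h oo oo oo (w5.2.2.2 oo)
    omega
  have lw : A.l w = 4 := by
    have : A.l w = 1 ∨ A.l w = 2 ∨ A.l w = 3 ∨ A.l w = 4 := by omega
    rcases this with e | e | e | e
    · refine (excl1 w 2 2 e rw' we w3 fun e => ?_).elim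
      subst e
      have q : A.Lam {a, b} (tz • dl a + (1 : ℤ) • dl b) := c1 (-1) we
      exact h.V.P h.hM _ q
    · exact (notY w e rw' w3).elim
    · exact (h.V.nb (c1 1 (we.coll xe oo oo))).elim
    · exact e
  have tw : ∀ x i j, A.Ex a b x i j → A.l x = 2 → A.r x = A.r c + 1 →
      A.Lam {c, a, b} (dl c - ((i : ℤ) - 1) • dl a - (j : ℤ) • dl b) := fun x i j e e1 e2 => by
    have q : A.Lam {x, c, a, b} (dl c - ((i : ℤ) - 1) • dl a - (j : ℤ) • dl b) := c2 1 e (-1) (isY x e1 e2)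
    exact e.dom.drop q
  have K1 : ∀ x, A.Ex a b x 3 1 → (A.l x = 1 ∧ A.r x = A.r c + 1) ∨ (A.l x = 4 ∧ A.r x = A.r c + 2) := fun x e => by
    have b1 := Ex.low (i := 2) (j := 0) h e
    have b2 := upA x (c3 1 e 2 ia 1 nb)
    have b0 : 1 ≤ A.l x ∧ A.l x ≤ 4 ∧ A.r c ≤ A.r x ∧ 1 ≤ A.r x := by omega
    have b3 : A.r x ≠ A.r c := fun e => CL h oo oo oo (b1.2.2.2 oo)
    have b4 : ¬ (A.l x = 2 ∧ A.r x = A.r c + 1) := fun e1 => f2 (c3 1 (tw x 3 1 e e1.1 e1.2) 1 ia 1 nb)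
    have b5 : ¬ (A.l x = 3 ∧ A.r x = A.r c + 1) := fun e1 => h.V.na (c1 1 (e.coll xe oo oo))
    have b6 : ¬ (A.l x = 4 ∧ A.r x = A.r c + 1) := fun e1 => h.V.ne (A.sep (c1 1 (e.coll we oo oo)))
    have b7 : ¬ (A.l x = 2 ∧ A.r x = A.r c + 2) := fun e1 => h.V.i1 (c1 1 (e.coll ze oo oo))
    have b8 : ¬ (A.l x = 3 ∧ A.r x = A.r c + 2) := fun e1 => h.V.s1 (c1 1 (e.coll ye oo oo))
    exact fin _ _ _ b0.1 b0.2.1 b0.2.2.1 b3 b0.2.2.2 b2.1 b2.2 b4 b5 b6 b7 b8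
  have K3 : ∀ x, A.Ex a b x 1 3 → (A.l x = 1 ∧ A.r x = A.r c + 1) ∨ (A.l x = 4 ∧ A.r x = A.r c + 2) := fun x e => by
    have b1 := Ex.low (i := 0) (j := 2) h e
    have b2 := upA x (c3 1 e 1 ia 3 nb)
    have b0 : 1 ≤ A.l x ∧ A.l x ≤ 4 ∧ A.r c ≤ A.r x ∧ 1 ≤ A.r x := by omega
    have b3 : A.r x ≠ A.r c := fun e => CL h oo oo oo (b1.2.2.2 oo)
    have b4 : ¬ (A.l x = 2 ∧ A.r x = A.r c + 1) := fun e1 => f2 (c2 1 (tw x 1 3 e e1.1 e1.2) 3 nb)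
    have b5 : ¬ (A.l x = 3 ∧ A.r x = A.r c + 1) := fun e1 => h.V.s2 (c1 1 (e.coll xe oo oo))
    have b6 : ¬ (A.l x = 4 ∧ A.r x = A.r c + 1) := fun e1 => h.V.ne (A.sep (c1 (-1) (e.coll we oo oo)))
    have b7 : ¬ (A.l x = 2 ∧ A.r x = A.r c + 2) := fun e1 => h.V.i2 (c1 1 (e.coll ze oo oo))
    have b8 : ¬ (A.l x = 3 ∧ A.r x = A.r c + 2) := fun e1 => h.V.nb (c1 1 (e.coll ye oo oo))
    exact fin _ _ _ b0.1 b0.2.1 b0.2.2.1 b3 b0.2.2.2 b2.1 b2.2 b4 b5 b6 b7 b8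
  have NP : ∀ x x', A.Ex a b x 3 1 → A.Ex a b x' 1 3 → A.l x = A.l x' → A.r x = A.r x' → False := fun x x' e e' e1 e2 =>
    h.V.P h.hM (-2) (c1 1 (e.coll e' e1 e2))
  have core : ∀ k, A.l k = 1 → A.r k = A.r c + 1 → (A.Ex a b k 3 1 ∨ A.Ex a b k 1 3) → False := fun k lk rk ek => by
    have ka0 : A.Lam {b, k, a, c} (dl k - dl a) := by
      rcases ek with e | e
      · exact c3 1 e 1 ia 1 nb
      · exact c2 1 e 3 nb
    have ka : A.Lam {k, a, c} (dl k - dl a) := db.drop ka0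
    have dk' : A.Dom k {a, c} := domk (dl a) ka
    have dk : A.Dom k {a, b} := ek.elim (fun e => e.dom) (fun e => e.dom)
    have pk : A.PureL k := by
      rcases MM3 lk with p | ⟨f, p⟩ | ⟨f, p⟩
      · exact p
      · obtain rfl := A.inj (p.1.1.trans lc.symm) (show A.r f = A.r c by have := p.1.2.1; omega)
        have q : A.Lam {k, f, a} (tz • dl f) := c3 (-2) p.2 4 ka 2 ia
        exact (nia (dk'.drop q)).elim
      · obtain rfl := A.inj (p.1.1.trans lc.symm) (show A.r f = A.r c by have := p.1.2.1; omega)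
        have q : A.Lam {k, a, f} (dl a) := c2 1 p.2 (-1) ka
        exact (na (dk'.drop q)).elim
    obtain ⟨u, hu⟩ := A.pick2 k b
    have bd := hu.bd lk lb
    have n1 : A.r u ≠ A.r c := fun e1 => by
      obtain ⟨m, p1, p2⟩ := hu.circ lk lb
      have := pk _ p2 bs (by simp only [Multiset.card_cons]; omega) b bs
      subst this
      have q : A.Lam {b, a, c} (dl a) := c2 (-1) ka 1 nb
      exact na (db.drop q)
    have q : A.Lam {k, u, a, b, c} (dl u + dl a) := c4 1 hu 1 ka 1 ia 1 nb
    have b2 := upA u (dk'.drop q)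
    have b4 : ¬ (A.l u = 2 ∧ A.r u = A.r c + 1) := fun e1 => by
      have q : A.Lam {u, k, c, a, b} (dl c) := c4 1 hu (-1) (isY u e1.1 e1.2) 1 ka 1 nb
      have q1 : A.Lam {k, c, a, b} (dl c) := hu.dom.drop q
      exact f2 (dk'.drop q1)
    have b5 : ¬ (A.l u = 1 ∧ A.r u = A.r c + 1) := fun e1 => by
      obtain rfl := A.inj (e1.1.trans lk.symm) (e1.2.trans rk.symm)
      have q : A.Lam {u, a, b} (dl b) := c1 (-1) hu
      exact h.V.nb (dk.drop q)
    have e4 : A.l u = 2 ∧ A.r u = A.r c + 2 := by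
      rcases hu.lor lk lb oo with e | e <;> omega
    obtain rfl := A.inj (e4.1.trans z2.symm) (show A.r u = A.r z by omega)
    have q : A.Lam {u, k, a, b} (dl k - dl a) := c2 (-1) hu 1 z1
    have be : A.Lam {k, a, b} (dl k - dl a) := z1.dom.drop q
    rcases ek with e | e
    · have q : A.Lam {k, a, b} (tz • dl a + (1 : ℤ) • dl b) := c2 (-1) e 1 be
      exact h.V.P h.hM _ (dk.drop q)
    · obtain ⟨n, hn⟩ : ∃ n, A.r c = n + 2 := ⟨A.r c - 2, by omega⟩
      have t0 : A.Lam {k, a, b} ((3 : ℤ) • dl b) := c2 (-1) e 1 be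
      have pq := pk.q lk
      rw [rk, hn] at pq
      have t1 : A.Lam {k, a, b} (((n : ℤ) + 4) • dl a + (3 : ℤ) • dl b) := c3 1 pq (-((n : ℤ) + 4)) be 1 t0
      have t2 : A.Lam {a, b} (((n : ℤ) + 4) • dl a + (3 : ℤ) • dl b) := dk.drop t1
      obtain ⟨x, p1, p2⟩ := split {a, b} {a, b} ((3 : ℤ) • dl a + dl b) (((n : ℤ) + 1) • dl a + tz • dl b) t2
      have p3 : A.Ex a b x 3 1 := c1 1 p1
      have N : A.Neg x (rp (n + 1) a + rp 2 b) := c1 1 p2 (by simp only [vec_add, vec_rep]; push_cast; module)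
      have le := N.le (arcs_add (arcs_rep la) (arcs_rep lb))
      simp only [Multiset.card_add, Multiset.card_replicate] at le
      have := K1 x p3
      exact NP x k p3 e oo oo
  obtain ⟨p, pe⟩ := A.ex_pick a b 3 1
  obtain ⟨p', pe'⟩ := A.ex_pick a b 1 3
  rcases K1 p pe with e | e
  · exact core p e.1 e.2 (Or.inl pe)
  · rcases K3 p' pe' with e' | e'
    · exact core p' e'.1 e'.2 (Or.inr pe')
    · exact NP p p' pe pe' oo oo


theorem noCls (h : A.Ctx a b M) (hi : 1 ≤ i) (hj : 1 ≤ j) (hij : 3 ≤ i + j)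
    (ex : ∃ m, A.Cls a b M i j m) : False := by
  obtain ⟨W, c, w, g, hc, k⟩ := CaseB' h hi hj ex
  have w1 := w.2.2.1
  have w2 := w.2.2.2
  rcases KS h g hc k with ⟨-, -, -, k1, k2⟩ | o | o
  · omega
  · exact case1 h g hc k o
  · exact case1 h.symm g.symm hc k.symm o

theorem case2b (h : A.Ctx a b M) (lc : A.l c = 1) (ca : c ≠ a)
    (ha : A.Lam {a, c} (dl a)) (hb : A.Lam {b, c} (dl b)) (hM : M = A.r c + 1) (e : A.Ex a b x 2 1) :
    A.l x = 3 ∧ A.r x = A.r c + 1 := by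
  have la := h.V.la
  have lb := h.V.lb
  have da : A.Dom a {c} := domk 0 (c1 1 ha)
  have db : A.Dom b {c} := domk 0 (c1 1 hb)
  obtain ⟨m, m1, m2⟩ := arc_circ lc
  have up0 : ∀ x, A.Lam {x, c} (dl x) → A.r x ≤ A.r c + 1 := fun x hx => by
    have N : A.Neg x (c :> m) := c2 1 hx 1 m2.2
    have := N.le m2.1
    simp only [Multiset.card_cons] at this; omega
  obtain ⟨z, z1, z2, z3⟩ := h.V.zz h.hM
  have ze : A.Ex a b z 1 1 := c1 1 z1
  have q0 : A.Lam {a, b, x, c} (dl x) := c3 1 e 2 ha 1 hb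
  have q1 : A.Lam {b, x, c} (dl x) := da.drop q0
  have hx : A.Lam {x, c} (dl x) := db.drop q1
  have u := up0 x hx
  have lo := Ex.low (i := 1) (j := 0) h e
  have n1 : A.r x ≠ A.r c := fun e => noCls h oo oo oo (lo.2.2.2 oo)
  have rx : A.r x = A.r c + 1 := by omega
  refine ⟨?_, rx⟩
  have : A.l x = 1 ∨ A.l x = 2 ∨ A.l x = 3 := by omega
  rcases this with lx | lx | lx
  · exfalso
    obtain ⟨w, hw⟩ := A.pick2 a x
    have dx : A.Dom x {c} := domk 0 (c1 1 hx)
    have q0 : A.Lam {a, x, w, c} (dl w) := c3 1 hw 1 ha 1 hx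
    have q1 : A.Lam {x, w, c} (dl w) := da.drop q0
    have q2 : A.Lam {w, c} (dl w) := dx.drop q1
    have u := up0 w q2
    have bd := hw.bd la lx
    by_cases e1 : A.r w = A.r c
    · obtain ⟨m, p1, p2⟩ := hw.circ la lx
      rcases mmlet lx p2 bs (by simp only [Multiset.card_cons]; omega) (show a ∈ _ by simp) with e2 | e2
      · subst e2
        exact two2 la lb h.V.r2 (c1 (-1) e)
      · exact ca (A.inj (lc.trans la.symm) oo)
    · have e2 : A.r w = A.r c + 1 := by omega
      rcases hw.lor la lx oo with e3 | e3
      · obtain rfl := A.inj (e3.trans lx.symm) (e2.trans rx.symm)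
        have q : A.Lam {w, a, b} (dl a) := c1 (-1) hw
        exact h.V.na (e.dom.drop q)
      · obtain rfl := A.inj (e3.trans z2.symm) (show A.r w = A.r z by omega)
        have q : A.Lam {w, x, a, b} (tz • dl a) := c3 (-1) hw 1 z1 (-1) e
        have q' : A.Lam {x, a, b} (tz • dl a) := z1.dom.drop q
        exact h.V.i1 (e.dom.drop q')
  · exact (h.V.na (c1 1 (e.coll ze oo oo))).elim
  · exact lx

theorem noCtx (h : A.Ctx a b M) : False := by
  have ex : ∃ m, A.Cls a b M 1 1 m := by
    obtain ⟨z, z1, z2, z3⟩ := h.V.zz h.hM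
    have ze : A.Ex a b z 1 1 := c1 1 z1
    exact (Ex.low (i := 0) (j := 0) h ze).2.2.2 oo
  obtain ⟨W, c, w, g, hc, k⟩ := CaseB' h le_rfl le_rfl ex
  rcases KS h g hc k with ⟨ha, hb, hM, -, -⟩ | o | o
  · have lc := g.C.1 c hc
    obtain ⟨x, e⟩ := A.ex_pick a b 2 1
    obtain ⟨y, f⟩ := A.ex_pick a b 1 2
    have p := case2b h lc k.1 ha hb hM e
    have p' := case2b h.symm lc k.2.1 hb ha hM f.symm
    exact h.V.ne (A.sep (c1 1 (e.coll f oo oo)))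
  · exact case1 h g hc k o
  · exact case1 h.symm g.symm hc k.symm o

theorem noViol (V : A.Viol a b) : False := by
  classical
  have ex : ∃ M, ∃ c d, A.Viol c d ∧ A.Mn c d M := by
    obtain ⟨M, hM⟩ := mn_ex V.la V.lb
    exact ⟨M, a, b, V, hM⟩
  obtain ⟨c, d, v, hM⟩ := Nat.find_spec ex
  exact noCtx ⟨v, hM, fun c d M' v' m' => Nat.find_min' ex ⟨c, d, v', m'⟩⟩

end Sys


section Fin
universe u
variable {V : Type u} [Fintype V] {G : CTWDR V}

theorem pnum_ne {h i j : ℕ × ℕ} {x y z : V} (e : tdist G.adj x y = h) (h1 : tdist G.adj x z = i)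
    (h2 : tdist G.adj z y = j) : pnum G.adj h i j ≠ 0 := by
  subst e
  rw [pnum_eq]
  have hp : 0 < Set.ncard {w : V | tdist G.adj x w = i ∧ tdist G.adj w y = j} :=
    (Set.ncard_pos (Set.toFinite _)).2 ⟨z, h1, h2⟩
  exact hp.ne'

noncomputable def arcR (G : CTWDR V) (f : ℕ → V) (i : ℕ) : RelG G := ⟨tdist G.adj (f i) (f (i + 1)), _, _, rfl⟩

theorem Wd_range (f : ℕ → V) (n : ℕ) : (Wd ((Multiset.range n).map (arcR G f))).1 (f 0) (f n) := by
  induction n with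
  | zero => simp only [Multiset.range_zero, Multiset.map_zero, Wd_zero]; rfl
  | succ n ih =>
    rw [Multiset.range_succ, Multiset.map_cons, ← Multiset.singleton_add, Wd_add, Wd_single, mul_comm]
    exact ⟨f n, ih, rfl⟩

theorem pure_of [Nonempty V] {s : ℕ} {b : RelG G} (hb : b.1 = (1, s - 1)) (hs : 1 ≤ s)
    (h : (sysG G).PureL b) : G.Pure s := by
  rintro f ⟨-, f1, f2⟩ ⟨i, hi, e⟩ j hj
  have C : (sysG G).Circ ((Multiset.range s).map (arcR G f)) := by
    refine ⟨fun y hy => ?_, (Multiset.range s).map (arcR G f), 0, fun y hy => hy, by simp, by simp, f 0, ?_⟩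
    · obtain ⟨k, hk, rfl⟩ := Multiset.mem_map.1 hy
      exact (dd_one G).2 (f2 k (Multiset.mem_range.1 hk))
    · rw [Wd_zero, Coh.st_one, mul_one]
      have := Wd_range (G := G) f s
      rwa [f1] at this
  have hr : (sysG G).r b = s - 1 := congrArg Prod.snd hb
  have := h _ C (Multiset.mem_map.2 ⟨i, Multiset.mem_range.2 hi, Subtype.ext (e.trans hb.symm)⟩)
    (by rw [Multiset.card_map, Multiset.card_range, hr]; omega) _
    (Multiset.mem_map.2 ⟨j, Multiset.mem_range.2 hj, rfl⟩)
  exact (congrArg Subtype.val this).trans hb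

theorem of_II [Nonempty V] {p q : ℕ} {a b : RelG G} (ha : a.1 = (1, q - 1)) (hb : b.1 = (1, p - 1))
    (h : (sysG G).II a b) : (G.pow (1, q - 1) 2 ∩ G.prodS {(1, p - 1)} {(p - 1, 1)}).Nonempty := by
  have := rigid h (m := ({a} + {a}) + {b}) (n := {b}) (by rintro z (rfl | rfl) <;> simp) (by
    simp only [vec_add, vec_singleton]; module)
  simp only [Wd_add, Wd_single] at this
  obtain ⟨x, y, ⟨w, ⟨z, h1, h2⟩, h3⟩, h4⟩ := this
  rw [cls_def, ha] at h1 h2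
  rw [cls_def] at h3
  have h4' : tdist G.adj x y = b.1 := h4
  rw [hb] at h3 h4'
  refine ⟨tdist G.adj x w, ⟨_, rfl, _, rfl, pnum_ne rfl h1 h2⟩, _, rfl, _, rfl, pnum_ne rfl h4' ?_⟩
  rw [td_swap, h3]; rfl

theorem of_SS [Nonempty V] {p q : ℕ} {a b : RelG G} (ha : a.1 = (1, q - 1)) (hb : b.1 = (1, p - 1))
    (h2 : 2 ≤ (sysG G).r a) (h : (sysG G).SS a b) : G.Cexists q ∧ p = q - 1 := by
  have la : (sysG G).l a = 1 := congrArg Prod.fst ha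
  have lb : (sysG G).l b = 1 := congrArg Prod.fst hb
  have ra : (sysG G).r a = q - 1 := congrArg Prod.snd ha
  have rb : (sysG G).r b = p - 1 := congrArg Prod.snd hb
  have r1 := Sys.r_pos lb
  have c := h.cc la lb h2
  have e := c.1.2.1
  have pq : p = q - 1 := by omega
  refine ⟨⟨?_, ?_⟩, pq⟩
  · have := rigid h (m := {a} + {a}) (n := {b}) (by rintro z (rfl | rfl) <;> simp) (by
      simp only [vec_add, vec_singleton]; module)
    simp only [Wd_add, Wd_single] at this
    obtain ⟨x, y, ⟨z, h1, h2⟩, h4⟩ := this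
    have h4' : tdist G.adj x y = b.1 := h4
    rw [cls_def, ha] at h1 h2
    exact pnum_ne (h4'.trans (hb.trans (by rw [pq, Nat.sub_sub]))) h1 h2
  · rw [← pq]; exact pure_of hb (by omega) c.1.2.2.1

end Fin

/-- Theorem 5.1: for distinct `q, p ∈ T`, one of the following holds:
(i) `C(q)` exists and `p = q-1`; (ii) `C(p)` exists and `q = p-1`;
(iii) `Γ_{1,q-1}^2 ∩ Γ_{1,p-1}Γ_{p-1,1} ≠ ∅`; (iv) `Γ_{1,p-1}^2 ∩ Γ_{1,q-1}Γ_{q-1,1} ≠ ∅`. -/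
theorem stmt15 {V : Type*} [Fintype V] (G : CTWDR V) (p q : ℕ) (hpq : q ≠ p)
    (hp : Attained G.adj (1, p - 1)) (hq : Attained G.adj (1, q - 1)) :
    (G.Cexists q ∧ p = q - 1) ∨ (G.Cexists p ∧ q = p - 1) ∨
    (G.pow (1, q - 1) 2 ∩ G.prodS {(1, p - 1)} {(p - 1, 1)}).Nonempty ∨
    (G.pow (1, p - 1) 2 ∩ G.prodS {(1, q - 1)} {(q - 1, 1)}).Nonempty := by
  have ne : Nonempty V := let ⟨x, _⟩ := hp; ⟨x⟩
  let a : RelG G := ⟨(1, q - 1), hq⟩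
  let b : RelG G := ⟨(1, p - 1), hp⟩
  have ra : 1 ≤ q - 1 := Sys.r_pos (A := sysG G) (a := a) rfl
  have rb : 1 ≤ p - 1 := Sys.r_pos (A := sysG G) (a := b) rfl
  by_cases i1 : (sysG G).II a b
  · exact Or.inr (Or.inr (Or.inl (of_II rfl rfl i1)))
  by_cases i2 : (sysG G).II b a
  · exact Or.inr (Or.inr (Or.inr (of_II rfl rfl i2)))
  have r2 : 2 ≤ (sysG G).r a := by
    by_contra h
    exact i1 (Sys.c1 1 (Sys.two_q (a := a) rfl (show q - 1 = 1 from by have : ¬ 2 ≤ q - 1 := h; omega)))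
  have r2' : 2 ≤ (sysG G).r b := by
    by_contra h
    exact i2 (Sys.c1 1 (Sys.two_q (a := b) rfl (show p - 1 = 1 from by have : ¬ 2 ≤ p - 1 := h; omega)))
  by_cases s1 : (sysG G).SS a b
  · exact Or.inl (of_SS rfl rfl r2 s1)
  by_cases s2 : (sysG G).SS b a
  · exact Or.inr (Or.inl (of_SS rfl rfl r2' s2))
  refine (Sys.noViol (A := sysG G) (a := a) (b := b) ⟨rfl, rfl, fun e => ?_, i1, i2, s1, s2⟩).elim
  have := congrArg (fun x => x.1.2) e
  have : q - 1 = p - 1 := this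
  omega
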